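/- arXiv:1406.6517 — 2 statements merged into one kernel-verified Lean document; each statement's English description precedes it below -/
import Mathlib

section
/- Let G be a homogeneous m-generic L-graph and let 𝒜 ⊆ O(G) be a C_{ij}-cover set such that for some distinct k, l ∈ {0,…,m−1} ∖ {i,j}, O(G) contains a C_{ij}^{kl}-omission set based on 𝒜. Then there are distinct k', l' ∈ {0,…,m−1} ∖ {i,j} such that O(G) contains a C_{ij}^{k'l'}-omission set based on triangles from 𝒜; in particular 𝒜 contains at least one ijk'-triangle and at least one ijl'-triangle. -/
/-!
Common framework: coloured multipartite graphs in a finite language `L`.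
Colours are natural numbers; for each pair of distinct parts `i j : Fin m`
there is a finite nonempty colour set `C i j`.
-/

/-- A finite language for coloured `m`-partite graphs. -/
structure MLang (m : ℕ) where
  C : Fin m → Fin m → Finset ℕ
  symm : ∀ i j, C i j = C j i
  nonempty : ∀ i j, i ≠ j → (C i j).Nonempty

/-- A coloured `m`-partite `L`-graph: vertices partitioned into parts `V_0, …, V_{m-1}`,
with a symmetric colouring of cross-part pairs taking values in the colour sets of `L`.
(The value of `colour` on pairs within a part is irrelevant junk data.) -/
structure LGraph {m : ℕ} (L : MLang m) where
  V : Type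
  part : V → Fin m
  colour : V → V → ℕ
  colour_symm : ∀ x y, colour x y = colour y x
  colour_mem : ∀ x y, part x ≠ part y → colour x y ∈ L.C (part x) (part y)

namespace LGraph

variable {m : ℕ} {L : MLang m}

/-- The induced subgraph of `A` on a set `S` of its vertices. -/
def restrict (A : LGraph L) (S : Set A.V) : LGraph L where
  V := S
  part x := A.part x.1
  colour x y := A.colour x.1 y.1
  colour_symm := fun x y => A.colour_symm x.1 y.1
  colour_mem := fun x y h => A.colour_mem x.1 y.1 h

/-- `f` is an embedding of `A` into `G`: injective, part-preserving, colour-preserving. -/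
def IsEmbedding (A G : LGraph L) (f : A.V → G.V) : Prop :=
  Function.Injective f ∧ (∀ x, G.part (f x) = A.part x) ∧
    ∀ x y : A.V, A.part x ≠ A.part y → G.colour (f x) (f y) = A.colour x y

/-- `A` is realized in `G`, i.e. `A` embeds into `G`. -/
def Realized (G A : LGraph L) : Prop := ∃ f : A.V → G.V, IsEmbedding A G f

/-- `A` and `B` are isomorphic `L`-graphs. -/
def IsIsomorphic (A B : LGraph L) : Prop :=
  ∃ f : A.V → B.V, IsEmbedding A B f ∧ Function.Surjective f

/-- `φ` restricted to `S` is an isomorphism between induced subgraphs of `G`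
(a partial automorphism of `G`). -/
def IsPartialIso (G : LGraph L) (S : Set G.V) (φ : G.V → G.V) : Prop :=
  Set.InjOn φ S ∧ (∀ x ∈ S, G.part (φ x) = G.part x) ∧
    ∀ x ∈ S, ∀ y ∈ S, G.part x ≠ G.part y → G.colour (φ x) (φ y) = G.colour x y

/-- `G` is homogeneous: every isomorphism between finite induced subgraphs of `G`
extends to an automorphism of `G`. -/
def Homogeneous (G : LGraph L) : Prop :=
  ∀ S : Set G.V, S.Finite → ∀ φ : G.V → G.V, G.IsPartialIso S φ →
    ∃ ψ : G.V ≃ G.V, (∀ x, G.part (ψ x) = G.part x) ∧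
      (∀ x y : G.V, G.part x ≠ G.part y → G.colour (ψ x) (ψ y) = G.colour x y) ∧
      ∀ x ∈ S, ψ x = φ x

/-- `G` is `m`-generic: every part is countably infinite and every bipartite
restriction is generic. -/
def Generic (G : LGraph L) : Prop :=
  Countable G.V ∧ (∀ i : Fin m, {x : G.V | G.part x = i}.Infinite) ∧
    ∀ i j : Fin m, i ≠ j → ∀ U : Finset G.V, (∀ u ∈ U, G.part u = i) →
      ∀ f : G.V → ℕ, (∀ u ∈ U, f u ∈ L.C i j) →
        ∃ x : G.V, G.part x = j ∧ ∀ u ∈ U, G.colour x u = f u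

/-- `A` is minimally omitted from `G` (membership in `O(G)`): `A` is finite and omitted,
but every proper induced subgraph of `A` is realized in `G`. -/
def MinOmitted (G A : LGraph L) : Prop :=
  Finite A.V ∧ ¬ G.Realized A ∧ ∀ S : Set A.V, S ≠ Set.univ → G.Realized (A.restrict S)

/-- `A` is monic: at most one vertex in each part. -/
def Monic (A : LGraph L) : Prop := ∀ x y : A.V, A.part x = A.part y → x = y

/-- `A` covers colour `c` on the restriction `V_i V_j`: it has vertices in `V_i` and `V_j`
joined by a `c`-coloured edge. -/
def Covers (A : LGraph L) (i j : Fin m) (c : ℕ) : Prop :=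
  ∃ x y : A.V, A.part x = i ∧ A.part y = j ∧ A.colour x y = c

/-- `A` is an `ijk`-triangle: a monic with vertices in exactly the parts `V_i, V_j, V_k`. -/
def IsTriangleOn (A : LGraph L) (i j k : Fin m) : Prop :=
  A.Monic ∧ (∀ x : A.V, A.part x = i ∨ A.part x = j ∨ A.part x = k) ∧
    (∃ x : A.V, A.part x = i) ∧ (∃ x : A.V, A.part x = j) ∧ (∃ x : A.V, A.part x = k)

/-- `A` is a triangle: an `ijk`-triangle for some pairwise distinct `i, j, k`. -/
def IsTriangle (A : LGraph L) : Prop :=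
  ∃ i j k : Fin m, i ≠ j ∧ i ≠ k ∧ j ≠ k ∧ A.IsTriangleOn i j k

end LGraph

open LGraph

variable {m : ℕ} {L : MLang m}

/-- A `C_{ij}`-cover set: a set of monics covering every colour of `C i j` on `V_i V_j`. -/
def IsCoverSet (𝒜 : Set (LGraph L)) (i j : Fin m) : Prop :=
  (∀ A ∈ 𝒜, A.Monic) ∧ ∀ c ∈ L.C i j, ∃ A ∈ 𝒜, A.Covers i j c

/-- A `C_{ij}^{kl}`-omission set with code `(i,j,k,l; cik, cil, cjk, cjl)`:
a `C_{ij}`-cover set of `ijk`-triangles and `ijl`-triangles all of whose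
`E_{ik}, E_{il}, E_{jk}, E_{jl}`-edges have the indicated colours. -/
def IsOmissionSet (S : Set (LGraph L)) (i j k l : Fin m) (cik cil cjk cjl : ℕ) : Prop :=
  IsCoverSet S i j ∧
  (∀ A ∈ S, A.IsTriangleOn i j k ∨ A.IsTriangleOn i j l) ∧
  (∀ A ∈ S, ∀ x y : A.V, A.part x = i → A.part y = k → A.colour x y = cik) ∧
  (∀ A ∈ S, ∀ x y : A.V, A.part x = i → A.part y = l → A.colour x y = cil) ∧
  (∀ A ∈ S, ∀ x y : A.V, A.part x = j → A.part y = k → A.colour x y = cjk) ∧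
  (∀ A ∈ S, ∀ x y : A.V, A.part x = j → A.part y = l → A.colour x y = cjl)

/-- The code `(i,j,k,l; cik, cil, cjk, cjl)` is based on the cover set `𝒜`. -/
def BasedOn (𝒜 : Set (LGraph L)) (i j k l : Fin m) (cik cil cjk cjl : ℕ) : Prop :=
  ∃ A ∈ 𝒜, ∃ A' ∈ 𝒜,
    A.Covers i k cik ∧ A.Covers j k cjk ∧ A'.Covers i l cil ∧ A'.Covers j l cjl

/-- The code `(i,j,k,l; cik, cil, cjk, cjl)` is based on triangles from the cover set `𝒜`. -/
def BasedOnTriangles (𝒜 : Set (LGraph L)) (i j k l : Fin m) (cik cil cjk cjl : ℕ) : Prop :=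
  ∃ A ∈ 𝒜, ∃ A' ∈ 𝒜, A.IsTriangle ∧ A'.IsTriangle ∧
    A.Covers i k cik ∧ A.Covers j k cjk ∧ A'.Covers i l cil ∧ A'.Covers j l cjl

/-- The age of `G`: the class of finite `L`-graphs embedding into `G`. -/
def Age (G : LGraph L) : Set (LGraph L) := {A | Finite A.V ∧ G.Realized A}

/-- `Forb F`: the class of finite `L`-graphs into which no member of `F` embeds. -/
def Forb (F : Set (LGraph L)) : Set (LGraph L) :=
  {B | Finite B.V ∧ ∀ A ∈ F, ¬ B.Realized A}

/-- An amalgamation class: a class of finite `L`-graphs closed under isomorphism and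
induced subgraphs with the amalgamation property. -/
def IsAmalgamationClass (𝒞 : Set (LGraph L)) : Prop :=
  (∀ A ∈ 𝒞, Finite A.V) ∧
  (∀ A ∈ 𝒞, ∀ B : LGraph L, A.IsIsomorphic B → B ∈ 𝒞) ∧
  (∀ A ∈ 𝒞, ∀ S : Set A.V, A.restrict S ∈ 𝒞) ∧
  ∀ A B₁ B₂ : LGraph L, A ∈ 𝒞 → B₁ ∈ 𝒞 → B₂ ∈ 𝒞 →
    ∀ (f₁ : A.V → B₁.V) (f₂ : A.V → B₂.V),
      IsEmbedding A B₁ f₁ → IsEmbedding A B₂ f₂ →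
      ∃ C ∈ 𝒞, ∃ (g₁ : B₁.V → C.V) (g₂ : B₂.V → C.V),
        IsEmbedding B₁ C g₁ ∧ IsEmbedding B₂ C g₂ ∧ g₁ ∘ f₁ = g₂ ∘ f₂

section Parts01

variable [NeZero m]

/-- `A ≤₀₁ B`: `A` is an off-`E_{01}`-subgraph of `B`, i.e. `A` embeds into `B` ignoring
the colours of edges between `V_0` and `V_1` (equivalently, `A` embeds into the graph
obtained from `B` by recolouring its `E_{01}`-edge with the `E_{01}`-colour of `A`). -/
def Le01 (A B : LGraph L) : Prop :=
  ∃ f : A.V → B.V, Function.Injective f ∧ (∀ x, B.part (f x) = A.part x) ∧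
    ∀ x y : A.V, A.part x ≠ A.part y →
      ¬((A.part x = 0 ∧ A.part y = 1) ∨ (A.part x = 1 ∧ A.part y = 0)) →
      B.colour (f x) (f y) = A.colour x y

/-- `A` and `B` are off-`E_{01}`-isomorphic. -/
def OffIso01 (A B : LGraph L) : Prop := Le01 A B ∧ Le01 B A

/-- `A` is a maximal element of the quasi-order `(𝒜, ≤₀₁)`. -/
def MaxIn (𝒜 : Set (LGraph L)) (A : LGraph L) : Prop :=
  A ∈ 𝒜 ∧ ∀ B ∈ 𝒜, Le01 A B → Le01 B A

/-- `𝒜 ∈ Λ`: a `C_{01}`-cover set contained in `O(G)` of size exactly `|C_{01}|`. -/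
def InLambda (G : LGraph L) (𝒜 : Set (LGraph L)) : Prop :=
  (∀ A ∈ 𝒜, G.MinOmitted A) ∧ IsCoverSet 𝒜 0 1 ∧ 𝒜.ncard = (L.C 0 1).card

/-- The graph obtained from `A` by recolouring its `E_{01}`-edge with `α`
(that is, `A^{c/α}` where `c` is the `E_{01}`-colour of `A`) is realized in `G`. -/
def RealizedRecoloured01 (G A : LGraph L) (α : ℕ) : Prop :=
  ∃ f : A.V → G.V, Function.Injective f ∧ (∀ x, G.part (f x) = A.part x) ∧
    (∀ x y : A.V, A.part x ≠ A.part y →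
      ¬((A.part x = 0 ∧ A.part y = 1) ∨ (A.part x = 1 ∧ A.part y = 0)) →
      G.colour (f x) (f y) = A.colour x y) ∧
    ∀ x y : A.V, A.part x = 0 → A.part y = 1 → G.colour (f x) (f y) = α

/-- `Ω₀₁(𝒜) ⊆ Ω₀₁(ℬ)`: every code `(0,1,k,l; c_{0k}, c_{0l}, c_{1k}, c_{1l})`
based on `𝒜` is based on `ℬ`. -/
def Omega01Le (𝒜 ℬ : Set (LGraph L)) : Prop :=
  ∀ k l : Fin m, k ≠ l → k ≠ 0 → k ≠ 1 → l ≠ 0 → l ≠ 1 →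
    ∀ c0k c0l c1k c1l : ℕ,
      BasedOn 𝒜 0 1 k l c0k c0l c1k c1l → BasedOn ℬ 0 1 k l c0k c0l c1k c1l

/-- `ℬ` is a good `C_{01}`-cover set (for `G`): there is a key colour `α ∈ C_{01}` with key
monic `A^α ∈ ℬ` such that every member of `ℬ`, after recolouring its `E_{01}`-edge by `α`,
is either an (off-`E_{01}`-)subgraph of `A^α` or realized in `G`. -/
def GoodCoverSet (G : LGraph L) (ℬ : Set (LGraph L)) : Prop :=
  ∃ α ∈ L.C 0 1, ∃ Aα ∈ ℬ, Aα.Covers 0 1 α ∧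
    ∀ A ∈ ℬ, Le01 A Aα ∨ RealizedRecoloured01 G A α

/-- `ℬ` is a star `C_{01}`-cover set: good, with a key monic which either has vertices
in at least four parts, or has vertices in exactly three parts `V_0, V_1, V_i` while no
other member of `ℬ` has vertices in all of the remaining parts. -/
def StarCoverSet (G : LGraph L) (ℬ : Set (LGraph L)) : Prop :=
  ∃ α ∈ L.C 0 1, ∃ Aα ∈ ℬ, Aα.Covers 0 1 α ∧
    (∀ A ∈ ℬ, Le01 A Aα ∨ RealizedRecoloured01 G A α) ∧
    (4 ≤ (Set.range Aα.part).ncard ∨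
      ∃ i : Fin m, i ≠ 0 ∧ i ≠ 1 ∧ Set.range Aα.part = {0, 1, i} ∧
        ∀ B ∈ ℬ, B ≠ Aα → ∃ p : Fin m, p ≠ 0 ∧ p ≠ 1 ∧ p ≠ i ∧ p ∉ Set.range B.part)

/-- `B` is a copy of the monic `B^{cd}` (relative to the background colours `α`): a monic
with exactly one vertex in every part, `E_{01}`-colour `c`, `E_{12}`-colour `d`, and
`E_{ij}`-colour `α i j` for every other pair of distinct parts. -/
def IsBcd (B : LGraph L) (α : Fin m → Fin m → ℕ) (c d : ℕ) : Prop :=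
  B.Monic ∧ (∀ i : Fin m, ∃ x : B.V, B.part x = i) ∧
  (∀ x y : B.V, B.part x = 0 → B.part y = 1 → B.colour x y = c) ∧
  (∀ x y : B.V, B.part x = 1 → B.part y = 2 → B.colour x y = d) ∧
  (∀ x y : B.V, B.part x ≠ B.part y →
    ¬((B.part x = 0 ∧ B.part y = 1) ∨ (B.part x = 1 ∧ B.part y = 0)) →
    ¬((B.part x = 1 ∧ B.part y = 2) ∨ (B.part x = 2 ∧ B.part y = 1)) →
    B.colour x y = α (B.part x) (B.part y))

end Parts01

namespace OmS

/-- Normalised colour: zero inside a part. -/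
def col (G : LGraph L) (u v : G.V) : ℕ := if G.part u = G.part v then 0 else G.colour u v

lemma col_symm (G : LGraph L) (u v : G.V) : col G u v = col G v u := by
  unfold col
  by_cases h : G.part u = G.part v
  · simp [h]
  · rw [if_neg h, if_neg (fun h' => h h'.symm), G.colour_symm]

lemma col_same (G : LGraph L) {u v : G.V} (h : G.part u = G.part v) : col G u v = 0 := by
  simp [col, h]

lemma col_ne (G : LGraph L) {u v : G.V} (h : G.part u ≠ G.part v) :
    col G u v = G.colour u v := by
  simp [col, h]

lemma hom_ext {G : LGraph L} (hG : G.Homogeneous) {Λ : Type} (A : Set Λ) (hA : A.Finite)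
    (f g : Λ → G.V) (hf : Set.InjOn f A) (hg : Set.InjOn g A)
    (hp : ∀ u ∈ A, G.part (g u) = G.part (f u))
    (hc : ∀ u ∈ A, ∀ v ∈ A, col G (g u) (g v) = col G (f u) (f v)) :
    ∃ ψ : G.V ≃ G.V, (∀ x, G.part (ψ x) = G.part x) ∧
      (∀ x y, col G (ψ x) (ψ y) = col G x y) ∧ ∀ u ∈ A, ψ (f u) = g u := by
  classical
  let φ : G.V → G.V := fun x => if h : ∃ u ∈ A, f u = x then g h.choose else x
  have hφ : ∀ u ∈ A, φ (f u) = g u := by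
    intro u hu
    have h : ∃ v ∈ A, f v = f u := ⟨u, hu, rfl⟩
    simp only [φ, dif_pos h]
    rw [hf h.choose_spec.1 hu h.choose_spec.2]
  obtain ⟨ψ, h1, h2, h3⟩ := hG (f '' A) (hA.image f) φ (by
    refine ⟨?_, ?_, ?_⟩
    · rintro _ ⟨u, hu, rfl⟩ _ ⟨v, hv, rfl⟩ h
      rw [hφ u hu, hφ v hv] at h
      rw [hg hu hv h]
    · rintro _ ⟨u, hu, rfl⟩
      rw [hφ u hu, hp u hu]
    · rintro _ ⟨u, hu, rfl⟩ _ ⟨v, hv, rfl⟩ h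
      rw [hφ u hu, hφ v hv]
      have := hc u hu v hv
      rwa [col_ne G h, col_ne G (by rwa [hp u hu, hp v hv])] at this)
  refine ⟨ψ, h1, ?_, ?_⟩
  · intro x y
    by_cases h : G.part x = G.part y
    · rw [col_same G h, col_same G (by rw [h1, h1, h])]
    · rw [col_ne G h, col_ne G (by rwa [h1, h1]), h2 x y h]
  · intro u hu
    rw [h3 _ ⟨u, hu, rfl⟩, hφ u hu]

/-- Generic extension avoiding a finite set. -/
lemma gen_avoid {G : LGraph L} (hgen : G.Generic) (i j : Fin m) (hij : i ≠ j) (a b : ℕ)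
    (ha : a ∈ L.C i j) (hb : b ∈ L.C i j) (hab : a ≠ b)
    (U : Finset G.V) (hU : ∀ u ∈ U, G.part u = i) (f : G.V → ℕ)
    (hf : ∀ u ∈ U, f u ∈ L.C i j) (W : Finset G.V) :
    ∃ x, G.part x = j ∧ (∀ u ∈ U, G.colour x u = f u) ∧ x ∉ W := by
  classical
  induction W using Finset.induction_on generalizing U f with
  | empty =>
    obtain ⟨x, h1, h2⟩ := hgen.2.2 i j hij U hU f hf
    exact ⟨x, h1, h2, by simp⟩
  | insert w W hw ih =>
    obtain ⟨z, hz, hzU⟩ := (hgen.2.1 i).exists_notMem_finset U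
    let c := if G.colour w z = a then b else a
    obtain ⟨x, h1, h2, h3⟩ := ih (insert z U) (by
        intro u hu
        rcases Finset.mem_insert.1 hu with rfl | hu
        · exact hz
        · exact hU u hu) (fun u => if u = z then c else f u) (by
        intro u hu
        by_cases h : u = z
        · simp only [h, if_true, c]
          split_ifs
          · exact hb
          · exact ha
        · simp only [h, if_false]
          exact hf u ((Finset.mem_insert.1 hu).resolve_left h))
    refine ⟨x, h1, ?_, ?_⟩
    · intro u hu
      have := h2 u (Finset.mem_insert_of_mem hu)
      rwa [if_neg (by rintro rfl; exact hzU hu)] at this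
    · rw [Finset.mem_insert, not_or]
      refine ⟨?_, h3⟩
      rintro rfl
      have := h2 z (Finset.mem_insert_self _ _)
      simp only [if_true, c] at this
      split_ifs at this with h
      · exact hab (h.symm.trans this)
      · exact h this

/-- No algebraicity. -/
lemma noalg {G : LGraph L} (hG : G.Homogeneous) (hgen : G.Generic) (B : Finset G.V) :
    ∀ u, u ∉ B → {v | G.part v = G.part u ∧ ∀ b ∈ B, col G v b = col G u b}.Infinite := by
  classical
  induction B using Finset.induction_on with
  | empty =>
    intro u _
    simpa using hgen.2.1 (G.part u)
  | insert b D hbD ih =>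
    intro u hu
    rw [Finset.mem_insert, not_or] at hu
    obtain ⟨hub, huD⟩ := hu
    by_cases hp : G.part u = G.part b
    · refine (ih u huD).mono ?_
      rintro v ⟨h1, h2⟩
      refine ⟨h1, ?_⟩
      intro z hz
      rcases Finset.mem_insert.1 hz with rfl | hz
      · rw [col_same G hp, col_same G (h1.trans hp)]
      · exact h2 z hz
    by_cases hs : ∀ a ∈ L.C (G.part u) (G.part b), ∀ c ∈ L.C (G.part u) (G.part b), a = c
    · refine (ih u huD).mono ?_
      rintro v ⟨h1, h2⟩
      refine ⟨h1, ?_⟩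
      intro z hz
      rcases Finset.mem_insert.1 hz with rfl | hz
      · have hvz : G.part v ≠ G.part z := by rwa [h1]
        rw [col_ne G hp, col_ne G hvz]
        refine hs _ ?_ _ (G.colour_mem _ _ hp)
        have := G.colour_mem _ _ hvz
        rwa [h1] at this
      · exact h2 z hz
    push Not at hs
    obtain ⟨a, ha, c, hc, hac⟩ := hs
    by_contra hfin
    rw [Set.not_infinite] at hfin
    set K := hfin.toFinset \ (insert b D) with hK
    have memK : ∀ v, v ∈ K ↔ (G.part v = G.part u ∧ ∀ z ∈ insert b D, col G v z = col G u z)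
        ∧ v ∉ insert b D := by
      intro v
      rw [hK, Finset.mem_sdiff, Set.Finite.mem_toFinset]
      rfl
    have huK : u ∈ K := (memK u).2 ⟨⟨rfl, fun _ _ => rfl⟩, by simp [hub, huD]⟩
    obtain ⟨u', hu', hu'n⟩ := (ih u huD).exists_notMem_finset (K ∪ insert b D)
    rw [Finset.mem_union, not_or] at hu'n
    obtain ⟨hu'K, hu'B⟩ := hu'n
    have hu'D : u' ∉ D := fun h => hu'B (Finset.mem_insert_of_mem h)
    -- σ fixes D and sends u to u'
    obtain ⟨σ, σ1, σ2, σ3⟩ := hom_ext hG (insert u (D : Set G.V)) (D.finite_toSet.insert u)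
      id (fun v => if v = u then u' else v) (Set.injOn_id _) (by
        intro v hv w hw h
        by_cases h1 : v = u <;> by_cases h2 : w = u
        · rw [h1, h2]
        · simp only [h1, h2, if_true, if_false] at h
          exact absurd (hw.resolve_left h2) (by rw [← h]; exact hu'D)
        · simp only [h1, h2, if_true, if_false] at h
          exact absurd (hv.resolve_left h1) (by rw [h]; exact hu'D)
        · simpa only [h1, h2, if_false] using h) (by
        intro v hv
        by_cases h1 : v = u
        · simp [h1, hu'.1]
        · simp [h1]) (by
        intro v hv w hw
        by_cases h1 : v = u <;> by_cases h2 : w = u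
        · simp [h1, h2, col_same]
        · simp only [h1, h2, if_true, if_false, id]
          exact hu'.2 w (hw.resolve_left h2)
        · simp only [h1, h2, if_true, if_false, id]
          rw [col_symm G v u', col_symm G v u]
          exact hu'.2 v (hv.resolve_left h1)
        · simp [h1, h2])
    have σu : σ u = u' := by simpa using σ3 u (Set.mem_insert _ _)
    have σD : ∀ d ∈ D, σ d = d := by
      intro d hd
      have := σ3 d (Set.mem_insert_of_mem _ hd)
      rw [if_neg (by rintro rfl; exact huD hd)] at this
      exact this
    -- choose w
    obtain ⟨w, w1, w2, w3⟩ := gen_avoid hgen _ _ hp a c ha hc hac (insert u' K) (by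
        intro v hv
        rcases Finset.mem_insert.1 hv with rfl | hv
        · exact hu'.1
        · exact ((memK v).1 hv).1.1) (fun v => if v = u' then c else a) (by
        intro v _
        split_ifs
        · exact hc
        · exact ha) (insert b D ∪ (insert b D).image σ)
    rw [Finset.mem_union, not_or] at w3
    obtain ⟨wB, wσB⟩ := w3
    set w' := σ.symm w with hw'
    have hw'w : σ w' = w := by simp [hw']
    have w'B : w' ∉ insert b D := by
      intro h
      exact wσB (Finset.mem_image.2 ⟨w', h, hw'w⟩)
    have w'p : G.part w' = G.part b := by rw [← σ1, hw'w, w1]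
    obtain ⟨ψ, ψ1, ψ2, ψ3⟩ := hom_ext hG (insert w' ((insert b D : Finset G.V) : Set G.V))
      ((insert b D).finite_toSet.insert w')
      id (fun v => if v = w' then w else v) (Set.injOn_id _) (by
        intro v hv x hx h
        by_cases h1 : v = w' <;> by_cases h2 : x = w'
        · rw [h1, h2]
        · simp only [h1, h2, if_true, if_false] at h
          exact absurd (hx.resolve_left h2) (by rw [← h]; exact wB)
        · simp only [h1, h2, if_true, if_false] at h
          exact absurd (hv.resolve_left h1) (by rw [h]; exact wB)
        · simpa only [h1, h2, if_false] using h) (by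
        intro v hv
        by_cases h1 : v = w'
        · simp [h1, w1, w'p]
        · simp [h1]) (by
        have key : ∀ v ∈ insert b D, col G w v = col G w' v := by
          intro v hv
          rcases Finset.mem_insert.1 hv with rfl | hv
          · rw [col_same G w1, col_same G w'p]
          · rw [← σ2 w' v, hw'w, σD v hv]
        intro v hv x hx
        by_cases h1 : v = w' <;> by_cases h2 : x = w'
        · simp [h1, h2, col_same]
        · simp only [h1, h2, if_true, if_false, id]
          exact key x (hx.resolve_left h2)
        · simp only [h1, h2, if_true, if_false, id]
          rw [col_symm G v w, col_symm G v w']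
          exact key v (hv.resolve_left h1)
        · simp [h1, h2])
    have ψw : ψ w' = w := by simpa using ψ3 w' (Set.mem_insert _ _)
    have ψB : ∀ d ∈ insert b D, ψ d = d := by
      intro d hd
      have := ψ3 d (Set.mem_insert_of_mem _ hd)
      rw [if_neg (by rintro rfl; exact w'B hd)] at this
      exact this
    have ψu : ψ u ∈ K := by
      rw [memK]
      refine ⟨⟨ψ1 u, ?_⟩, ?_⟩
      · intro z hz
        conv_lhs => rw [← ψB z hz]
        rw [ψ2]
      · intro h
        have h4 := ψB _ h
        have : ψ u = u := ψ.injective h4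
        rw [this] at h
        exact ((memK u).1 huK).2 h
    have wp : ∀ v, G.part v = G.part u → G.part w ≠ G.part v := by
      intro v hv h
      exact hp (by rw [← hv, ← h, w1])
    have e1 : col G w (ψ u) = a := by
      rw [col_ne G (wp _ (ψ1 u)), w2 _ (Finset.mem_insert_of_mem ψu),
        if_neg (by rintro h; exact hu'K (h ▸ ψu))]
    have e2 : col G w u' = c := by
      rw [col_ne G (wp _ hu'.1), w2 _ (Finset.mem_insert_self _ _), if_pos rfl]
    have e3 : col G w' u = a := by rw [← ψ2, ψw, e1]
    have e4 : col G w u' = col G w' u := by rw [← σ2 w' u, hw'w, σu]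
    exact hac (by rw [← e3, ← e4, e2])

/-- A part- and colour-preserving map can be made injective. -/
lemma make_inj {G : LGraph L} (hG : G.Homogeneous) (hgen : G.Generic) {Λ : Type}
    (A : Set Λ) (hA : A.Finite) (f : Λ → G.V) :
    ∃ f' : Λ → G.V, Set.InjOn f' A ∧ (∀ u ∈ A, G.part (f' u) = G.part (f u)) ∧
      ∀ u ∈ A, ∀ v ∈ A, col G (f' u) (f' v) = col G (f u) (f v) := by
  classical
  lift A to Finset Λ using hA
  suffices h : ∀ B : Finset Λ, B ⊆ A → ∃ f' : Λ → G.V,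
      (∀ u ∈ B, ∀ v ∈ A, u ≠ v → f' u ≠ f' v) ∧ (∀ u ∈ A, G.part (f' u) = G.part (f u)) ∧
      ∀ u ∈ A, ∀ v ∈ A, col G (f' u) (f' v) = col G (f u) (f v) by
    obtain ⟨f', h1, h2, h3⟩ := h A (Finset.Subset.refl _)
    refine ⟨f', ?_, h2, h3⟩
    intro u hu v hv h
    by_contra hne
    exact h1 u hu v hv hne h
  intro B
  induction B using Finset.induction_on with
  | empty => exact fun _ => ⟨f, by simp, fun _ _ => rfl, fun _ _ _ _ => rfl⟩
  | insert w B hw ih =>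
    intro hB
    obtain ⟨f', h1, h2, h3⟩ := ih (fun x hx => hB (Finset.mem_insert_of_mem hx))
    have hwA : w ∈ A := hB (Finset.mem_insert_self _ _)
    obtain ⟨v, hv, hvn⟩ := (noalg hG hgen ((A.image f').erase (f' w)) (f' w)
      (Finset.notMem_erase _ _)).exists_notMem_finset (A.image f')
    have hcol : ∀ u ∈ A, col G v (f' u) = col G (f' w) (f' u) := by
      intro u hu
      by_cases h : f' u = f' w
      · rw [h, col_same G hv.1, col_same G rfl]
      · exact hv.2 _ (Finset.mem_erase.2 ⟨h, Finset.mem_image_of_mem _ hu⟩)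
    have hvne : ∀ u ∈ A, v ≠ f' u := by
      rintro u hu rfl
      exact hvn (Finset.mem_image_of_mem _ hu)
    refine ⟨Function.update f' w v, ?_, ?_, ?_⟩
    · intro u hu x hx hux
      by_cases huw : u = w
      · subst huw
        rw [Function.update_self, Function.update_of_ne (Ne.symm hux)]
        exact hvne x hx
      · have huB : u ∈ B := (Finset.mem_insert.1 hu).resolve_left huw
        rw [Function.update_of_ne huw]
        by_cases hxw : x = w
        · subst hxw
          rw [Function.update_self]
          exact (hvne u (hB hu)).symm
        · rw [Function.update_of_ne hxw]
          exact h1 u huB x hx hux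
    · intro u hu
      by_cases huw : u = w
      · subst huw
        rw [Function.update_self, hv.1, h2 u hu]
      · rw [Function.update_of_ne huw, h2 u hu]
    · intro u hu x hx
      by_cases huw : u = w <;> by_cases hxw : x = w
      · subst huw; subst hxw
        rw [col_same G rfl, col_same G rfl]
      · subst huw
        rw [Function.update_self, Function.update_of_ne hxw, hcol x hx, h3 u hu x hx]
      · subst hxw
        rw [Function.update_self, Function.update_of_ne huw, col_symm G _ v, hcol u hu,
          col_symm G _ (f' u), h3 u hu x hx]
      · rw [Function.update_of_ne huw, Function.update_of_ne hxw, h3 u hu x hx]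

/-- Realizability of a coloured diagram on a set of labels. -/
def Rz (G : LGraph L) {Λ : Type} (A : Set Λ) (pt : Λ → Fin m) (κ : Λ → Λ → ℕ) : Prop :=
  ∃ f : Λ → G.V, (∀ u ∈ A, G.part (f u) = pt u) ∧
    ∀ u ∈ A, ∀ v ∈ A, col G (f u) (f v) = κ u v

lemma Rz.pull {G : LGraph L} {Λ Λ' : Type} {A : Set Λ} {pt : Λ → Fin m} {κ : Λ → Λ → ℕ}
    (h : Rz G A pt κ) (e : Λ' → Λ) (A' : Set Λ') (pt' : Λ' → Fin m) (κ' : Λ' → Λ' → ℕ)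
    (h1 : ∀ u ∈ A', e u ∈ A) (h2 : ∀ u ∈ A', pt' u = pt (e u))
    (h3 : ∀ u ∈ A', ∀ v ∈ A', κ' u v = κ (e u) (e v)) : Rz G A' pt' κ' := by
  obtain ⟨f, f1, f2⟩ := h
  refine ⟨f ∘ e, ?_, ?_⟩
  · intro u hu
    rw [h2 u hu]; exact f1 _ (h1 u hu)
  · intro u hu v hv
    rw [h3 u hu v hv]; exact f2 _ (h1 u hu) _ (h1 v hv)

lemma Rz.sub {G : LGraph L} {Λ : Type} {A A' : Set Λ} {pt : Λ → Fin m} {κ κ' : Λ → Λ → ℕ}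
    (h : Rz G A pt κ) (h1 : A' ⊆ A)
    (h3 : ∀ u ∈ A', ∀ v ∈ A', κ' u v = κ u v) : Rz G A' pt κ' :=
  h.pull id A' pt κ' (fun u hu => h1 hu) (fun _ _ => rfl) h3

lemma Rz.am {G : LGraph L} (hG : G.Homogeneous) (hgen : G.Generic) {Λ : Type} {A B : Set Λ}
    {pt : Λ → Fin m} {κ₁ κ₂ : Λ → Λ → ℕ} (hA : A.Finite) (hB : B.Finite)
    (h1 : Rz G A pt κ₁) (h2 : Rz G B pt κ₂)
    (h : ∀ u ∈ A ∩ B, ∀ v ∈ A ∩ B, κ₁ u v = κ₂ u v) :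
    ∃ κ : Λ → Λ → ℕ, Rz G (A ∪ B) pt κ ∧ (∀ u ∈ A, ∀ v ∈ A, κ u v = κ₁ u v) ∧
      ∀ u ∈ B, ∀ v ∈ B, κ u v = κ₂ u v := by
  classical
  obtain ⟨f₀, f1, f2⟩ := h1
  obtain ⟨g₀, g1, g2⟩ := h2
  obtain ⟨f, fi, fp, fc⟩ := make_inj hG hgen A hA f₀
  obtain ⟨g, gi, gp, gc⟩ := make_inj hG hgen B hB g₀
  obtain ⟨ψ, ψ1, ψ2, ψ3⟩ := hom_ext hG (A ∩ B) (hA.inter_of_left B) g f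
    (gi.mono Set.inter_subset_right) (fi.mono Set.inter_subset_left)
    (fun u hu => by rw [fp u hu.1, gp u hu.2, f1 u hu.1, g1 u hu.2])
    (fun u hu v hv => by
      rw [fc u hu.1 v hv.1, gc u hu.2 v hv.2, f2 u hu.1 v hv.1, g2 u hu.2 v hv.2, h u hu v hv])
  let k : Λ → G.V := fun u => if u ∈ A then f u else ψ (g u)
  have kA : ∀ u ∈ A, k u = f u := fun u hu => if_pos hu
  have kB : ∀ u ∈ B, k u = ψ (g u) := by
    intro u hu
    by_cases h : u ∈ A
    · rw [kA u h, ψ3 u ⟨h, hu⟩]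
    · exact if_neg h
  refine ⟨fun u v => col G (k u) (k v), ⟨k, ?_, fun _ _ _ _ => rfl⟩, ?_, ?_⟩
  · rintro u (hu | hu)
    · rw [kA u hu, fp u hu, f1 u hu]
    · rw [kB u hu, ψ1, gp u hu, g1 u hu]
  · intro u hu v hv
    dsimp only
    rw [kA u hu, kA v hv, fc u hu v hv, f2 u hu v hv]
  · intro u hu v hv
    dsimp only
    rw [kB u hu, kB v hv, ψ2, gc u hu v hv, g2 u hu v hv]

lemma Rz.symm {G : LGraph L} {Λ : Type} {A : Set Λ} {pt : Λ → Fin m} {κ : Λ → Λ → ℕ}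
    (h : Rz G A pt κ) {u v : Λ} (hu : u ∈ A) (hv : v ∈ A) : κ u v = κ v u := by
  obtain ⟨f, f1, f2⟩ := h
  rw [← f2 u hu v hv, ← f2 v hv u hu, col_symm]

lemma Rz.zero {G : LGraph L} {Λ : Type} {A : Set Λ} {pt : Λ → Fin m} {κ : Λ → Λ → ℕ}
    (h : Rz G A pt κ) {u v : Λ} (hu : u ∈ A) (hv : v ∈ A) (e : pt u = pt v) : κ u v = 0 := by
  obtain ⟨f, f1, f2⟩ := h
  rw [← f2 u hu v hv, col_same G (by rw [f1 u hu, f1 v hv, e])]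


/-- Sorts. -/
inductive S6 | x | y | p | q | r1 | r2
  deriving DecidableEq

/-- The class of a sort; `r1` and `r2` lie in the same part. -/
def cl : S6 → S6
  | .r2 => .r1
  | a => a

/-- Abstract amalgamation classes of coloured sorted diagrams. -/
structure AC where
  K : ∀ {Λ : Type}, Set Λ → (Λ → S6) → (Λ → Λ → ℕ) → Prop
  pull : ∀ {Λ Λ' : Type} {A : Set Λ} {s : Λ → S6} {κ : Λ → Λ → ℕ} (_ : K A s κ) (e : Λ' → Λ)
    (A' : Set Λ') (s' : Λ' → S6) (κ' : Λ' → Λ' → ℕ), (∀ u ∈ A', e u ∈ A) →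
    (∀ u ∈ A', s' u = s (e u)) →
    (∀ u ∈ A', ∀ v ∈ A', κ' u v = κ (e u) (e v)) → K A' s' κ'
  am : ∀ {Λ : Type} {A B : Set Λ} {s : Λ → S6} {κ₁ κ₂ : Λ → Λ → ℕ}, A.Finite → B.Finite →
    K A s κ₁ → K B s κ₂ → (∀ u ∈ A ∩ B, ∀ v ∈ A ∩ B, κ₁ u v = κ₂ u v) →
    ∃ κ : Λ → Λ → ℕ, K (A ∪ B) s κ ∧ (∀ u ∈ A, ∀ v ∈ A, κ u v = κ₁ u v) ∧
      ∀ u ∈ B, ∀ v ∈ B, κ u v = κ₂ u v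
  symm : ∀ {Λ : Type} {A : Set Λ} {s : Λ → S6} {κ : Λ → Λ → ℕ}, K A s κ →
    ∀ u ∈ A, ∀ v ∈ A, κ u v = κ v u
  zero : ∀ {Λ : Type} {A : Set Λ} {s : Λ → S6} {κ : Λ → Λ → ℕ}, K A s κ →
    ∀ u ∈ A, ∀ v ∈ A, cl (s u) = cl (s v) → κ u v = 0

namespace AC

/-- Colours of the extended diagram. -/
def extκ {Λ : Type} (f : S6 → ℕ) (s : Λ → S6) (κ : Λ → Λ → ℕ) : Option Λ → Option Λ → ℕ
  | none, none => 0
  | none, some u => f (s u)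
  | some u, none => f (s u)
  | some u, some v => κ u v

/-- Sorts of the extended diagram. -/
def exts {Λ : Type} (a : S6) (s : Λ → S6) : Option Λ → S6
  | none => a
  | some u => s u

/-- Add a fixed extra vertex of sort `a`. -/
def ext (M : AC) (a : S6) (f : S6 → ℕ) : AC where
  K A s κ := M.K (insert none (some '' A)) (exts a s) (extκ f s κ)
  pull := by
    intro Λ Λ' A s κ h e A' s' κ' h1 h2 h3
    refine M.pull h (Option.map e) _ _ _ ?_ ?_ ?_
    · rintro u (rfl | ⟨u, hu, rfl⟩)
      · exact Or.inl rfl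
      · exact Or.inr ⟨e u, h1 u hu, rfl⟩
    · rintro u (rfl | ⟨u, hu, rfl⟩)
      · rfl
      · exact h2 u hu
    · rintro u (rfl | ⟨u, hu, rfl⟩) v (rfl | ⟨v, hv, rfl⟩)
      · rfl
      · simp [extκ, h2 v hv]
      · simp [extκ, h2 u hu]
      · simp [extκ, h3 u hu v hv]
  am := by
    intro Λ A B s κ₁ κ₂ hA hB h1 h2 h
    obtain ⟨κ, k1, k2, k3⟩ := M.am ((hA.image some).insert none) ((hB.image some).insert none)
      h1 h2 (by
        rintro u ⟨(rfl | ⟨u, hu, rfl⟩), hu'⟩ v ⟨(rfl | ⟨v, hv, rfl⟩), hv'⟩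
        · rfl
        · rfl
        · rfl
        · have hu2 : u ∈ B := by simpa using hu'
          have hv2 : v ∈ B := by simpa using hv'
          exact h u ⟨hu, hu2⟩ v ⟨hv, hv2⟩)
    have k2' : ∀ u ∈ A, ∀ v ∈ A, κ (some u) (some v) = κ₁ u v := fun u hu v hv =>
      k2 _ (Or.inr ⟨u, hu, rfl⟩) _ (Or.inr ⟨v, hv, rfl⟩)
    have k3' : ∀ u ∈ B, ∀ v ∈ B, κ (some u) (some v) = κ₂ u v := fun u hu v hv =>
      k3 _ (Or.inr ⟨u, hu, rfl⟩) _ (Or.inr ⟨v, hv, rfl⟩)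
    refine ⟨fun u v => κ (some u) (some v), ?_, k2', k3'⟩
    refine M.pull k1 id _ _ _ ?_ (fun _ _ => rfl) ?_
    · rintro u (rfl | ⟨u, hu | hu, rfl⟩)
      · exact Or.inl (Or.inl rfl)
      · exact Or.inl (Or.inr ⟨u, hu, rfl⟩)
      · exact Or.inr (Or.inr ⟨u, hu, rfl⟩)
    · rintro u (rfl | ⟨u, hu | hu, rfl⟩) v (rfl | ⟨v, hv | hv, rfl⟩)
      · exact (k2 none (Or.inl rfl) none (Or.inl rfl)).symm
      · exact (k2 none (Or.inl rfl) (some v) (Or.inr ⟨v, hv, rfl⟩)).symm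
      · exact (k3 none (Or.inl rfl) (some v) (Or.inr ⟨v, hv, rfl⟩)).symm
      · exact (k2 (some u) (Or.inr ⟨u, hu, rfl⟩) none (Or.inl rfl)).symm
      · rfl
      · rfl
      · exact (k3 (some u) (Or.inr ⟨u, hu, rfl⟩) none (Or.inl rfl)).symm
      · rfl
      · rfl
  symm := by
    intro Λ A s κ h u hu v hv
    exact M.symm h (some u) (Or.inr ⟨u, hu, rfl⟩) (some v) (Or.inr ⟨v, hv, rfl⟩)
  zero := by
    intro Λ A s κ h u hu v hv
    exact M.zero h (some u) (Or.inr ⟨u, hu, rfl⟩) (some v) (Or.inr ⟨v, hv, rfl⟩)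

/-- Swap of the sorts `x` and `y`. -/
def σs : S6 → S6
  | .x => .y
  | .y => .x
  | a => a

lemma cl_σs (a b : S6) (h : cl a = cl b) : cl (σs a) = cl (σs b) := by
  cases a <;> cases b <;> simp_all [cl, σs]

/-- The class with `x` and `y` swapped. -/
def swap (M : AC) : AC where
  K A s κ := M.K A (σs ∘ s) κ
  pull := by
    intro Λ Λ' A s κ h e A' s' κ' h1 h2 h3
    exact M.pull h e _ _ _ h1 (fun u hu => by simp [h2 u hu]) h3
  am := by
    intro Λ A B s κ₁ κ₂ hA hB h1 h2 h
    exact M.am hA hB h1 h2 h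
  symm := by
    intro Λ A s κ h
    exact M.symm h
  zero := by
    intro Λ A s κ h u hu v hv hs
    exact M.zero h u hu v hv (cl_σs _ _ hs)

lemma sub (M : AC) {Λ : Type} {A A' : Set Λ} {s : Λ → S6} {κ κ' : Λ → Λ → ℕ}
    (h : M.K A s κ) (h1 : ∀ u ∈ A', u ∈ A)
    (h3 : ∀ u ∈ A', ∀ v ∈ A', κ' u v = κ u v) : M.K A' s κ' :=
  M.pull h id A' s κ' h1 (fun _ _ => rfl) h3

lemma am' (M : AC) {Λ : Type} [Finite Λ] {A B : Set Λ} {s : Λ → S6} {κ₁ κ₂ : Λ → Λ → ℕ}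
    (h1 : M.K A s κ₁) (h2 : M.K B s κ₂)
    (h : ∀ u ∈ A, u ∈ B → ∀ v ∈ A, v ∈ B → κ₁ u v = κ₂ u v) :
    ∃ κ : Λ → Λ → ℕ, M.K (A ∪ B) s κ ∧ (∀ u ∈ A, ∀ v ∈ A, κ u v = κ₁ u v) ∧
      (∀ u ∈ B, ∀ v ∈ B, κ u v = κ₂ u v) ∧ (∀ u v, κ u v = κ v u) ∧
      (∀ u v, cl (s u) = cl (s v) → κ u v = 0) := by
  classical
  obtain ⟨κ, k1, k2, k3⟩ := M.am (Set.toFinite A) (Set.toFinite B) h1 h2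
    (fun u hu v hv => h u hu.1 hu.2 v hv.1 hv.2)
  refine ⟨fun u v => if u ∈ A ∪ B ∧ v ∈ A ∪ B then κ u v else 0, ?_, ?_, ?_, ?_, ?_⟩
  · exact M.sub k1 (fun _ h => h) (fun u hu v hv => if_pos ⟨hu, hv⟩)
  · intro u hu v hv
    dsimp only
    rw [if_pos ⟨Or.inl hu, Or.inl hv⟩, k2 u hu v hv]
  · intro u hu v hv
    dsimp only
    rw [if_pos ⟨Or.inr hu, Or.inr hv⟩, k3 u hu v hv]
  · intro u v
    dsimp only
    by_cases hc : u ∈ A ∪ B ∧ v ∈ A ∪ B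
    · rw [if_pos hc, if_pos hc.symm, M.symm k1 u hc.1 v hc.2]
    · rw [if_neg hc, if_neg (fun h => hc h.symm)]
  · intro u v huv
    dsimp only
    by_cases hc : u ∈ A ∪ B ∧ v ∈ A ∪ B
    · rw [if_pos hc, M.zero k1 u hc.1 v hc.2 huv]
    · rw [if_neg hc]

end AC


/-- Labels. -/
inductive Lb | x | y | z | p | q | r1 | r2 | t1 | t2
  deriving DecidableEq

instance : Fintype Lb :=
  ⟨{.x, .y, .z, .p, .q, .r1, .r2, .t1, .t2}, by intro a; cases a <;> simp⟩

/-- Sorts of labels. -/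
def sl : Lb → S6
  | .x => .x
  | .y => .y
  | .z => .x
  | .p => .p
  | .q => .q
  | .r1 => .r1
  | .r2 => .r2
  | .t1 => .r1
  | .t2 => .r2

/-- Set the colour of the pair `a`, `b` to `c`. -/
def upd {Λ : Type} [DecidableEq Λ] (κ : Λ → Λ → ℕ) (a b : Λ) (c : ℕ) : Λ → Λ → ℕ :=
  fun u v => if (u = a ∧ v = b) ∨ (u = b ∧ v = a) then c else κ u v

namespace AC

open Lb

/-- Hypotheses of the key lemma. -/
structure Hyp (M : AC) (κ : Lb → Lb → ℕ) : Prop where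
  sy : ∀ u v, κ u v = κ v u
  ze : ∀ u, κ u u = 0
  xp : M.K {x, p, r1} sl κ
  yp : M.K {y, p, r1} sl κ
  xq : M.K {x, q, r2} sl κ
  yq : M.K {y, q, r2} sl κ
  gp : M.K {x, y, p} sl κ
  gq : M.K {x, y, q} sl κ
  cp : ∃ c, M.K {x, y, p} sl (upd κ x y c) ∧ M.K {x, y, r2} sl (upd κ x y c)
  cq : ∃ c, M.K {x, y, q} sl (upd κ x y c) ∧ M.K {x, y, r1} sl (upd κ x y c)

/-- Conclusion of the key lemma. -/
def Con (M : AC) (κ : Lb → Lb → ℕ) : Prop :=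
  ∃ c, M.K {x, y, p, r1} sl (upd κ x y c) ∧ M.K {x, y, q, r2} sl (upd κ x y c)

/-- Colours available between `p` and `q`. -/
def PQ (M : AC) (κ : Lb → Lb → ℕ) : Set ℕ := {e | M.K {p, q} sl (upd κ p q e)}

/-- From labels to extended labels. -/
def toZ : Option Lb → Lb
  | none => z
  | some u => u

lemma ext_intro (M : AC) {A : Set Lb} {κ κ' : Lb → Lb → ℕ} {f : S6 → ℕ}
    (h : M.K (insert z A) sl κ) (h0 : κ z z = 0)
    (h1 : ∀ u ∈ A, κ z u = f (sl u)) (h2 : ∀ u ∈ A, κ u z = f (sl u))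
    (h3 : ∀ u ∈ A, ∀ v ∈ A, κ' u v = κ u v) : (M.ext .x f).K A sl κ' := by
  refine M.pull h toZ _ _ _ ?_ ?_ ?_
  · rintro u (rfl | ⟨u, hu, rfl⟩)
    · exact Or.inl rfl
    · exact Or.inr hu
  · rintro u (rfl | ⟨u, hu, rfl⟩) <;> rfl
  · rintro u (rfl | ⟨u, hu, rfl⟩) v (rfl | ⟨v, hv, rfl⟩)
    · exact h0.symm
    · exact (h1 v hv).symm
    · exact (h2 u hu).symm
    · exact h3 u hu v hv

lemma xstep (M : AC) {κ : Lb → Lb → ℕ} (H : M.Hyp κ) :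
    ∃ M' : AC, M'.Hyp κ ∧ (M'.Con κ → M.Con κ) ∧
      (∀ e, M'.K {p, q} sl (upd κ p q e) → M.K {x, p, q} sl (upd κ p q e)) ∧
      (∀ e, M'.K {y, p, q} sl (upd κ p q e) → M.K {x, y, p, q} sl (upd κ p q e)) := by
  obtain ⟨sy, ze, xp, yp, xq, yq, gp, gq, ⟨c, cp1, cp2⟩, ⟨d, cq1, cq2⟩⟩ := H
  obtain ⟨κ1, a1, b1, c1, d1, e1⟩ := M.am' gp yp (by simp)
  obtain ⟨κ2, a2, b2, c2, d2, e2⟩ := M.am' gq yq (by simp)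
  let f : S6 → ℕ := fun a => match a with
    | .x => 0
    | .y => κ x y
    | .p => κ x p
    | .q => κ x q
    | .r1 => κ1 x r1
    | .r2 => κ2 x r2
  -- the vertex z
  let τ : Lb → Lb := fun u => match u with
    | z => x
    | u => u
  let μ : Lb → Lb → ℕ := fun u v => match u, v with
    | z, z => 0
    | z, v => f (sl v)
    | u, z => f (sl u)
    | u, v => κ u v
  have μs : ∀ u v, μ u v = μ v u := by
    intro u v; cases u <;> cases v <;> simp [μ, sy]
  have zp : M.K {z, y, p, r1} sl μ := by
    refine M.pull a1 τ _ _ _ (by simp [τ]) (by simp [τ, sl]) ?_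
    simp [τ, μ, f, sl] at b1 c1 ⊢
    grind
  have zq : M.K {z, y, q, r2} sl μ := by
    refine M.pull a2 τ _ _ _ (by simp [τ]) (by simp [τ, sl]) ?_
    simp [τ, μ, f, sl] at b2 c2 ⊢
    grind
  have xp' : (M.ext .x f).K {x, p, r1} sl κ := by
    obtain ⟨κ', k1, k2, k3, k4, k5⟩ := M.am' (B := {z, p, r1}) (κ₂ := μ) xp
      (M.sub zp (by simp) (fun _ _ _ _ => rfl)) (by simp [μ, upd, ze])
    have kz := k5 z x rfl
    have kz' := k5 x z rfl
    refine M.ext_intro (κ := κ') (M.sub k1 (by simp) (fun _ _ _ _ => rfl)) (k5 z z rfl) ?_ ?_ ?_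
    all_goals
      simp [μ, f, sl, upd, ze] at k2 k3 ⊢
      grind
  have xq' : (M.ext .x f).K {x, q, r2} sl κ := by
    obtain ⟨κ', k1, k2, k3, k4, k5⟩ := M.am' (B := {z, q, r2}) (κ₂ := μ) xq
      (M.sub zq (by simp) (fun _ _ _ _ => rfl)) (by simp [μ, upd, ze])
    have kz := k5 z x rfl
    have kz' := k5 x z rfl
    refine M.ext_intro (κ := κ') (M.sub k1 (by simp) (fun _ _ _ _ => rfl)) (k5 z z rfl) ?_ ?_ ?_
    all_goals
      simp [μ, f, sl, upd, ze] at k2 k3 ⊢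
      grind
  have cp1' : (M.ext .x f).K {x, y, p} sl (upd κ x y c) := by
    obtain ⟨κ', k1, k2, k3, k4, k5⟩ := M.am' (B := {z, y, p}) (κ₂ := μ) cp1
      (M.sub zp (by simp) (fun _ _ _ _ => rfl)) (by simp [μ, upd, ze])
    have kz := k5 z x rfl
    have kz' := k5 x z rfl
    refine M.ext_intro (κ := κ') (M.sub k1 (by simp) (fun _ _ _ _ => rfl)) (k5 z z rfl) ?_ ?_ ?_
    all_goals
      simp [μ, f, sl, upd, ze] at k2 k3 ⊢
      grind
  have cp2' : (M.ext .x f).K {x, y, r2} sl (upd κ x y c) := by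
    obtain ⟨κ', k1, k2, k3, k4, k5⟩ := M.am' (B := {z, y, r2}) (κ₂ := μ) cp2
      (M.sub zq (by simp) (fun _ _ _ _ => rfl)) (by simp [μ, upd, ze])
    have kz := k5 z x rfl
    have kz' := k5 x z rfl
    refine M.ext_intro (κ := κ') (M.sub k1 (by simp) (fun _ _ _ _ => rfl)) (k5 z z rfl) ?_ ?_ ?_
    all_goals
      simp [μ, f, sl, upd, ze] at k2 k3 ⊢
      grind
  have cq1' : (M.ext .x f).K {x, y, q} sl (upd κ x y d) := by
    obtain ⟨κ', k1, k2, k3, k4, k5⟩ := M.am' (B := {z, y, q}) (κ₂ := μ) cq1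
      (M.sub zq (by simp) (fun _ _ _ _ => rfl)) (by simp [μ, upd, ze])
    have kz := k5 z x rfl
    have kz' := k5 x z rfl
    refine M.ext_intro (κ := κ') (M.sub k1 (by simp) (fun _ _ _ _ => rfl)) (k5 z z rfl) ?_ ?_ ?_
    all_goals
      simp [μ, f, sl, upd, ze] at k2 k3 ⊢
      grind
  have cq2' : (M.ext .x f).K {x, y, r1} sl (upd κ x y d) := by
    obtain ⟨κ', k1, k2, k3, k4, k5⟩ := M.am' (B := {z, y, r1}) (κ₂ := μ) cq2
      (M.sub zp (by simp) (fun _ _ _ _ => rfl)) (by simp [μ, upd, ze])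
    have kz := k5 z x rfl
    have kz' := k5 x z rfl
    refine M.ext_intro (κ := κ') (M.sub k1 (by simp) (fun _ _ _ _ => rfl)) (k5 z z rfl) ?_ ?_ ?_
    all_goals
      simp [μ, f, sl, upd, ze] at k2 k3 ⊢
      grind
  have yp' : (M.ext .x f).K {y, p, r1} sl κ := by
    refine M.ext_intro (κ := μ) (M.sub zp (by simp) (fun _ _ _ _ => rfl)) rfl ?_ ?_ ?_ <;>
      simp [μ, f, sl]
  have yq' : (M.ext .x f).K {y, q, r2} sl κ := by
    refine M.ext_intro (κ := μ) (M.sub zq (by simp) (fun _ _ _ _ => rfl)) rfl ?_ ?_ ?_ <;>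
      simp [μ, f, sl]
  have gp' : (M.ext .x f).K {x, y, p} sl κ := by
    refine M.ext_intro (κ := μ) (M.pull gp τ _ _ _ (by simp [τ]) (by simp [τ, sl]) ?_) rfl ?_ ?_ ?_ <;>
      simp [μ, f, sl, τ, ze, sy]
  have gq' : (M.ext .x f).K {x, y, q} sl κ := by
    refine M.ext_intro (κ := μ) (M.pull gq τ _ _ _ (by simp [τ]) (by simp [τ, sl]) ?_) rfl ?_ ?_ ?_ <;>
      simp [μ, f, sl, τ, ze, sy]
  refine ⟨M.ext .x f, ⟨sy, ze, xp', yp', xq', yq', gp', gq', ⟨c, cp1', cp2'⟩, ⟨d, cq1', cq2'⟩⟩,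
    ?_, ?_, ?_⟩
  · rintro ⟨c, h1, h2⟩
    refine ⟨c, ?_, ?_⟩
    · exact M.pull h1 some _ _ _ (fun u hu => Or.inr ⟨u, hu, rfl⟩) (fun _ _ => rfl)
        (fun _ _ _ _ => rfl)
    · exact M.pull h2 some _ _ _ (fun u hu => Or.inr ⟨u, hu, rfl⟩) (fun _ _ => rfl)
        (fun _ _ _ _ => rfl)
  · intro e he
    refine M.pull he (fun u => match u with
      | x => none
      | u => some u) _ _ _ ?_ ?_ ?_
    · simp
    · simp [sl, exts]
    · simp [extκ, sl, f, upd, ze, sy]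
  · intro e he
    refine M.pull he (fun u => match u with
      | x => none
      | u => some u) _ _ _ ?_ ?_ ?_
    · simp
    · simp [sl, exts]
    · simp [extκ, sl, f, upd, ze, sy]

end AC


namespace AC

open Lb

/-- Swap of labels. -/
def σl : Lb → Lb
  | x => y
  | y => x
  | u => u

lemma swap_intro (M : AC) {A A' : Set Lb} {κ κ' : Lb → Lb → ℕ} (h : M.K A sl κ)
    (hz : z ∉ A') (h1 : ∀ u ∈ A', σl u ∈ A)
    (h3 : ∀ u ∈ A', ∀ v ∈ A', κ' u v = κ (σl u) (σl v)) : M.swap.K A' sl κ' := by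
  refine M.pull h σl _ _ _ h1 ?_ h3
  intro u hu
  cases u <;> first | rfl | exact absurd hu hz

lemma swap_elim (M : AC) {A A' : Set Lb} {κ κ' : Lb → Lb → ℕ} (h : M.swap.K A sl κ)
    (hz : z ∉ A') (h1 : ∀ u ∈ A', σl u ∈ A)
    (h3 : ∀ u ∈ A', ∀ v ∈ A', κ' u v = κ (σl u) (σl v)) : M.K A' sl κ' := by
  refine M.pull h σl _ _ _ h1 ?_ h3
  intro u hu
  cases u <;> first | rfl | exact absurd hu hz

lemma swap_hyp (M : AC) {κ : Lb → Lb → ℕ} (H : M.Hyp κ) :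
    M.swap.Hyp (fun u v => κ (σl u) (σl v)) := by
  obtain ⟨sy, ze, xp, yp, xq, yq, gp, gq, ⟨c, cp1, cp2⟩, ⟨d, cq1, cq2⟩⟩ := H
  refine ⟨fun _ _ => sy _ _, fun _ => ze _, ?_, ?_, ?_, ?_, ?_, ?_, ⟨c, ?_, ?_⟩, ⟨d, ?_, ?_⟩⟩
  · exact M.swap_intro yp (by simp) (by simp [σl]) (by simp)
  · exact M.swap_intro xp (by simp) (by simp [σl]) (by simp)
  · exact M.swap_intro yq (by simp) (by simp [σl]) (by simp)
  · exact M.swap_intro xq (by simp) (by simp [σl]) (by simp)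
  · exact M.swap_intro gp (by simp) (by simp [σl]) (by simp)
  · exact M.swap_intro gq (by simp) (by simp [σl]) (by simp)
  · exact M.swap_intro cp1 (by simp) (by simp [σl]) (by simp [σl, upd])
  · exact M.swap_intro cp2 (by simp) (by simp [σl]) (by simp [σl, upd])
  · exact M.swap_intro cq1 (by simp) (by simp [σl]) (by simp [σl, upd])
  · exact M.swap_intro cq2 (by simp) (by simp [σl]) (by simp [σl, upd])

lemma ystep (M : AC) {κ : Lb → Lb → ℕ} (H : M.Hyp κ) :
    ∃ M' : AC, M'.Hyp κ ∧ (M'.Con κ → M.Con κ) ∧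
      (∀ e, M'.K {p, q} sl (upd κ p q e) → M.K {y, p, q} sl (upd κ p q e)) := by
  obtain ⟨N, h1, h2, h3, -⟩ := M.swap.xstep (M.swap_hyp H)
  have h1' := N.swap_hyp h1
  have e : (fun u v => (fun u v => κ (σl u) (σl v)) (σl u) (σl v)) = κ := by
    funext u v
    cases u <;> cases v <;> rfl
  rw [e] at h1'
  refine ⟨N.swap, h1', ?_, ?_⟩
  · rintro ⟨c, k1, k2⟩
    obtain ⟨d, k3, k4⟩ := h2 ⟨c, N.swap_elim k1 (by simp) (by simp [σl]) (by simp [σl, upd]),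
      N.swap_elim k2 (by simp) (by simp [σl]) (by simp [σl, upd])⟩
    exact ⟨d, M.swap_elim k3 (by simp) (by simp [σl]) (by simp [σl, upd]),
      M.swap_elim k4 (by simp) (by simp [σl]) (by simp [σl, upd])⟩
  · intro e he
    exact M.swap_elim (h3 e (N.swap_elim he (by simp) (by simp [σl]) (by simp [σl, upd])))
      (by simp) (by simp [σl]) (by simp [σl, upd])

lemma final (M : AC) {κ : Lb → Lb → ℕ} (H : M.Hyp κ)
    (F : ∀ e, M.K {p, q} sl (upd κ p q e) → M.K {x, y, p, q} sl (upd κ p q e)) : M.Con κ := by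
  obtain ⟨sy, ze, xp, yp, xq, yq, gp, gq, ⟨c, cp1, cp2⟩, ⟨d, cq1, cq2⟩⟩ := H
  obtain ⟨κ1, a1, b1, c1, d1, -⟩ := M.am' cp1 cp2 (by simp)
  obtain ⟨κ2, a2, b2, c2, d2, -⟩ := M.am' cq1 cq2 (by simp)
  simp [upd, ze] at b1 c1 b2 c2
  obtain ⟨μ, hμ⟩ : ∃ μ, μ = upd (upd (upd κ p r2 (κ1 p r2)) q r1 (κ2 q r1)) r1 r2 0 := ⟨_, rfl⟩
  have xp2 : M.K {x, p, r2} sl μ := M.sub a1 (by simp) (by simp [hμ, upd]; grind)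
  have yp2 : M.K {y, p, r2} sl μ := M.sub a1 (by simp) (by simp [hμ, upd]; grind)
  have xq1 : M.K {x, q, r1} sl μ := M.sub a2 (by simp) (by simp [hμ, upd]; grind)
  have yq1 : M.K {y, q, r1} sl μ := M.sub a2 (by simp) (by simp [hμ, upd]; grind)
  have xp1 : M.K {x, p, r1} sl μ := M.sub xp (by simp) (by simp [hμ, upd])
  have yp1 : M.K {y, p, r1} sl μ := M.sub yp (by simp) (by simp [hμ, upd])
  have xq2 : M.K {x, q, r2} sl μ := M.sub xq (by simp) (by simp [hμ, upd])
  have yq2 : M.K {y, q, r2} sl μ := M.sub yq (by simp) (by simp [hμ, upd])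
  have F' : ∀ e, M.K {p, q} sl (upd μ p q e) → M.K {x, y, p, q} sl (upd μ p q e) := by
    intro e he
    refine M.sub (F e (M.sub he (by simp) ?_)) (by simp) ?_
    · simp [hμ, upd]
    · simp [hμ, upd]
  have μ0 : μ r1 r2 = 0 := by simp [hμ, upd]
  have μs : ∀ u v, μ u v = μ v u := by
    intro u v
    subst hμ
    cases u <;> cases v <;> simp [upd, sy]
  have μz : ∀ u, μ u u = 0 := by
    intro u
    subst hμ
    cases u <;> simp [upd, ze]
  have goal' : (∃ c, M.K {x, y, p, r1} sl (upd μ x y c) ∧ M.K {x, y, q, r2} sl (upd μ x y c)) →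
      M.Con κ := by
    rintro ⟨c, h1, h2⟩
    exact ⟨c, M.sub h1 (by simp) (by simp [hμ, upd]), M.sub h2 (by simp) (by simp [hμ, upd])⟩
  clear hμ F xp yp xq yq gp gq cp1 cp2 cq1 cq2 a1 a2 b1 b2 c1 c2 d1 d2
  apply goal'
  clear goal'
  have four : ∀ a ∈ ({x, y} : Set Lb), ∀ b ∈ ({p, q} : Set Lb), M.K {a, b, r1} sl μ →
      M.K {a, b, r2} sl μ → M.K {a, b, r1, r2} sl μ := by
    intro a ha b hb h1 h2
    obtain ⟨ν, k1, k2, k3, k4, k5⟩ := M.am' h1 h2 (fun _ _ _ _ _ _ => rfl)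
    have k := k5 r1 r2 rfl
    refine M.sub k1 ?_ ?_
    · simp
    · simp at k2 k3 ⊢
      grind
  have xp := four x (by simp) p (by simp) xp1 xp2
  have xq := four x (by simp) q (by simp) xq1 xq2
  have yp := four y (by simp) p (by simp) yp1 yp2
  have yq := four y (by simp) q (by simp) yq1 yq2
  clear four xp1 xp2 xq1 xq2 yp1 yp2 yq1 yq2
  have five : ∀ a ∈ ({x, y} : Set Lb), M.K {a, p, r1, r2} sl μ → M.K {a, q, r1, r2} sl μ →
      ∃ e, M.K {a, p, q, r1, r2} sl (upd μ p q e) := by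
    intro a ha h1 h2
    obtain ⟨ν, k1, k2, k3, k4, k5⟩ := M.am' h1 h2 (fun _ _ _ _ _ _ => rfl)
    refine ⟨ν p q, M.sub k1 (by simp) ?_⟩
    rcases ha with rfl | rfl <;>
    · simp [upd] at k2 k3 ⊢
      grind
  obtain ⟨ex, hx⟩ := five x (by simp) xp xq
  obtain ⟨ey, hy⟩ := five y (by simp) yp yq
  clear five xp xq yp yq
  have hx4 := F' ex (M.sub hx (by simp) (fun _ _ _ _ => rfl))
  have hy4 := F' ey (M.sub hy (by simp) (fun _ _ _ _ => rfl))
  obtain ⟨κx, x1, x2, x3, x4, x5⟩ := M.am' hx hx4 (fun _ _ _ _ _ _ => rfl)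
  obtain ⟨κy, y1, y2, y3, y4, y5⟩ := M.am' hy hy4 (fun _ _ _ _ _ _ => rfl)
  obtain ⟨ρ, hρ⟩ : ∃ ρ : Lb → Lb, ρ = fun u => match u with
    | t1 => r1
    | t2 => r2
    | u => u := ⟨_, rfl⟩
  have y1' : M.K {x, y, p, q, t1, t2} sl (fun u v => κy (ρ u) (ρ v)) :=
    M.pull y1 ρ _ _ _ (by simp [hρ]) (by simp [hρ, sl]) (fun _ _ _ _ => rfl)
  simp [upd] at x2 x3 y2 y3
  obtain ⟨κp, p1, p2, p3, p4, p5⟩ := M.am' (A := {x, y, p, r1, r2}) (B := {x, y, p, t1, t2})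
    (M.sub x1 (by simp) (fun _ _ _ _ => rfl)) (M.sub y1' (by simp) (fun _ _ _ _ => rfl))
    (by simp [hρ]; grind)
  obtain ⟨κq, q1, q2, q3, q4, q5⟩ := M.am' (A := {x, y, q, r1, r2}) (B := {x, y, q, t1, t2})
    (M.sub x1 (by simp) (fun _ _ _ _ => rfl)) (M.sub y1' (by simp) (fun _ _ _ _ => rfl))
    (by simp [hρ]; grind)
  obtain ⟨κf, f1, f2, f3, f4, f5⟩ := M.am' p1 q1 (by
    have P1 := p5 r1 t1 rfl
    have P2 := p5 r1 t2 rfl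
    have P3 := p5 r2 t1 rfl
    have P4 := p5 r2 t2 rfl
    have Q1 := q5 r1 t1 rfl
    have Q2 := q5 r1 t2 rfl
    have Q3 := q5 r2 t1 rfl
    have Q4 := q5 r2 t2 rfl
    simp [hρ] at p2 p3 q2 q3 ⊢
    grind)
  have g1 : M.K {x, p, q, r1, r2} sl (upd μ p q (κf p q)) := by
    refine M.sub f1 (by simp) ?_
    simp [hρ, upd] at p2 p3 q2 q3 f2 f3 ⊢
    grind
  have g2 : M.K {y, p, q, r1, r2} sl (upd μ p q (κf p q)) := by
    refine M.pull f1 (fun u => match u with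
      | r1 => t1
      | r2 => t2
      | u => u) _ _ _ (by simp) (by simp [sl]) ?_
    simp [hρ, upd] at p2 p3 q2 q3 f2 f3 ⊢
    grind
  obtain ⟨κ', h1, h2, h3, h4, h5⟩ := M.am' g1 g2 (fun _ _ _ _ _ _ => rfl)
  simp [upd] at h2 h3
  refine ⟨κ' x y, M.sub h1 (by simp) ?_, M.sub h1 (by simp) ?_⟩
  · simp [upd]
    grind
  · simp [upd]
    grind

theorem S1 (n : ℕ) : ∀ (M : AC) {κ : Lb → Lb → ℕ} (_ : M.Hyp κ) (_ : (M.PQ κ).Finite)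
    (_ : (M.PQ κ).ncard ≤ n), M.Con κ := by
  induction n with
  | zero =>
    intro M κ H hf hn
    refine M.final H ?_
    intro e he
    have : M.PQ κ = ∅ := (Set.ncard_eq_zero hf).1 (Nat.le_zero.1 hn)
    exact absurd (show e ∈ M.PQ κ from he) (by simp [this])
  | succ n ih =>
    intro M κ H hf hn
    obtain ⟨M1, H1, C1, D1, E1⟩ := M.xstep H
    obtain ⟨M2, H2, C2, D2⟩ := M1.ystep H1
    have hsub : M2.PQ κ ⊆ M.PQ κ := by
      intro e he
      exact M.sub (E1 e (D2 e he)) (by simp) (fun _ _ _ _ => rfl)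
    by_cases heq : M2.PQ κ = M.PQ κ
    · refine M.final H ?_
      intro e he
      have : e ∈ M2.PQ κ := by rw [heq]; exact he
      exact E1 e (D2 e this)
    · apply C1
      apply C2
      refine ih M2 H2 (hf.subset hsub) ?_
      have := Set.ncard_lt_ncard (hsub.ssubset_of_ne heq) hf
      omega

end AC


/-- Colours of a diagram over the base labels. -/
def glue {Λ Λ' : Type} (κ : Λ → Λ → ℕ) (lab : S6 → Λ) (s : Λ' → S6) (κ' : Λ' → Λ' → ℕ) :
    Λ' ⊕ Λ → Λ' ⊕ Λ → ℕ
  | .inl u, .inl v => κ' u v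
  | .inl u, .inr w => κ (lab (s u)) w
  | .inr w, .inl u => κ w (lab (s u))
  | .inr w, .inr w' => κ w w'

/-- Part assignment of a diagram over the base labels. -/
def gpt {Λ Λ' : Type} (pt : Λ → Fin m) (lab : S6 → Λ) (s : Λ' → S6) : Λ' ⊕ Λ → Fin m
  | .inl u => pt (lab (s u))
  | .inr w => pt w

/-- The amalgamation class of diagrams over a fixed base `R`. -/
def KR (G : LGraph L) (hG : G.Homogeneous) (hgen : G.Generic) {Λ : Type} (pt : Λ → Fin m)
    (κ : Λ → Λ → ℕ) (R : Finset Λ) (lab : S6 → Λ) (hlab : lab .r2 = lab .r1) : AC where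
  K A s κ' := Rz G (Sum.inl '' A ∪ Sum.inr '' (R : Set Λ)) (gpt pt lab s) (glue κ lab s κ')
  pull := by
    intro Λ₁ Λ₂ A s κ₁ h e A' s' κ₂ h1 h2 h3
    refine Rz.pull h (Sum.map e id) _ _ _ ?_ ?_ ?_
    · rintro _ (⟨u, hu, rfl⟩ | ⟨w, hw, rfl⟩)
      · exact Or.inl ⟨e u, h1 u hu, rfl⟩
      · exact Or.inr ⟨w, hw, rfl⟩
    · rintro _ (⟨u, hu, rfl⟩ | ⟨w, hw, rfl⟩)
      · simp [gpt, h2 u hu]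
      · rfl
    · rintro _ (⟨u, hu, rfl⟩ | ⟨w, hw, rfl⟩) _ (⟨v, hv, rfl⟩ | ⟨w', hw', rfl⟩)
      · simp [glue, h3 u hu v hv]
      · simp [glue, h2 u hu]
      · simp [glue, h2 v hv]
      · rfl
  am := by
    intro Λ₁ A B s κ₁ κ₂ hA hB h1 h2 h
    obtain ⟨ν, k1, k2, k3⟩ := Rz.am hG hgen
      ((hA.image Sum.inl).union (R.finite_toSet.image Sum.inr))
      ((hB.image Sum.inl).union (R.finite_toSet.image Sum.inr)) h1 h2 (by
        rintro _ ⟨(⟨u, hu, rfl⟩ | ⟨w, hw, rfl⟩), hu'⟩ _ ⟨(⟨v, hv, rfl⟩ | ⟨w', hw', rfl⟩), hv'⟩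
        · have hu2 : u ∈ B := by simpa using hu'
          have hv2 : v ∈ B := by simpa using hv'
          exact h u ⟨hu, hu2⟩ v ⟨hv, hv2⟩
        · rfl
        · rfl
        · rfl)
    have l : ∀ {A : Set Λ₁} {u}, u ∈ A →
        (Sum.inl u : Λ₁ ⊕ Λ) ∈ Sum.inl '' A ∪ Sum.inr '' (R : Set Λ) :=
      fun hu => Or.inl ⟨_, hu, rfl⟩
    have r : ∀ {A : Set Λ₁} {u}, u ∈ (R : Set Λ) →
        (Sum.inr u : Λ₁ ⊕ Λ) ∈ Sum.inl '' A ∪ Sum.inr '' (R : Set Λ) :=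
      fun hu => Or.inr ⟨_, hu, rfl⟩
    refine ⟨fun u v => ν (.inl u) (.inl v), ?_, fun u hu v hv => k2 _ (l hu) _ (l hv),
      fun u hu v hv => k3 _ (l hu) _ (l hv)⟩
    refine Rz.pull k1 id _ _ _ ?_ (fun _ _ => rfl) ?_
    · rintro _ (⟨u, hu | hu, rfl⟩ | ⟨w, hw, rfl⟩)
      · exact Or.inl (l hu)
      · exact Or.inr (l hu)
      · exact Or.inl (r hw)
    · rintro _ (⟨u, hu | hu, rfl⟩ | ⟨w, hw, rfl⟩) _ (⟨v, hv | hv, rfl⟩ | ⟨w', hw', rfl⟩)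
      · rfl
      · rfl
      · exact (k2 _ (l hu) _ (r hw')).symm
      · rfl
      · rfl
      · exact (k3 _ (l hu) _ (r hw')).symm
      · exact (k2 _ (r hw) _ (l hv)).symm
      · exact (k3 _ (r hw) _ (l hv)).symm
      · exact (k2 _ (r hw) _ (r hw')).symm
  symm := by
    intro Λ₁ A s κ₁ h u hu v hv
    exact Rz.symm h (u := .inl u) (v := .inl v) (Or.inl ⟨_, hu, rfl⟩) (Or.inl ⟨_, hv, rfl⟩)
  zero := by
    intro Λ₁ A s κ₁ h u hu v hv hs
    refine Rz.zero h (u := .inl u) (v := .inl v) (Or.inl ⟨_, hu, rfl⟩) (Or.inl ⟨_, hv, rfl⟩) ?_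
    have : ∀ a, lab (cl a) = lab a := by
      intro a
      cases a <;> simp [cl, hlab]
    simp only [gpt]
    rw [← this (s u), ← this (s v), hs]

section

variable {G : LGraph L} {hG : G.Homogeneous} {hgen : G.Generic} {Λ : Type} {pt : Λ → Fin m}
    {κ : Λ → Λ → ℕ} {R : Finset Λ} {lab : S6 → Λ} {hlab : lab .r2 = lab .r1}

lemma kr_intro {B : Set Λ} {ν : Λ → Λ → ℕ} {A : Set Lb} {κ' : Lb → Lb → ℕ}
    (h : Rz G B pt ν) (h1 : ∀ u ∈ A, lab (sl u) ∈ B) (h2 : ∀ w ∈ R, w ∈ B)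
    (h3 : ∀ u ∈ A, ∀ v ∈ A, κ' u v = ν (lab (sl u)) (lab (sl v)))
    (h4 : ∀ u ∈ A, ∀ w ∈ R, κ (lab (sl u)) w = ν (lab (sl u)) w)
    (h5 : ∀ w ∈ R, ∀ w' ∈ R, κ w w' = ν w w') (sy : ∀ u v, κ u v = κ v u) :
    (KR G hG hgen pt κ R lab hlab).K A sl κ' := by
  refine Rz.pull h (Sum.elim (fun u => lab (sl u)) id) _ _ _ ?_ ?_ ?_
  · rintro _ (⟨u, hu, rfl⟩ | ⟨w, hw, rfl⟩)
    · exact h1 u hu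
    · exact h2 w hw
  · rintro _ (⟨u, hu, rfl⟩ | ⟨w, hw, rfl⟩) <;> rfl
  · rintro _ (⟨u, hu, rfl⟩ | ⟨w, hw, rfl⟩) _ (⟨v, hv, rfl⟩ | ⟨w', hw', rfl⟩)
    · exact h3 u hu v hv
    · exact h4 u hu w' hw'
    · simp only [glue, Sum.elim_inl, Sum.elim_inr, id]
      rw [sy, h4 v hv w hw, Rz.symm h (h1 v hv) (h2 w hw)]
    · exact h5 w hw w' hw'

lemma kr_elim {B : Set Λ} {ν : Λ → Λ → ℕ} {A : Set Lb} {κ' : Lb → Lb → ℕ}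
    (h : (KR G hG hgen pt κ R lab hlab).K A sl κ')
    (h1 : ∀ u ∈ B, u ∈ R ∨ ∃ a ∈ A, lab (sl a) = u)
    (h3 : ∀ u ∈ A, ∀ v ∈ A, ν (lab (sl u)) (lab (sl v)) = κ' u v)
    (h4 : ∀ u ∈ A, ∀ w ∈ R, ν (lab (sl u)) w = κ (lab (sl u)) w)
    (h4' : ∀ u ∈ A, ∀ w ∈ R, ν w (lab (sl u)) = κ w (lab (sl u)))
    (h5 : ∀ w ∈ R, ∀ w' ∈ R, ν w w' = κ w w') : Rz G B pt ν := by
  have : ∀ u, ∃ e : Lb ⊕ Λ, u ∈ B → (u ∈ R ∧ e = .inr u) ∨ (∃ a ∈ A, lab (sl a) = u ∧ e = .inl a) := by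
    intro u
    by_cases hu : u ∈ B
    · rcases h1 u hu with h | ⟨a, ha, h⟩
      · exact ⟨.inr u, fun _ => Or.inl ⟨h, rfl⟩⟩
      · exact ⟨.inl a, fun _ => Or.inr ⟨a, ha, h, rfl⟩⟩
    · exact ⟨.inr u, fun h => absurd h hu⟩
  choose e he using this
  refine Rz.pull h e _ _ _ ?_ ?_ ?_
  · intro u hu
    rcases he u hu with ⟨h, h'⟩ | ⟨a, ha, h, h'⟩
    · rw [h']; exact Or.inr ⟨u, h, rfl⟩
    · rw [h']; exact Or.inl ⟨a, ha, rfl⟩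
  · intro u hu
    rcases he u hu with ⟨h, h'⟩ | ⟨a, ha, h, h'⟩
    · rw [h']; rfl
    · rw [h', ← h]; rfl
  · intro u hu v hv
    rcases he u hu with ⟨h, h'⟩ | ⟨a, ha, h, h'⟩ <;>
    rcases he v hv with ⟨k, k'⟩ | ⟨b, hb, k, k'⟩
    · rw [h', k']; exact h5 u h v k
    · rw [h', k', ← k]; exact h4' b hb u h
    · rw [h', k', ← h]; exact h4 a ha v k
    · rw [h', k', ← h, ← k]; exact h3 a ha b hb

lemma upd_symm [DecidableEq Λ] (sy : ∀ u v, κ u v = κ v u) (a b : Λ) (c : ℕ) (u v : Λ) :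
    upd κ a b c u v = upd κ a b c v u := by
  unfold upd
  rw [sy u v]
  congr 1
  simp only [eq_iff_iff]
  tauto

lemma fail [DecidableEq Λ] (hG : G.Homogeneous) (hgen : G.Generic) (pt : Λ → Fin m)
    (κ : Λ → Λ → ℕ) (sy : ∀ u v, κ u v = κ v u) (ze : ∀ u, κ u u = 0) {x y p q : Λ}
    (hxy : x ≠ y) (hxp : x ≠ p) (hxq : x ≠ q) (hyp : y ≠ p) (hyq : y ≠ q) (hpq : p ≠ q)
    (h0 : ∃ c, Rz G {x, y, p} pt (upd κ x y c) ∧ Rz G {x, y, q} pt (upd κ x y c))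
    (R : Finset Λ) (hx : x ∉ R) (hy : y ∉ R) (hp : p ∉ R) (hq : q ∉ R)
    (xp : Rz G ({x, p} ∪ (R : Set Λ)) pt κ) (yp : Rz G ({y, p} ∪ (R : Set Λ)) pt κ)
    (xq : Rz G ({x, q} ∪ (R : Set Λ)) pt κ) (yq : Rz G ({y, q} ∪ (R : Set Λ)) pt κ) :
    ∃ c, Rz G ({x, y, p} ∪ (R : Set Λ)) pt (upd κ x y c) ∧
      Rz G ({x, y, q} ∪ (R : Set Λ)) pt (upd κ x y c) := by
  induction R using Finset.induction_on with
  | empty => simpa using h0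
  | insert r R hr ih =>
    simp only [Finset.mem_insert, not_or] at hx hy hp hq
    obtain ⟨hxr, hxR⟩ := hx
    obtain ⟨hyr, hyR⟩ := hy
    obtain ⟨hpr, hpR⟩ := hp
    obtain ⟨hqr, hqR⟩ := hq
    have mono : ∀ s : Set Λ, s ∪ (R : Set Λ) ⊆ s ∪ ((insert r R : Finset Λ) : Set Λ) := by
      intro s
      refine Set.union_subset_union_right _ ?_
      simp
    obtain ⟨c0, i1, i2⟩ := ih hxR hyR hpR hqR (xp.sub (mono _) (fun _ _ _ _ => rfl))
      (yp.sub (mono _) (fun _ _ _ _ => rfl)) (xq.sub (mono _) (fun _ _ _ _ => rfl))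
      (yq.sub (mono _) (fun _ _ _ _ => rfl))
    let lab : S6 → Λ := fun a => match a with
      | .x => x
      | .y => y
      | .p => p
      | .q => q
      | .r1 => r
      | .r2 => r
    have hlab : lab .r2 = lab .r1 := rfl
    let M : AC := KR G hG hgen pt κ R lab hlab
    let κ' : Lb → Lb → ℕ := fun u v => upd κ x y c0 (lab (sl u)) (lab (sl v))
    have hneR : ∀ w ∈ R, w ≠ x ∧ w ≠ y ∧ w ≠ p ∧ w ≠ q ∧ w ≠ r := by
      intro w hw
      refine ⟨?_, ?_, ?_, ?_, ?_⟩ <;> rintro rfl <;> contradiction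
    have hyx := hxy.symm
    have hpx := hxp.symm
    have hqx := hxq.symm
    have hpy := hyp.symm
    have hqy := hyq.symm
    have hqp := hpq.symm
    have hrx := Ne.symm hxr
    have hry := Ne.symm hyr
    have hrp := Ne.symm hpr
    have hrq := Ne.symm hqr
    have updR : ∀ c u, ∀ w ∈ R, upd κ x y c u w = κ u w := by
      intro c u w hw
      simp [upd, hneR w hw]
    have updR' : ∀ c u, ∀ w ∈ R, upd κ x y c w u = κ w u := by
      intro c u w hw
      simp [upd, hneR w hw]
    have amxy : ∀ b, Rz G ({x, b} ∪ ((insert r R : Finset Λ) : Set Λ)) pt κ →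
        Rz G ({y, b} ∪ ((insert r R : Finset Λ) : Set Λ)) pt κ → x ≠ b → y ≠ b →
        ∃ c, Rz G ({x, y, b} ∪ ((insert r R : Finset Λ) : Set Λ)) pt (upd κ x y c) := by
      intro b h1 h2 hxb hyb
      obtain ⟨ν, k1, k2, k3⟩ := Rz.am hG hgen (Set.toFinite _) (Set.toFinite _) h1 h2
        (fun _ _ _ _ => rfl)
      refine ⟨ν x y, k1.sub ?_ ?_⟩
      · intro u hu
        simp at hu ⊢
        tauto
      · have ks := Rz.symm k1 (u := x) (v := y) (by simp) (by simp)
        have kx := k2 x (by simp) x (by simp)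
        have ky := k3 y (by simp) y (by simp)
        intro u hu v hv
        unfold upd
        split_ifs with hc
        · rcases hc with ⟨rfl, rfl⟩ | ⟨rfl, rfl⟩
          · rfl
          · exact ks
        · by_cases h1 : u = y ∨ v = y
          · refine (k3 u ?_ v ?_).symm <;> simp at hu hv ⊢ <;> grind
          · refine (k2 u ?_ v ?_).symm <;> simp at hu hv ⊢ <;> grind
    obtain ⟨c1, j1⟩ := amxy p xp yp hxp hyp
    obtain ⟨c2, j2⟩ := amxy q xq yq hxq hyq
    have Hy : M.Hyp κ' := by
      refine ⟨fun _ _ => upd_symm sy _ _ _ _ _, ?_, ?_, ?_, ?_, ?_, ?_, ?_, ⟨c1, ?_, ?_⟩,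
        ⟨c2, ?_, ?_⟩⟩
      · intro u
        cases u <;> simp [κ', upd, lab, sl, ze, hxy, hyx, hxp, hpx, hxq, hqx, hyp, hpy, hyq, hqy, hpq, hqp, hxr, hrx, hyr, hry, hpr, hrp, hqr, hrq]
      · exact kr_intro xp (by simp [lab, sl]) (by simp +contextual) (by simp [κ', upd, lab, sl, hxy, hyx, hxp, hpx, hxq, hqx, hyp, hpy, hyq, hqy, hpq, hqp, hxr, hrx, hyr, hry, hpr, hrp, hqr, hrq])
          (fun _ _ _ _ => rfl) (fun _ _ _ _ => rfl) sy
      · exact kr_intro yp (by simp [lab, sl]) (by simp +contextual) (by simp [κ', upd, lab, sl, hxy, hyx, hxp, hpx, hxq, hqx, hyp, hpy, hyq, hqy, hpq, hqp, hxr, hrx, hyr, hry, hpr, hrp, hqr, hrq])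
          (fun _ _ _ _ => rfl) (fun _ _ _ _ => rfl) sy
      · exact kr_intro xq (by simp [lab, sl]) (by simp +contextual) (by simp [κ', upd, lab, sl, hxy, hyx, hxp, hpx, hxq, hqx, hyp, hpy, hyq, hqy, hpq, hqp, hxr, hrx, hyr, hry, hpr, hrp, hqr, hrq])
          (fun _ _ _ _ => rfl) (fun _ _ _ _ => rfl) sy
      · exact kr_intro yq (by simp [lab, sl]) (by simp +contextual) (by simp [κ', upd, lab, sl, hxy, hyx, hxp, hpx, hxq, hqx, hyp, hpy, hyq, hqy, hpq, hqp, hxr, hrx, hyr, hry, hpr, hrp, hqr, hrq])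
          (fun _ _ _ _ => rfl) (fun _ _ _ _ => rfl) sy
      · exact kr_intro i1 (by simp [lab, sl]) (by simp +contextual)
          (by simp [κ', upd, lab, sl, hxy, hyx, hxp, hpx, hxq, hqx, hyp, hpy, hyq, hqy, hpq, hqp, hxr, hrx, hyr, hry, hpr, hrp, hqr, hrq])
          (fun u _ w hw => (updR _ _ w hw).symm) (fun u _ w hw => (updR _ _ w hw).symm) sy
      · exact kr_intro i2 (by simp [lab, sl]) (by simp +contextual)
          (by simp [κ', upd, lab, sl, hxy, hyx, hxp, hpx, hxq, hqx, hyp, hpy, hyq, hqy, hpq, hqp, hxr, hrx, hyr, hry, hpr, hrp, hqr, hrq])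
          (fun u _ w hw => (updR _ _ w hw).symm) (fun u _ w hw => (updR _ _ w hw).symm) sy
      · exact kr_intro j1 (by simp [lab, sl]) (by simp +contextual)
          (by simp [κ', upd, lab, sl, hxy, hyx, hxp, hpx, hxq, hqx, hyp, hpy, hyq, hqy, hpq, hqp, hxr, hrx, hyr, hry, hpr, hrp, hqr, hrq])
          (fun u _ w hw => (updR _ _ w hw).symm) (fun u _ w hw => (updR _ _ w hw).symm) sy
      · exact kr_intro j1 (by simp [lab, sl]) (by simp +contextual)
          (by simp [κ', upd, lab, sl, hxy, hyx, hxp, hpx, hxq, hqx, hyp, hpy, hyq, hqy, hpq, hqp, hxr, hrx, hyr, hry, hpr, hrp, hqr, hrq])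
          (fun u _ w hw => (updR _ _ w hw).symm) (fun u _ w hw => (updR _ _ w hw).symm) sy
      · exact kr_intro j2 (by simp [lab, sl]) (by simp +contextual)
          (by simp [κ', upd, lab, sl, hxy, hyx, hxp, hpx, hxq, hqx, hyp, hpy, hyq, hqy, hpq, hqp, hxr, hrx, hyr, hry, hpr, hrp, hqr, hrq])
          (fun u _ w hw => (updR _ _ w hw).symm) (fun u _ w hw => (updR _ _ w hw).symm) sy
      · exact kr_intro j2 (by simp [lab, sl]) (by simp +contextual)
          (by simp [κ', upd, lab, sl, hxy, hyx, hxp, hpx, hxq, hqx, hyp, hpy, hyq, hqy, hpq, hqp, hxr, hrx, hyr, hry, hpr, hrp, hqr, hrq])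
          (fun u _ w hw => (updR _ _ w hw).symm) (fun u _ w hw => (updR _ _ w hw).symm) sy
    have hfin : (M.PQ κ').Finite := by
      refine (Set.Finite.insert 0 (L.C (pt p) (pt q)).finite_toSet).subset ?_
      rintro e ⟨f, f1, f2⟩
      have e1 := f1 (.inl .p) (by simp)
      have e2 := f1 (.inl .q) (by simp)
      have e3 := f2 (.inl .p) (by simp) (.inl .q) (by simp)
      simp only [gpt, glue, upd, sl, lab] at e1 e2 e3
      rw [if_pos (by simp)] at e3
      rw [← e3]
      by_cases hc : G.part (f (.inl .p)) = G.part (f (.inl .q))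
      · rw [col_same G hc]
        simp
      · rw [col_ne G hc, ← e1, ← e2]
        exact Or.inr (G.colour_mem _ _ hc)
    obtain ⟨c, k1, k2⟩ := AC.S1 _ M Hy hfin le_rfl
    refine ⟨c, ?_, ?_⟩
    · refine kr_elim k1 ?_ ?_ (fun u _ w hw => updR _ _ w hw) (fun u _ w hw => updR' _ _ w hw)
        (fun u _ w hw => updR _ _ w hw)
      · intro u hu
        simp only [Set.mem_union, Set.mem_insert_iff, Set.mem_singleton_iff, Finset.coe_insert,
          Finset.mem_coe] at hu
        rcases hu with (rfl | rfl | rfl) | rfl | hu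
        · exact Or.inr ⟨.x, by simp, rfl⟩
        · exact Or.inr ⟨.y, by simp, rfl⟩
        · exact Or.inr ⟨.p, by simp, rfl⟩
        · exact Or.inr ⟨.r1, by simp, rfl⟩
        · exact Or.inl hu
      · simp [κ', upd, lab, sl, hxy, hyx, hxp, hpx, hxq, hqx, hyp, hpy, hyq, hqy, hpq, hqp, hxr, hrx, hyr, hry, hpr, hrp, hqr, hrq]
    · refine kr_elim k2 ?_ ?_ (fun u _ w hw => updR _ _ w hw) (fun u _ w hw => updR' _ _ w hw)
        (fun u _ w hw => updR _ _ w hw)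
      · intro u hu
        simp only [Set.mem_union, Set.mem_insert_iff, Set.mem_singleton_iff, Finset.coe_insert,
          Finset.mem_coe] at hu
        rcases hu with (rfl | rfl | rfl) | rfl | hu
        · exact Or.inr ⟨.x, by simp, rfl⟩
        · exact Or.inr ⟨.y, by simp, rfl⟩
        · exact Or.inr ⟨.q, by simp, rfl⟩
        · exact Or.inr ⟨.r2, by simp, rfl⟩
        · exact Or.inl hu
      · simp [κ', upd, lab, sl, hxy, hyx, hxp, hpx, hxq, hqx, hyp, hpy, hyq, hqy, hpq, hqp, hxr, hrx, hyr, hry, hpr, hrp, hqr, hrq]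

end


set_option maxHeartbeats 2000000 in
lemma combine {G : LGraph L} (hG : G.Homogeneous) (hgen : G.Generic) {Λ : Type} [DecidableEq Λ]
    (pt : Λ → Fin m) (κ₀ : Λ → Λ → ℕ) (sy₀ : ∀ u v, κ₀ u v = κ₀ v u) (ze₀ : ∀ u, κ₀ u u = 0)
    {x y : Λ} (hxy : x ≠ y) (N : Finset Λ) (hx : x ∉ N) (hy : y ∉ N) (β : Λ → ℕ)
    (hbx : ∀ b, Rz G {u | u = x ∨ (u ∈ N ∧ β u = b)} pt κ₀)
    (hby : ∀ b, Rz G {u | u = y ∨ (u ∈ N ∧ β u = b)} pt κ₀)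
    (hpair : ∀ p ∈ N, ∀ q ∈ N, β p ≠ β q →
      ∃ c, Rz G {x, y, p} pt (upd κ₀ x y c) ∧ Rz G {x, y, q} pt (upd κ₀ x y c)) :
    ∃ ν, Rz G {u | u = x ∨ u = y ∨ u ∈ N} pt ν ∧
      (∀ u v, (u = x ∨ u ∈ N) → (v = x ∨ v ∈ N) → (u ∈ N → v ∈ N → β u = β v) →
        ν u v = κ₀ u v) ∧
      (∀ u v, (u = y ∨ u ∈ N) → (v = y ∨ v ∈ N) → (u ∈ N → v ∈ N → β u = β v) →
        ν u v = κ₀ u v) := by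
  have outer : ∀ P : Finset Λ, P ⊆ N → ∃ κ : Λ → Λ → ℕ, (∀ u v, κ u v = κ v u) ∧
      (∀ u v, (u ∈ N → v ∈ N → β u = β v) → κ u v = κ₀ u v) ∧
      Rz G {u | u = x ∨ u ∈ P} pt κ ∧ Rz G {u | u = y ∨ u ∈ P} pt κ := by
    intro P
    induction P using Finset.induction_on with
    | empty =>
      intro _
      refine ⟨κ₀, sy₀, fun _ _ _ => rfl, (hbx 0).sub ?_ (fun _ _ _ _ => rfl),
        (hby 0).sub ?_ (fun _ _ _ _ => rfl)⟩
      · intro u hu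
        simp at hu
        exact Or.inl hu
      · intro u hu
        simp at hu
        exact Or.inl hu
    | insert p P hpP ih =>
      intro hPN
      have hpN : p ∈ N := hPN (Finset.mem_insert_self _ _)
      have hPN' : P ⊆ N := fun u hu => hPN (Finset.mem_insert_of_mem hu)
      obtain ⟨κ, ks, ka, kx, ky⟩ := ih hPN'
      have inner : ∀ Q : Finset Λ, (∀ u ∈ Q, u ∈ P ∧ β u ≠ β p) → ∃ κ' : Λ → Λ → ℕ,
          (∀ u v, κ' u v = κ' v u) ∧
          (∀ u v, (u ∈ N → v ∈ N → β u = β v) → κ' u v = κ₀ u v) ∧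
          (∀ u ∈ P, ∀ v ∈ P, κ' u v = κ u v) ∧
          Rz G ({x, p} ∪ ((P.filter (fun u => β u = β p) ∪ Q : Finset Λ) : Set Λ)) pt κ' ∧
          Rz G ({y, p} ∪ ((P.filter (fun u => β u = β p) ∪ Q : Finset Λ) : Set Λ)) pt κ' := by
        intro Q
        induction Q using Finset.induction_on with
        | empty =>
          intro _
          refine ⟨κ, ks, ka, fun _ _ _ _ => rfl, (hbx (β p)).sub ?_ ?_, (hby (β p)).sub ?_ ?_⟩
          · intro u hu
            simp at hu
            simp only [Set.mem_setOf_eq]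
            grind
          · intro u hu v hv
            simp at hu hv
            refine ka u v ?_
            grind
          · intro u hu
            simp at hu
            simp only [Set.mem_setOf_eq]
            grind
          · intro u hu v hv
            simp at hu hv
            refine ka u v ?_
            grind
        | insert q Q hqQ ihQ =>
          intro hQ
          obtain ⟨hqP, hqp⟩ := hQ q (Finset.mem_insert_self _ _)
          have hqN := hPN' hqP
          obtain ⟨κ', s', a', g', x', y'⟩ := ihQ (fun u hu => hQ u (Finset.mem_insert_of_mem hu))
          have hQP : ∀ u ∈ Q, u ∈ P := fun u hu => (hQ u (Finset.mem_insert_of_mem hu)).1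
          set R := P.filter (fun u => β u = β p) ∪ Q with hR
          have hRP : ∀ u ∈ R, u ∈ P := by
            intro u hu
            rw [hR, Finset.mem_union, Finset.mem_filter] at hu
            rcases hu with h | h
            · exact h.1
            · exact hQP u h
          have hqR : q ∉ R := by
            rw [hR, Finset.mem_union, Finset.mem_filter]
            rintro (h | h)
            · exact hqp h.2
            · exact hqQ h
          have hpR : p ∉ R := fun h => hpP (hRP p h)
          have hxR : x ∉ R := fun h => hx (hPN' (hRP x h))
          have hyR : y ∉ R := fun h => hy (hPN' (hRP y h))
          have hxp : x ≠ p := by rintro rfl; exact hx hpN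
          have hyp : y ≠ p := by rintro rfl; exact hy hpN
          have hxq : x ≠ q := by rintro rfl; exact hx hqN
          have hyq : y ≠ q := by rintro rfl; exact hy hqN
          have hpq : p ≠ q := by rintro rfl; exact hqp rfl
          obtain ⟨c, c1, c2⟩ := fail hG hgen pt κ' s' (fun u => by rw [a' u u (fun _ _ => rfl), ze₀])
            hxy hxp hxq hyp hyq hpq (by
              obtain ⟨c, h1, h2⟩ := hpair p hpN q hqN (Ne.symm hqp)
              refine ⟨c, h1.sub (fun _ h => h) ?_, h2.sub (fun _ h => h) ?_⟩
              · intro u hu v hv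
                simp at hu hv
                unfold upd
                split_ifs
                · rfl
                · exact a' u v (by grind)
              · intro u hu v hv
                simp at hu hv
                unfold upd
                split_ifs
                · rfl
                · exact a' u v (by grind)) R hxR hyR hpR hqR x' y'
            (kx.sub (by
              intro u hu
              simp at hu
              simp only [Set.mem_setOf_eq]
              grind) (by
              intro u hu v hv
              simp at hu hv
              by_cases h : u ∈ P ∧ v ∈ P
              · exact g' u h.1 v h.2
              · have h' : u ∈ N → v ∈ N → β u = β v := by grind
                rw [a' u v h', ka u v h']))
            (ky.sub (by
              intro u hu
              simp at hu
              simp only [Set.mem_setOf_eq]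
              grind) (by
              intro u hu v hv
              simp at hu hv
              by_cases h : u ∈ P ∧ v ∈ P
              · exact g' u h.1 v h.2
              · have h' : u ∈ N → v ∈ N → β u = β v := by grind
                rw [a' u v h', ka u v h']))
          obtain ⟨ν, n1, n2, n3⟩ := Rz.am hG hgen (Set.toFinite _) (Set.toFinite _) c1 c2
            (fun _ _ _ _ => rfl)
          have ns : ν p q = ν q p := Rz.symm n1 (by simp) (by simp)
          have fin : ∀ w, (w = x ∨ w = y) →
              Rz G ({w, p} ∪ ((P.filter (fun u => β u = β p) ∪ insert q Q : Finset Λ) : Set Λ)) pt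
                (upd κ' p q (ν p q)) := by
            intro w hw
            have key : ∀ u, u ∈ ({w, p} ∪
                ((P.filter (fun u => β u = β p) ∪ insert q Q : Finset Λ) : Set Λ)) →
                u = w ∨ u = p ∨ u = q ∨ u ∈ R := by
              intro u hu
              simp at hu
              rw [hR, Finset.mem_union, Finset.mem_filter]
              tauto
            refine n1.sub ?_ ?_
            · intro u hu
              have := key u hu
              simp
              grind
            · intro u hu v hv
              have hu := key u hu
              have hv := key v hv
              by_cases hc : (u = p ∧ v = q) ∨ (u = q ∧ v = p)
              · simp only [upd, if_pos hc]
                rcases hc with ⟨rfl, rfl⟩ | ⟨rfl, rfl⟩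
                · rfl
                · exact ns
              · have e : upd κ' p q (ν p q) u v = upd κ' x y c u v := by
                  simp only [upd, if_neg hc]
                  rw [if_neg]
                  grind
                rw [e]
                by_cases h1 : u = q ∨ v = q
                · refine (n3 u ?_ v ?_).symm <;>
                  · simp only [Set.mem_union, Set.mem_insert_iff, Set.mem_singleton_iff,
                      Finset.mem_coe]
                    grind
                · refine (n2 u ?_ v ?_).symm <;>
                  · simp only [Set.mem_union, Set.mem_insert_iff, Set.mem_singleton_iff,
                      Finset.mem_coe]
                    grind
          refine ⟨upd κ' p q (ν p q), upd_symm s' _ _ _, ?_, ?_, fin x (Or.inl rfl),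
            fin y (Or.inr rfl)⟩
          · intro u v h
            unfold upd
            rw [if_neg (by grind)]
            exact a' u v h
          · intro u hu v hv
            unfold upd
            rw [if_neg (by grind)]
            exact g' u hu v hv
      obtain ⟨κ', s', a', -, x', y'⟩ := inner (P.filter (fun u => β u ≠ β p)) (by simp)
      rw [Finset.filter_union_filter_not_eq] at x' y'
      refine ⟨κ', s', a', x'.sub ?_ (fun _ _ _ _ => rfl), y'.sub ?_ (fun _ _ _ _ => rfl)⟩
      · intro u hu
        simp at hu ⊢
        tauto
      · intro u hu
        simp at hu ⊢
        tauto
  obtain ⟨κ, ks, ka, kx, ky⟩ := outer N (Finset.Subset.refl _)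
  have fi : ∀ w, {u | u = w ∨ u ∈ N}.Finite := fun w => (N.finite_toSet.insert w)
  obtain ⟨ν, n1, n2, n3⟩ := Rz.am hG hgen (fi x) (fi y) kx ky (fun _ _ _ _ => rfl)
  refine ⟨ν, n1.sub ?_ (fun _ _ _ _ => rfl), ?_, ?_⟩
  · intro u hu
    simp at hu ⊢
    tauto
  · intro u v hu hv h
    rw [n2 u hu v hv, ka u v h]
  · intro u v hu hv h
    rw [n3 u hu v hv, ka u v h]


/-- A minimally omitted monic, given by its set of parts and its colours. -/
structure Mono (G : LGraph L) (P : Set (Fin m)) (D : Fin m → Fin m → ℕ) : Prop where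
  min : ∀ S ⊆ P, S ≠ P → Rz G S id D
  om : ¬ Rz G P id D

/-- Colours of a triangle. -/
def tri (i j k : Fin m) (d a b : ℕ) : Fin m → Fin m → ℕ :=
  upd (upd (upd (fun _ _ => 0) i j d) i k a) j k b

/-- Realizability of a triangle. -/
def RT (G : LGraph L) (i j k : Fin m) (d a b : ℕ) : Prop := Rz G {i, j, k} id (tri i j k d a b)

lemma tri_symm (i j k : Fin m) (d a b : ℕ) (u v : Fin m) :
    tri i j k d a b u v = tri i j k d a b v u :=
  upd_symm (upd_symm (upd_symm (fun _ _ => rfl) _ _ _) _ _ _) _ _ _ _ _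

lemma tri_diag {i j k : Fin m} (hij : i ≠ j) (hik : i ≠ k) (hjk : j ≠ k) (d a b : ℕ) (u : Fin m) :
    tri i j k d a b u u = 0 := by
  unfold tri upd
  grind

lemma rt_of {G : LGraph L} {i j k : Fin m} (hij : i ≠ j) (hik : i ≠ k) (hjk : j ≠ k)
    {P : Set (Fin m)} {D : Fin m → Fin m → ℕ} (h : Rz G P id D) (sy : ∀ u v, D u v = D v u)
    (ze : ∀ u, D u u = 0) (hi : i ∈ P) (hj : j ∈ P) (hk : k ∈ P) :
    RT G i j k (D i j) (D i k) (D j k) := by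
  refine h.sub ?_ ?_
  · rintro u (rfl | rfl | rfl) <;> assumption
  · simp [tri, upd, ze, hij, hik, hjk, hij.symm, hik.symm, hjk.symm, sy]

/-- A family of minimally omitted monics covering all colours between parts `i` and `j`. -/
structure Fam (G : LGraph L) (i j : Fin m) (P : ℕ → Set (Fin m)) (D : ℕ → Fin m → Fin m → ℕ) :
    Prop where
  sy : ∀ c u v, D c u v = D c v u
  ze : ∀ c u, D c u u = 0
  mo : ∀ c ∈ L.C i j, Mono G (P c) (D c)
  hi : ∀ c ∈ L.C i j, i ∈ P c
  hj : ∀ c ∈ L.C i j, j ∈ P c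
  co : ∀ c ∈ L.C i j, D c i j = c

/-- A pair of types omitting all colours. -/
def OmP (G : LGraph L) (i j k l : Fin m) (a b a' b' : ℕ) : Prop :=
  ∀ d ∈ L.C i j, ¬ RT G i j k d a b ∨ ¬ RT G i j l d a' b'

lemma glue3 {G : LGraph L} (hG : G.Homogeneous) (hgen : G.Generic) {Λ : Type}
    {pt : Λ → Fin m} {κ : Λ → Λ → ℕ} {w p q : Λ} (h1 : Rz G {w, p} pt κ) (h2 : Rz G {w, q} pt κ)
    (z1 : κ p q = 0) (z2 : κ q p = 0) (hp : pt p = pt q) : Rz G {w, p, q} pt κ := by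
  obtain ⟨ν, n1, n2, n3⟩ := Rz.am hG hgen (Set.toFinite _) (Set.toFinite _) h1 h2
    (fun _ _ _ _ => rfl)
  have y1 : ν p q = 0 := n1.zero (by simp) (by simp) hp
  have y2 : ν q p = 0 := n1.zero (by simp) (by simp) hp.symm
  simp only [Set.mem_insert_iff, Set.mem_singleton_iff] at n2 n3
  refine n1.sub ?_ ?_
  · rintro u (rfl | rfl | rfl) <;> simp
  · intro u hu v hv
    simp only [Set.mem_insert_iff, Set.mem_singleton_iff] at hu hv
    grind

lemma close2 {G : LGraph L} (hG : G.Homogeneous) (hgen : G.Generic) {Λ : Type} [DecidableEq Λ]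
    {pt : Λ → Fin m} {κ : Λ → Λ → ℕ} {x y p q : Λ} (h1 : Rz G {x, p, q} pt κ)
    (h2 : Rz G {y, p, q} pt κ) (hxy : x ≠ y) (hpx : p ≠ x) (hqx : q ≠ x) (hpy : p ≠ y)
    (hqy : q ≠ y) :
    ∃ d, Rz G {x, y, p} pt (upd κ x y d) ∧ Rz G {x, y, q} pt (upd κ x y d) := by
  obtain ⟨ν, n1, n2, n3⟩ := Rz.am hG hgen (Set.toFinite _) (Set.toFinite _) h1 h2
    (fun _ _ _ _ => rfl)
  have ns : ν x y = ν y x := n1.symm (by simp) (by simp)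
  simp only [Set.mem_insert_iff, Set.mem_singleton_iff] at n2 n3
  refine ⟨ν x y, n1.sub ?_ ?_, n1.sub ?_ ?_⟩
  · rintro u (rfl | rfl | rfl) <;> simp
  · intro u hu v hv
    simp only [Set.mem_insert_iff, Set.mem_singleton_iff] at hu hv
    unfold upd
    grind
  · rintro u (rfl | rfl | rfl) <;> simp
  · intro u hu v hv
    simp only [Set.mem_insert_iff, Set.mem_singleton_iff] at hu hv
    unfold upd
    grind

theorem main_pair {G : LGraph L} (hG : G.Homogeneous) (hgen : G.Generic) {i j : Fin m}
    (hij : i ≠ j) {P : ℕ → Set (Fin m)} {D : ℕ → Fin m → Fin m → ℕ} (F : Fam G i j P D) :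
    ∃ c ∈ L.C i j, ∃ c' ∈ L.C i j, ∃ k ∈ P c, ∃ l ∈ P c', k ≠ i ∧ k ≠ j ∧ l ≠ i ∧ l ≠ j ∧ k ≠ l ∧
      OmP G i j k l (D c i k) (D c j k) (D c' i l) (D c' j l) := by
  classical
  by_contra hcon
  have hcon' : ∀ c ∈ L.C i j, ∀ c' ∈ L.C i j, ∀ k ∈ P c, ∀ l ∈ P c', k ≠ i → k ≠ j → l ≠ i →
      l ≠ j → k ≠ l → ∃ d, RT G i j k d (D c i k) (D c j k) ∧
        RT G i j l d (D c' i l) (D c' j l) := by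
    intro c hc c' hc' k hk l hl h1 h2 h3 h4 h5
    by_contra hn
    refine hcon ⟨c, hc, c', hc', k, hk, l, hl, h1, h2, h3, h4, h5, ?_⟩
    intro d _
    by_contra h
    push Not at h
    exact hn ⟨d, h⟩
  clear hcon
  let x : Bool ⊕ (ℕ × Fin m) := .inl false
  let y : Bool ⊕ (ℕ × Fin m) := .inl true
  let pt : Bool ⊕ (ℕ × Fin m) → Fin m := fun u => match u with
    | .inl false => i
    | .inl true => j
    | .inr w => w.2
  let κ₀ : Bool ⊕ (ℕ × Fin m) → Bool ⊕ (ℕ × Fin m) → ℕ := fun u v => match u, v with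
    | .inl _, .inl _ => 0
    | .inl false, .inr w => D w.1 i w.2
    | .inl true, .inr w => D w.1 j w.2
    | .inr w, .inl false => D w.1 i w.2
    | .inr w, .inl true => D w.1 j w.2
    | .inr w, .inr w' => if w.1 = w'.1 then D w.1 w.2 w'.2 else 0
  let β : Bool ⊕ (ℕ × Fin m) → ℕ := fun u => match u with
    | .inl _ => 0
    | .inr w => w.1
  let N : Finset (Bool ⊕ (ℕ × Fin m)) :=
    (((L.C i j) ×ˢ (Finset.univ : Finset (Fin m))).filter
      (fun w => w.2 ∈ P w.1 ∧ w.2 ≠ i ∧ w.2 ≠ j)).image Sum.inr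
  have hN : ∀ u, u ∈ N ↔ ∃ c k, u = .inr (c, k) ∧ c ∈ L.C i j ∧ k ∈ P c ∧ k ≠ i ∧ k ≠ j := by
    intro u
    simp only [N, Finset.mem_image, Finset.mem_filter, Finset.mem_product, Finset.mem_univ,
      and_true, Prod.exists]
    constructor
    · rintro ⟨c, k, ⟨h1, h2⟩, rfl⟩
      exact ⟨c, k, rfl, h1, h2⟩
    · rintro ⟨c, k, rfl, h1, h2⟩
      exact ⟨c, k, ⟨h1, h2⟩, rfl⟩
  have sy₀ : ∀ u v, κ₀ u v = κ₀ v u := by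
    rintro ((_ | _) | ⟨c, k⟩) ((_ | _) | ⟨c', k'⟩) <;> simp only [κ₀]
    by_cases h : c = c'
    · subst h
      simp [F.sy c k k']
    · simp [h, Ne.symm h]
  have ze₀ : ∀ u, κ₀ u u = 0 := by
    rintro ((_ | _) | ⟨c, k⟩) <;> simp [κ₀, F.ze]
  have hxN : x ∉ N := by
    rw [hN]; rintro ⟨c, k, h, _⟩; simp [x] at h
  have hyN : y ∉ N := by
    rw [hN]; rintro ⟨c, k, h, _⟩; simp [y] at h
  have hsingle : ∀ w, Rz G {w} pt κ₀ := by
    intro w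
    obtain ⟨v, hv⟩ := (hgen.2.1 (pt w)).nonempty
    refine ⟨fun _ => v, ?_, ?_⟩
    · rintro u rfl
      exact hv
    · rintro u rfl v' rfl
      rw [ze₀, col_same G rfl]
  let e : Bool ⊕ (ℕ × Fin m) → Fin m := pt
  have hbw : ∀ w w' : Bool ⊕ (ℕ × Fin m), (w = x ∧ w' = y ∨ w = y ∧ w' = x) → ∀ b,
      Rz G {u | u = w ∨ (u ∈ N ∧ β u = b)} pt κ₀ := by
    intro w w' hw b
    by_cases hb : b ∈ L.C i j
    · have h := (F.mo b hb).min (P b \ {pt w'}) Set.sdiff_subset (by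
        intro h
        have : pt w' ∈ P b := by
          rcases hw with ⟨rfl, rfl⟩ | ⟨rfl, rfl⟩
          · exact F.hj b hb
          · exact F.hi b hb
        rw [← h] at this
        exact this.2 rfl)
      have hwP : pt w ∈ P b \ {pt w'} := by
        rcases hw with ⟨rfl, rfl⟩ | ⟨rfl, rfl⟩
        · exact ⟨F.hi b hb, hij⟩
        · exact ⟨F.hj b hb, hij.symm⟩
      refine h.pull pt _ _ _ ?_ (fun _ _ => rfl) ?_
      · rintro u (rfl | ⟨hu, hub⟩)
        · exact hwP
        · obtain ⟨c, k, rfl, h1, h2, h3, h4⟩ := (hN u).1 hu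
          have : c = b := hub
          subst this
          refine ⟨h2, ?_⟩
          rcases hw with ⟨rfl, rfl⟩ | ⟨rfl, rfl⟩
          · exact h4
          · exact h3
      · have aux : ∀ c k, κ₀ w (.inr (c, k)) = D c (pt w) k := by
          intro c k
          rcases hw with ⟨rfl, rfl⟩ | ⟨rfl, rfl⟩ <;> rfl
        rintro u (rfl | ⟨hu, hub⟩) v (rfl | ⟨hv, hvb⟩)
        · rw [ze₀, F.ze]
        · obtain ⟨c, k, rfl, h1, h2, h3, h4⟩ := (hN v).1 hv
          have : c = b := hvb
          subst this
          exact aux c k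
        · obtain ⟨c, k, rfl, h1, h2, h3, h4⟩ := (hN u).1 hu
          have : c = b := hub
          subst this
          rw [sy₀, F.sy]
          exact aux c k
        · obtain ⟨c, k, rfl, h1, h2, h3, h4⟩ := (hN u).1 hu
          obtain ⟨c', k', rfl, h1', h2', h3', h4'⟩ := (hN v).1 hv
          have : c = b := hub
          subst this
          have : c' = c := hvb
          subst this
          simp [κ₀, pt]
    · refine (hsingle w).sub ?_ (fun _ _ _ _ => rfl)
      rintro u (rfl | ⟨hu, hub⟩)
      · rfl
      · obtain ⟨c, k, rfl, h1, h2, h3, h4⟩ := (hN u).1 hu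
        have : c = b := hub
        subst this
        exact absurd h1 hb
  have hxy : x ≠ y := by simp [x, y]
  obtain ⟨ν, n1, n2, n3⟩ := combine hG hgen pt κ₀ sy₀ ze₀ hxy N hxN hyN β
    (hbw x y (Or.inl ⟨rfl, rfl⟩)) (hbw y x (Or.inr ⟨rfl, rfl⟩)) (by
      intro p hp q hq hpq
      obtain ⟨c, k, rfl, h1, h2, h3, h4⟩ := (hN p).1 hp
      obtain ⟨c', k', rfl, h1', h2', h3', h4'⟩ := (hN q).1 hq
      have hcc : c ≠ c' := hpq
      by_cases hkk : k = k'
      · subst hkk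
        have tw : ∀ w w', (w = x ∧ w' = y ∨ w = y ∧ w' = x) →
            Rz G {w, .inr (c, k), .inr (c', k)} pt κ₀ := by
          intro w w' hw
          refine glue3 hG hgen ?_ ?_ (if_neg hcc) (if_neg hcc.symm) rfl
          · refine (hbw w w' hw c).sub ?_ (fun _ _ _ _ => rfl)
            rintro u (rfl | rfl)
            · exact Or.inl rfl
            · exact Or.inr ⟨hp, rfl⟩
          · refine (hbw w w' hw c').sub ?_ (fun _ _ _ _ => rfl)
            rintro u (rfl | rfl)
            · exact Or.inl rfl
            · exact Or.inr ⟨hq, rfl⟩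
        exact close2 hG hgen (tw x y (Or.inl ⟨rfl, rfl⟩)) (tw y x (Or.inr ⟨rfl, rfl⟩)) hxy
          (by simp [x]) (by simp [x]) (by simp [y]) (by simp [y])
      · obtain ⟨d, d1, d2⟩ := hcon' c h1 c' h1' k h2 k' h2' h3 h4 h3' h4' hkk
        refine ⟨d, d1.pull pt _ _ _ ?_ (fun _ _ => rfl) ?_, d2.pull pt _ _ _ ?_ (fun _ _ => rfl) ?_⟩
        · simp [pt, x, y]
        · simp [pt, x, y, tri, upd, κ₀, F.ze, hij, hij.symm, h3, h4, Ne.symm h3, Ne.symm h4]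
        · simp [pt, x, y]
        · simp [pt, x, y, tri, upd, κ₀, F.ze, hij, hij.symm, h3', h4', Ne.symm h3', Ne.symm h4'])
  have hxym : ν x y ∈ L.C i j := by
    obtain ⟨f, f1, f2⟩ := n1
    have p1 : G.part (f x) = i := f1 x (by simp)
    have p2 : G.part (f y) = j := f1 y (by simp)
    rw [← f2 x (by simp) y (by simp), col_ne G (by rw [p1, p2]; exact hij)]
    have := G.colour_mem (f x) (f y) (by rw [p1, p2]; exact hij)
    rwa [p1, p2] at this
  obtain ⟨c, hc⟩ : ∃ c, c = ν x y := ⟨_, rfl⟩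
  rw [← hc] at hxym
  apply (F.mo c hxym).om
  let g : Fin m → Bool ⊕ (ℕ × Fin m) := fun k => if k = i then x else if k = j then y else .inr (c, k)
  have gi : g i = x := if_pos rfl
  have gj : g j = y := by simp [g, hij.symm]
  have gk : ∀ k, k ≠ i → k ≠ j → g k = .inr (c, k) := by
    intro k h1 h2
    simp [g, h1, h2]
  have gN : ∀ k ∈ P c, k ≠ i → k ≠ j → (.inr (c, k) : Bool ⊕ (ℕ × Fin m)) ∈ N := by
    intro k hk h1 h2
    exact (hN _).2 ⟨c, k, rfl, hxym, hk, h1, h2⟩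
  have ns : ν x y = ν y x := n1.symm (by simp) (by simp)
  refine n1.pull g _ _ _ ?_ ?_ ?_
  · intro k hk
    by_cases h1 : k = i
    · subst h1; rw [gi]; simp
    by_cases h2 : k = j
    · subst h2; rw [gj]; simp
    rw [gk k h1 h2]
    exact Or.inr (Or.inr (gN k hk h1 h2))
  · intro k hk
    by_cases h1 : k = i
    · subst h1; rw [gi]; rfl
    by_cases h2 : k = j
    · subst h2; rw [gj]; rfl
    rw [gk k h1 h2]
    rfl
  · intro k hk l hl
    by_cases h1 : k = i
    · subst h1
      rw [gi]
      by_cases h3 : l = k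
      · subst h3; rw [gi, F.ze, n2 x x (Or.inl rfl) (Or.inl rfl) (fun _ _ => rfl)]
      by_cases h4 : l = j
      · subst h4; rw [gj, F.co c hxym, hc]
      rw [gk l h3 h4, n2 x _ (Or.inl rfl) (Or.inr (gN l hl h3 h4)) (fun h => absurd h hxN)]
    by_cases h2 : k = j
    · subst h2
      rw [gj]
      by_cases h3 : l = i
      · subst h3; rw [gi, F.sy, F.co c hxym, hc, ns]
      by_cases h4 : l = k
      · subst h4; rw [gj, F.ze, n3 y y (Or.inl rfl) (Or.inl rfl) (fun _ _ => rfl)]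
      rw [gk l h3 h4, n3 y _ (Or.inl rfl) (Or.inr (gN l hl h3 h4)) (fun h => absurd h hyN)]
    rw [gk k h1 h2]
    by_cases h3 : l = i
    · subst h3
      rw [gi, n2 _ x (Or.inr (gN k hk h1 h2)) (Or.inl rfl) (fun _ h => absurd h hxN), F.sy]
    by_cases h4 : l = j
    · subst h4
      rw [gj, n3 _ y (Or.inr (gN k hk h1 h2)) (Or.inl rfl) (fun _ h => absurd h hyN), F.sy]
    rw [gk l h3 h4, n2 _ _ (Or.inr (gN k hk h1 h2)) (Or.inr (gN l hl h3 h4)) (fun _ _ => rfl)]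
    simp [κ₀]


lemma tri_vals {i j l : Fin m} (hij : i ≠ j) (hil : i ≠ l) (hjl : j ≠ l) (c a b : ℕ) :
    tri i j l c a b i j = c ∧ tri i j l c a b i l = a ∧ tri i j l c a b j l = b := by
  simp [tri, upd, hij, hil, hjl, hij.symm, hil.symm, hjl.symm]

lemma edge {G : LGraph L} (hgen : G.Generic) {p q : Fin m} (hpq : p ≠ q) {D : Fin m → Fin m → ℕ}
    (sy : ∀ u v, D u v = D v u) (ze : ∀ u, D u u = 0) (h : D p q ∈ L.C p q) :
    Rz G {p, q} id D := by
  classical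
  obtain ⟨u, hu⟩ := (hgen.2.1 p).nonempty
  have hu : G.part u = p := hu
  obtain ⟨x, hx, hxu⟩ := hgen.2.2 p q hpq {u} (by simp [hu]) (fun _ => D p q) (by simp [h])
  have hxu := hxu u (by simp)
  have c1 : col G x u = D p q := by
    rw [col_ne G (by rw [hx, hu]; exact hpq.symm), hxu]
  have c2 : col G u x = D p q := by rw [col_symm, c1]
  refine ⟨fun k => if k = p then u else x, ?_, ?_⟩
  · rintro k (rfl | rfl)
    · simp [hu]
    · simp [hpq.symm, hx]
  · rintro k (rfl | rfl) k' (rfl | rfl)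
    · simp [ze, col_same]
    · simp [hpq.symm, c2]
    · simp [hpq.symm, c1, sy]
    · simp [ze, col_same]

lemma mkMono {G : LGraph L} (hgen : G.Generic) {i j l : Fin m} (hij : i ≠ j) (hil : i ≠ l)
    (hjl : j ≠ l) {c a b : ℕ} (hc : c ∈ L.C i j) (ha : a ∈ L.C i l) (hb : b ∈ L.C j l)
    (h : ¬ RT G i j l c a b) : Mono G {i, j, l} (tri i j l c a b) := by
  obtain ⟨t1, t2, t3⟩ := tri_vals hij hil hjl c a b
  have sy := tri_symm i j l c a b
  have ze := tri_diag hij hil hjl c a b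
  refine ⟨?_, h⟩
  intro S hS hne
  have e1 := edge hgen hij sy ze (by rwa [t1])
  have e2 := edge hgen hil sy ze (by rwa [t2])
  have e3 := edge hgen hjl sy ze (by rwa [t3])
  have hS' : ∀ u ∈ S, u = i ∨ u = j ∨ u = l := fun u hu => by simpa using hS hu
  by_cases h1 : i ∈ S
  · by_cases h2 : j ∈ S
    · by_cases h3 : l ∈ S
      · refine absurd (Set.Subset.antisymm hS ?_) hne
        rintro u (rfl | rfl | rfl) <;> assumption
      · refine e1.sub ?_ (fun _ _ _ _ => rfl)
        intro u hu
        rcases hS' u hu with rfl | rfl | rfl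
        · simp
        · simp
        · exact absurd hu h3
    · refine e2.sub ?_ (fun _ _ _ _ => rfl)
      intro u hu
      rcases hS' u hu with rfl | rfl | rfl
      · simp
      · exact absurd hu h2
      · simp
  · refine e3.sub ?_ (fun _ _ _ _ => rfl)
    intro u hu
    rcases hS' u hu with rfl | rfl | rfl
    · exact absurd hu h1
    · simp
    · simp

lemma mem_of {G : LGraph L} {P : Set (Fin m)} {D : Fin m → Fin m → ℕ} (h : Mono G P D)
    {i j l : Fin m} (hi : i ∈ P) (hj : j ∈ P) (hl : l ∈ P) (hij : i ≠ j) (hil : i ≠ l)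
    (hjl : j ≠ l) : D i l ∈ L.C i l := by
  obtain ⟨f, f1, f2⟩ := h.min {i, l} (by rintro u (rfl | rfl) <;> assumption) (by
    intro h
    rw [← h] at hj
    rcases hj with h | h
    · exact hij h.symm
    · exact hjl h)
  have p1 : G.part (f i) = i := f1 i (by simp)
  have p2 : G.part (f l) = l := f1 l (by simp)
  have hne : G.part (f i) ≠ G.part (f l) := by rwa [p1, p2]
  rw [← f2 i (by simp) l (by simp), col_ne G hne]
  have := G.colour_mem _ _ hne
  rwa [p1, p2] at this

lemma Fam.rt {G : LGraph L} {i j : Fin m} (hij : i ≠ j) {P : ℕ → Set (Fin m)}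
    {D : ℕ → Fin m → Fin m → ℕ} (F : Fam G i j P D) {c : ℕ} (hc : c ∈ L.C i j) {l : Fin m}
    (hl : l ∈ P c) (hli : l ≠ i) (hlj : l ≠ j) (hne : P c ≠ {i, j, l}) :
    RT G i j l c (D c i l) (D c j l) := by
  have h := (F.mo c hc).min {i, j, l} (by
    rintro u (rfl | rfl | rfl)
    · exact F.hi c hc
    · exact F.hj c hc
    · exact hl) hne.symm
  have := rt_of hij hli.symm hlj.symm h (F.sy c) (F.ze c) (by simp) (by simp) (by simp)
  rwa [F.co c hc] at this

lemma OmP.symm {G : LGraph L} {i j k l : Fin m} {a b a' b' : ℕ} (h : OmP G i j k l a b a' b') :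
    OmP G i j l k a' b' a b := fun d hd => (h d hd).symm

/-- Replacing one member of the family by a triangle. -/
lemma Fam.repl {G : LGraph L} (hgen : G.Generic) {i j : Fin m} (hij : i ≠ j)
    {P : ℕ → Set (Fin m)} {D : ℕ → Fin m → Fin m → ℕ} (F : Fam G i j P D) {c : ℕ}
    (hc : c ∈ L.C i j) {k : Fin m} (hki : k ≠ i) (hkj : k ≠ j) {a b : ℕ} (ha : a ∈ L.C i k)
    (hb : b ∈ L.C j k) (h : ¬ RT G i j k c a b) :
    Fam G i j (Function.update P c {i, j, k}) (Function.update D c (tri i j k c a b)) := by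
  have hs : ∀ d, (d = c ∨ d ≠ c) := fun d => em _
  constructor
  · intro d u v
    rcases hs d with rfl | hd
    · simp [tri_symm i j k d a b u v]
    · simp [Function.update_of_ne hd, F.sy d u v]
  · intro d u
    rcases hs d with rfl | hd
    · simp [tri_diag hij hki.symm hkj.symm]
    · simp [Function.update_of_ne hd, F.ze d u]
  · intro d hdC
    rcases hs d with rfl | hd
    · simpa using mkMono hgen hij hki.symm hkj.symm hc ha hb h
    · simpa [Function.update_of_ne hd] using F.mo d hdC
  · intro d hdC
    rcases hs d with rfl | hd
    · simp
    · simpa [Function.update_of_ne hd] using F.hi d hdC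
  · intro d hdC
    rcases hs d with rfl | hd
    · simp
    · simpa [Function.update_of_ne hd] using F.hj d hdC
  · intro d hdC
    rcases hs d with rfl | hd
    · simpa using (tri_vals hij hki.symm hkj.symm d a b).1
    · simpa [Function.update_of_ne hd] using F.co d hdC

/-- The desired conclusion for a family. -/
def Good (G : LGraph L) (i j : Fin m) (P : ℕ → Set (Fin m)) (D : ℕ → Fin m → Fin m → ℕ) : Prop :=
  ∃ c ∈ L.C i j, ∃ c' ∈ L.C i j, ∃ k l, k ≠ l ∧ k ≠ i ∧ k ≠ j ∧ l ≠ i ∧ l ≠ j ∧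
    P c = {i, j, k} ∧ P c' = {i, j, l} ∧ OmP G i j k l (D c i k) (D c j k) (D c' i l) (D c' j l)

/-- The colours whose family member is not a triangle. -/
noncomputable def nonTri (L : MLang m) (i j : Fin m) (P : ℕ → Set (Fin m)) : Finset ℕ := by
  classical
  exact (L.C i j).filter (fun c => ¬ ∃ k, k ≠ i ∧ k ≠ j ∧ P c = {i, j, k})

lemma mem_nonTri {i j : Fin m} {P : ℕ → Set (Fin m)} {c : ℕ} :
    c ∈ nonTri L i j P ↔ c ∈ L.C i j ∧ ¬ ∃ k, k ≠ i ∧ k ≠ j ∧ P c = {i, j, k} := by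
  simp [nonTri]

lemma nonTri_lt {i j : Fin m} {P : ℕ → Set (Fin m)} {c : ℕ} (hc : c ∈ nonTri L i j P) {k : Fin m}
    (hki : k ≠ i) (hkj : k ≠ j) :
    (nonTri L i j (Function.update P c {i, j, k})).card < (nonTri L i j P).card := by
  apply Finset.card_lt_card
  rw [Finset.ssubset_iff_of_subset]
  · refine ⟨c, hc, ?_⟩
    rw [mem_nonTri]
    rintro ⟨_, h⟩
    exact h ⟨k, hki, hkj, by simp⟩
  · intro d hd
    rw [mem_nonTri] at hd ⊢
    refine ⟨hd.1, ?_⟩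
    have hdc : d ≠ c := by
      rintro rfl
      exact hd.2 ⟨k, hki, hkj, by simp⟩
    rw [Function.update_of_ne hdc] at hd
    exact hd.2

lemma tri_inj {i j k l : Fin m} (hki : k ≠ i) (hkj : k ≠ j)
    (h : ({i, j, k} : Set (Fin m)) = {i, j, l}) : k = l := by
  have : k ∈ ({i, j, l} : Set (Fin m)) := by rw [← h]; simp
  rcases this with h | h | h
  · exact absurd h hki
  · exact absurd h hkj
  · exact h

theorem good {G : LGraph L} (hG : G.Homogeneous) (hgen : G.Generic) {i j : Fin m} (hij : i ≠ j) :
    ∀ (n : ℕ) (P : ℕ → Set (Fin m)) (D : ℕ → Fin m → Fin m → ℕ), Fam G i j P D →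
      (nonTri L i j P).card = n → Good G i j P D := by
  intro n
  induction n using Nat.strong_induction_on with
  | _ n ih =>
  intro P D F hn
  -- membership of colours
  have mi : ∀ c ∈ L.C i j, ∀ k ∈ P c, k ≠ i → k ≠ j → D c i k ∈ L.C i k := by
    intro c hc k hk h1 h2
    exact mem_of (F.mo c hc) (F.hi c hc) (F.hj c hc) hk hij h1.symm h2.symm
  have mj : ∀ c ∈ L.C i j, ∀ k ∈ P c, k ≠ i → k ≠ j → D c j k ∈ L.C j k := by
    intro c hc k hk h1 h2
    exact mem_of (F.mo c hc) (F.hj c hc) (F.hi c hc) hk hij.symm h2.symm h1.symm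
  have nt : ∀ c ∈ nonTri L i j P, ∀ k ∈ P c, k ≠ i → k ≠ j → RT G i j k c (D c i k) (D c j k) := by
    intro c hc k hk h1 h2
    rw [mem_nonTri] at hc
    exact F.rt hij hc.1 hk h1 h2 (fun h => hc.2 ⟨k, h1, h2, h⟩)
  have tn : ∀ c ∈ L.C i j, c ∉ nonTri L i j P → ∀ k ∈ P c, k ≠ i → k ≠ j → P c = {i, j, k} := by
    intro c hc hcn k hk h1 h2
    rw [mem_nonTri] at hcn
    have : ∃ k, k ≠ i ∧ k ≠ j ∧ P c = {i, j, k} := by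
      by_contra h
      exact hcn ⟨hc, h⟩
    obtain ⟨k', h3, h4, h5⟩ := this
    rw [h5] at hk ⊢
    rcases hk with h | h | h
    · exact absurd h h1
    · exact absurd h h2
    · have h : k = k' := h
      rw [h]
  -- one triangle
  have one : ∀ c ∈ L.C i j, ∀ k, k ≠ i → k ≠ j → P c = {i, j, k} → ∀ c' ∈ nonTri L i j P,
      ∀ l ∈ P c', l ≠ i → l ≠ j → OmP G i j k l (D c i k) (D c j k) (D c' i l) (D c' j l) →
      Good G i j P D := by
    intro c hc k hki hkj hPc c' hc' l hl hli hlj hom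
    have hc'C := (mem_nonTri.1 hc').1
    have hkP : k ∈ P c := by rw [hPc]; simp
    have hnr : ¬ RT G i j k c' (D c i k) (D c j k) :=
      (hom c' hc'C).resolve_right (fun h => h (nt c' hc' l hl hli hlj))
    have F' := F.repl hgen hij hc'C hki hkj (mi c hc k hkP hki hkj) (mj c hc k hkP hki hkj) hnr
    have hcc : c ≠ c' := by
      rintro rfl
      exact (mem_nonTri.1 hc').2 ⟨k, hki, hkj, hPc⟩
    obtain ⟨c1, h1, c2, h2, k1, l1, a1, a2, a3, a4, a5, p1, p2, ho⟩ :=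
      ih _ (hn ▸ nonTri_lt hc' hki hkj) _ _ F' rfl
    have key : ∀ c1 ∈ L.C i j, ∀ k1, k1 ≠ i → k1 ≠ j →
        Function.update P c' {i, j, k} c1 = {i, j, k1} → ∃ c2 ∈ L.C i j, P c2 = {i, j, k1} ∧
        D c2 i k1 = Function.update D c' (tri i j k c' (D c i k) (D c j k)) c1 i k1 ∧
        D c2 j k1 = Function.update D c' (tri i j k c' (D c i k) (D c j k)) c1 j k1 := by
      intro c1 h1 k1 b1 b2 hp
      by_cases h : c1 = c'
      · subst h
        rw [Function.update_self] at hp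
        have := tri_inj hki hkj hp
        subst this
        obtain ⟨t1, t2, t3⟩ := tri_vals hij hki.symm hkj.symm c1 (D c i k) (D c j k)
        refine ⟨c, hc, hPc, ?_, ?_⟩
        · rw [Function.update_self, t2]
        · rw [Function.update_self, t3]
      · rw [Function.update_of_ne h] at hp ⊢
        exact ⟨c1, h1, hp, rfl, rfl⟩
    obtain ⟨d1, e1, e2, e3, e4⟩ := key c1 h1 k1 a2 a3 p1
    obtain ⟨d2, g1, g2, g3, g4⟩ := key c2 h2 l1 a4 a5 p2
    refine ⟨d1, e1, d2, g1, k1, l1, a1, a2, a3, a4, a5, e2, g2, ?_⟩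
    rw [e3, e4, g3, g4]
    exact ho
  obtain ⟨c, hc, c', hc', k, hk, l, hl, hki, hkj, hli, hlj, hkl, hom⟩ := main_pair hG hgen hij F
  by_cases hcn : c ∈ nonTri L i j P
  · by_cases hcn' : c' ∈ nonTri L i j P
    · have hnr : ¬ RT G i j l c (D c' i l) (D c' j l) :=
        (hom c hc).resolve_left (fun h => h (nt c hcn k hk hki hkj))
      have F' := F.repl hgen hij hc hli hlj (mi c' hc' l hl hli hlj) (mj c' hc' l hl hli hlj) hnr
      obtain ⟨c1, h1, c2, h2, k1, l1, a1, a2, a3, a4, a5, p1, p2, ho⟩ :=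
        ih _ (hn ▸ nonTri_lt hcn hli hlj) _ _ F' rfl
      obtain ⟨t1, t2, t3⟩ := tri_vals hij hli.symm hlj.symm c (D c' i l) (D c' j l)
      by_cases e1 : c1 = c
      · subst e1
        rw [Function.update_self] at p1 ho
        have := tri_inj hli hlj p1
        subst this
        rw [t2, t3] at ho
        have e2 : c2 ≠ c1 := by
          rintro rfl
          rw [Function.update_self] at p2
          exact a1 (tri_inj hli hlj p2)
        rw [Function.update_of_ne e2] at p2 ho
        exact one c2 h2 l1 a4 a5 p2 c' hcn' l hl hli hlj ho.symm
      · rw [Function.update_of_ne e1] at p1 ho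
        by_cases e2 : c2 = c
        · subst e2
          rw [Function.update_self] at p2 ho
          have := tri_inj hli hlj p2
          subst this
          rw [t2, t3] at ho
          exact one c1 h1 k1 a2 a3 p1 c' hcn' l hl hli hlj ho
        · rw [Function.update_of_ne e2] at p2 ho
          exact ⟨c1, h1, c2, h2, k1, l1, a1, a2, a3, a4, a5, p1, p2, ho⟩
    · exact one c' hc' l hli hlj (tn c' hc' hcn' l hl hli hlj) c hcn k hk hki hkj hom.symm
  · by_cases hcn' : c' ∈ nonTri L i j P
    · exact one c hc k hki hkj (tn c hc hcn k hk hki hkj) c' hcn' l hl hli hlj hom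
    · exact ⟨c, hc, c', hc', k, l, hkl, hki, hkj, hli, hlj, tn c hc hcn k hk hki hkj,
        tn c' hc' hcn' l hl hli hlj, hom⟩


lemma toMono {G : LGraph L} {A : LGraph L} (hA : A.Monic) (hm : G.MinOmitted A) {i j : Fin m}
    (hij : i ≠ j) {c : ℕ} (hc : A.Covers i j c) :
    ∃ (P : Set (Fin m)) (D : Fin m → Fin m → ℕ), (∀ u v, D u v = D v u) ∧ (∀ u, D u u = 0) ∧
      Mono G P D ∧ i ∈ P ∧ j ∈ P ∧ D i j = c ∧ (∀ u, A.part u ∈ P) ∧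
      (∀ k ∈ P, ∃ u, A.part u = k) ∧
      ∀ u v, A.part u ≠ A.part v → A.colour u v = D (A.part u) (A.part v) := by
  classical
  obtain ⟨x, y, hx, hy, hxy⟩ := hc
  have hv : ∀ k, ∃ v : A.V, k ∈ Set.range A.part → A.part v = k := by
    intro k
    by_cases h : k ∈ Set.range A.part
    · obtain ⟨v, hv⟩ := h
      exact ⟨v, fun _ => hv⟩
    · exact ⟨x, fun h' => absurd h' h⟩
  choose v hv using hv
  have hvp : ∀ u, v (A.part u) = u := fun u => hA _ _ (hv _ ⟨u, rfl⟩)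
  have hD : ∀ u w, col A (v (A.part u)) (v (A.part w)) = col A u w := by
    intro u w
    rw [hvp, hvp]
  refine ⟨Set.range A.part, fun k l => col A (v k) (v l), fun _ _ => col_symm _ _ _,
    fun _ => col_same _ rfl, ⟨?_, ?_⟩, ⟨x, hx⟩, ⟨y, hy⟩, ?_, fun u => ⟨u, rfl⟩, fun k hk => hk, ?_⟩
  · intro S hS hne
    obtain ⟨f, -, f1, f2⟩ := hm.2.2 (A.part ⁻¹' S) (by
      intro h
      apply hne
      refine Set.Subset.antisymm hS ?_
      rintro _ ⟨u, rfl⟩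
      have : u ∈ A.part ⁻¹' S := by rw [h]; trivial
      exact this)
    have hvS : ∀ k ∈ S, v k ∈ A.part ⁻¹' S := by
      intro k hk
      show A.part (v k) ∈ S
      rw [hv k (hS hk)]
      exact hk
    by_cases hne : S.Nonempty
    swap
    · rw [Set.not_nonempty_iff_eq_empty] at hne
      subst hne
      by_cases hG : Nonempty G.V
      · obtain ⟨g⟩ := hG
        exact ⟨fun _ => g, by simp, by simp⟩
      · exfalso
        obtain ⟨f, -⟩ := hm.2.2 {x} (by
          intro h
          have : y ∈ ({x} : Set A.V) := by rw [h]; trivial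
          have : y = x := this
          subst this
          exact hij (hx.symm.trans hy))
        exact hG ⟨f ⟨x, rfl⟩⟩
    obtain ⟨k0, hk0⟩ := hne
    let g : Fin m → G.V := fun k => if h : k ∈ S then f ⟨v k, hvS k h⟩ else f ⟨v k0, hvS k0 hk0⟩
    have hg : ∀ k (h : k ∈ S), g k = f ⟨v k, hvS k h⟩ := fun k h => dif_pos h
    have gp : ∀ k ∈ S, G.part (g k) = k := by
      intro k hk
      rw [hg k hk]
      exact (f1 _).trans (hv k (hS hk))
    refine ⟨g, gp, ?_⟩
    intro k hk l hl
    show _ = col A (v k) (v l)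
    by_cases hkl : k = l
    · subst hkl
      rw [col_same G rfl, col_same A rfl]
    · have hne : A.part (v k) ≠ A.part (v l) := by rwa [hv k (hS hk), hv l (hS hl)]
      rw [col_ne G (by rwa [gp k hk, gp l hl]), col_ne A hne, hg k hk, hg l hl]
      exact f2 _ _ hne
  · rintro ⟨f, f1, f2⟩
    apply hm.2.1
    refine ⟨fun u => f (A.part u), ?_, ?_, ?_⟩
    · intro u w h
      apply hA
      have h : f (A.part u) = f (A.part w) := h
      have h1 : G.part (f (A.part u)) = A.part u := f1 _ ⟨u, rfl⟩
      have h2 : G.part (f (A.part w)) = A.part w := f1 _ ⟨w, rfl⟩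
      rw [← h1, ← h2, h]
    · intro u
      exact f1 _ ⟨u, rfl⟩
    · intro u w h
      have h1 : G.part (f (A.part u)) = A.part u := f1 _ ⟨u, rfl⟩
      have h2 : G.part (f (A.part w)) = A.part w := f1 _ ⟨w, rfl⟩
      have : _ = col A (v (A.part u)) (v (A.part w)) := f2 _ ⟨u, rfl⟩ _ ⟨w, rfl⟩
      rw [hD, col_ne A h, col_ne G (by rwa [h1, h2])] at this
      exact this
  · subst hx; subst hy
    show col A (v (A.part x)) (v (A.part y)) = c
    rw [hD, col_ne A hij, hxy]
  · intro u w h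
    show _ = col A (v (A.part u)) (v (A.part w))
    rw [hD, col_ne A h]

lemma mkTri {G : LGraph L} {i j l : Fin m} (hij : i ≠ j) (hil : i ≠ l)
    (hjl : j ≠ l) {c a b : ℕ} (hc : c ∈ L.C i j) (ha : a ∈ L.C i l) (hb : b ∈ L.C j l)
    (h : Mono G {i, j, l} (tri i j l c a b)) :
    ∃ B : LGraph L, G.MinOmitted B ∧ B.IsTriangleOn i j l ∧ B.Covers i j c ∧
      (∀ x y, B.part x = i → B.part y = l → B.colour x y = a) ∧
      (∀ x y, B.part x = j → B.part y = l → B.colour x y = b) := by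
  obtain ⟨t1, t2, t3⟩ := tri_vals hij hil hjl c a b
  have sy := tri_symm i j l c a b
  let B : LGraph L :=
    { V := {k : Fin m // k ∈ ({i, j, l} : Set (Fin m))}
      part := fun u => u.1
      colour := fun u w => tri i j l c a b u.1 w.1
      colour_symm := fun u w => sy u.1 w.1
      colour_mem := by
        rintro ⟨u, hu⟩ ⟨w, hw⟩ huw
        have huw : u ≠ w := huw
        show tri i j l c a b u w ∈ L.C u w
        rcases hu with rfl | rfl | hu
        · rcases hw with rfl | rfl | hw
          · exact absurd rfl huw
          · rwa [t1]
          · have hw : w = l := hw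
            subst hw
            rwa [t2]
        · rcases hw with rfl | rfl | hw
          · rwa [sy, t1, L.symm]
          · exact absurd rfl huw
          · have hw : w = l := hw
            subst hw
            rwa [t3]
        · have hu : u = l := hu
          subst hu
          rcases hw with rfl | rfl | hw
          · rwa [sy, t2, L.symm]
          · rwa [sy, t3, L.symm]
          · exact absurd hw.symm huw }
  have hmon : B.Monic := fun u w h => Subtype.ext h
  refine ⟨B, ⟨?_, ?_, ?_⟩, ⟨hmon, ?_, ⟨⟨i, by simp⟩, rfl⟩, ⟨⟨j, by simp⟩, rfl⟩, ⟨⟨l, by simp⟩, rfl⟩⟩,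
    ⟨⟨i, by simp⟩, ⟨j, by simp⟩, rfl, rfl, t1⟩, ?_, ?_⟩
  · exact inferInstanceAs (Finite {k : Fin m // k ∈ ({i, j, l} : Set (Fin m))})
  · rintro ⟨f, f0, f1, f2⟩
    apply h.om
    classical
    let g : Fin m → G.V := fun k => if h : k ∈ ({i, j, l} : Set (Fin m)) then f ⟨k, h⟩
      else f ⟨i, by simp⟩
    have hg : ∀ k (h : k ∈ ({i, j, l} : Set (Fin m))), g k = f ⟨k, h⟩ := fun k h => dif_pos h
    have gp : ∀ k ∈ ({i, j, l} : Set (Fin m)), G.part (g k) = k := by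
      intro k hk
      rw [hg k hk]
      exact f1 _
    refine ⟨g, gp, ?_⟩
    intro u hu w hw
    by_cases huw : u = w
    · subst huw
      rw [col_same G rfl, tri_diag hij hil hjl]
    · rw [col_ne G (by rwa [gp u hu, gp w hw]), hg u hu, hg w hw]
      exact f2 _ _ huw
  · intro S hS
    obtain ⟨f, f1, f2⟩ := h.min {k | ∃ h : k ∈ ({i, j, l} : Set (Fin m)), (⟨k, h⟩ : B.V) ∈ S}
      (fun k hk => hk.1) (by
        intro h
        apply hS
        rw [Set.eq_univ_iff_forall]
        rintro ⟨k, hk⟩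
        have hk' := hk
        rw [← h] at hk'
        exact hk'.2)
    have fp : ∀ u : (B.restrict S).V, G.part (f u.1.1) = u.1.1 := fun u => f1 _ ⟨u.1.2, u.2⟩
    refine ⟨fun u => f u.1.1, ?_, ?_, ?_⟩
    · intro u w h
      have h : f u.1.1 = f w.1.1 := h
      apply Subtype.ext
      apply Subtype.ext
      rw [← fp u, ← fp w, h]
    · intro u
      exact fp u
    · intro u w huw
      have huw : u.1.1 ≠ w.1.1 := huw
      have := f2 _ ⟨u.1.2, u.2⟩ _ ⟨w.1.2, w.2⟩
      rw [col_ne G (by rwa [fp, fp])] at this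
      exact this
  · rintro ⟨u, hu⟩
    exact hu
  · rintro ⟨x, hx'⟩ ⟨y, hy'⟩ hx hy
    have hx : x = i := hx
    have hy : y = l := hy
    show tri i j l c a b x y = _
    rw [hx, hy, t2]
  · rintro ⟨x, hx'⟩ ⟨y, hy'⟩ hx hy
    have hx : x = j := hx
    have hy : y = l := hy
    show tri i j l c a b x y = _
    rw [hx, hy, t3]

theorem final {G : LGraph L} (hG : G.Homogeneous) (hgen : G.Generic)
    (i j : Fin m) (hij : i ≠ j)
    (𝒜 : Set (LGraph L)) (h𝒜 : ∀ A ∈ 𝒜, G.MinOmitted A)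
    (hcov : IsCoverSet 𝒜 i j) :
    ∃ k' l' : Fin m, k' ≠ l' ∧ k' ≠ i ∧ k' ≠ j ∧ l' ≠ i ∧ l' ≠ j ∧
      (∃ S : Set (LGraph L), (∀ A ∈ S, G.MinOmitted A) ∧
        ∃ cik cil cjk cjl : ℕ, IsOmissionSet S i j k' l' cik cil cjk cjl ∧
          BasedOnTriangles 𝒜 i j k' l' cik cil cjk cjl) ∧
      (∃ A ∈ 𝒜, A.IsTriangleOn i j k') ∧ (∃ A ∈ 𝒜, A.IsTriangleOn i j l') := by
  have hfam : ∀ c, ∃ (P : Set (Fin m)) (D : Fin m → Fin m → ℕ), (∀ u v, D u v = D v u) ∧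
      (∀ u, D u u = 0) ∧ (c ∈ L.C i j → Mono G P D ∧ i ∈ P ∧ j ∈ P ∧ D i j = c ∧
      ∃ A ∈ 𝒜, (∀ u, A.part u ∈ P) ∧ (∀ k ∈ P, ∃ u, A.part u = k) ∧
      ∀ u v, A.part u ≠ A.part v → A.colour u v = D (A.part u) (A.part v)) := by
    intro c
    by_cases hc : c ∈ L.C i j
    · obtain ⟨A, hA, hAc⟩ := hcov.2 c hc
      obtain ⟨P, D, h1, h2, h3, h4, h5, h6, h7⟩ := toMono (hcov.1 A hA) (h𝒜 A hA) hij hAc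
      exact ⟨P, D, h1, h2, fun _ => ⟨h3, h4, h5, h6, A, hA, h7⟩⟩
    · exact ⟨∅, fun _ _ => 0, fun _ _ => rfl, fun _ => rfl, fun h => absurd h hc⟩
  choose P D h1 h2 h3 using hfam
  have F : Fam G i j P D := ⟨h1, h2, fun c hc => (h3 c hc).1, fun c hc => (h3 c hc).2.1,
    fun c hc => (h3 c hc).2.2.1, fun c hc => (h3 c hc).2.2.2.1⟩
  obtain ⟨c, hc, c', hc', k, l, hkl, hki, hkj, hli, hlj, hP, hP', hom⟩ :=
    good hG hgen hij _ P D F rfl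
  have tr : ∀ c ∈ L.C i j, ∀ k, k ≠ i → k ≠ j → P c = {i, j, k} → ∃ A ∈ 𝒜, A.IsTriangleOn i j k ∧
      A.Covers i k (D c i k) ∧ A.Covers j k (D c j k) := by
    intro c hc k hki hkj hP
    obtain ⟨-, -, -, -, A, hA, a1, a2, a3⟩ := h3 c hc
    rw [hP] at a1 a2
    obtain ⟨x, hx⟩ := a2 i (by simp)
    obtain ⟨y, hy⟩ := a2 j (by simp)
    obtain ⟨z, hz⟩ := a2 k (by simp)
    refine ⟨A, hA, ⟨hcov.1 A hA, fun u => a1 u, ⟨x, hx⟩, ⟨y, hy⟩, ⟨z, hz⟩⟩, ⟨x, z, hx, hz, ?_⟩,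
      ⟨y, z, hy, hz, ?_⟩⟩
    · rw [a3 x z (by rw [hx, hz]; exact hki.symm), hx, hz]
    · rw [a3 y z (by rw [hy, hz]; exact hkj.symm), hy, hz]
  have mem : ∀ c ∈ L.C i j, ∀ k, k ≠ i → k ≠ j → P c = {i, j, k} →
      D c i k ∈ L.C i k ∧ D c j k ∈ L.C j k := by
    intro c hc k h1 h2 hP
    have hk : k ∈ P c := by rw [hP]; simp
    exact ⟨mem_of (F.mo c hc) (F.hi c hc) (F.hj c hc) hk hij h1.symm h2.symm,
      mem_of (F.mo c hc) (F.hj c hc) (F.hi c hc) hk hij.symm h2.symm h1.symm⟩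
  obtain ⟨A, hA, At, A1, A2⟩ := tr c hc k hki hkj hP
  obtain ⟨A', hA', At', A1', A2'⟩ := tr c' hc' l hli hlj hP'
  obtain ⟨m1, m2⟩ := mem c hc k hki hkj hP
  obtain ⟨m1', m2'⟩ := mem c' hc' l hli hlj hP'
  refine ⟨k, l, hkl, hki, hkj, hli, hlj, ?_, ⟨A, hA, At⟩, ⟨A', hA', At'⟩⟩
  let T : Fin m → ℕ → ℕ → LGraph L → Prop := fun k a b B => B.IsTriangleOn i j k ∧
    (∀ x y, B.part x = i → B.part y = k → B.colour x y = a) ∧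
    (∀ x y, B.part x = j → B.part y = k → B.colour x y = b)
  have novert : ∀ (k l : Fin m) (a b : ℕ) (B : LGraph L), T k a b B → l ≠ i → l ≠ j → l ≠ k →
      ∀ y : B.V, B.part y = l → False := by
    rintro k l a b B ⟨⟨_, hB, _⟩, _⟩ g1 g2 g3 y hy
    rcases hB y with h | h | h
    · exact g1 (hy.symm.trans h)
    · exact g2 (hy.symm.trans h)
    · exact g3 (hy.symm.trans h)
  refine ⟨{B | G.MinOmitted B ∧ (T k (D c i k) (D c j k) B ∨ T l (D c' i l) (D c' j l) B)},
    fun B hB => hB.1, D c i k, D c' i l, D c j k, D c' j l, ⟨⟨?_, ?_⟩, ?_, ?_, ?_, ?_, ?_⟩, ?_⟩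
  · rintro B ⟨_, hB | hB⟩ <;> exact hB.1.1
  · intro d hd
    rcases hom d hd with h | h
    · obtain ⟨B, B1, B2, B3, B4⟩ := mkTri hij hki.symm hkj.symm hd m1 m2
        (mkMono hgen hij hki.symm hkj.symm hd m1 m2 h)
      exact ⟨B, ⟨B1, Or.inl ⟨B2, B4⟩⟩, B3⟩
    · obtain ⟨B, B1, B2, B3, B4⟩ := mkTri hij hli.symm hlj.symm hd m1' m2'
        (mkMono hgen hij hli.symm hlj.symm hd m1' m2' h)
      exact ⟨B, ⟨B1, Or.inr ⟨B2, B4⟩⟩, B3⟩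
  · rintro B ⟨_, hB | hB⟩
    · exact Or.inl hB.1
    · exact Or.inr hB.1
  · rintro B ⟨_, hB | hB⟩ x y hx hy
    · exact hB.2.1 x y hx hy
    · exact (novert l k _ _ B hB hki hkj hkl y hy).elim
  · rintro B ⟨_, hB | hB⟩ x y hx hy
    · exact (novert k l _ _ B hB hli hlj hkl.symm y hy).elim
    · exact hB.2.1 x y hx hy
  · rintro B ⟨_, hB | hB⟩ x y hx hy
    · exact hB.2.2 x y hx hy
    · exact (novert l k _ _ B hB hki hkj hkl y hy).elim
  · rintro B ⟨_, hB | hB⟩ x y hx hy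
    · exact (novert k l _ _ B hB hli hlj hkl.symm y hy).elim
    · exact hB.2.2 x y hx hy
  · exact ⟨A, hA, A', hA', ⟨i, j, k, hij, hki.symm, hkj.symm, At⟩,
      ⟨i, j, l, hij, hli.symm, hlj.symm, At'⟩, A1, A2, A1', A2'⟩

end OmS

/-- If a `C_{ij}`-cover set `𝒜 ⊆ O(G)` has some omission set in `O(G)`
based on it, then it has one based on triangles from `𝒜`; in particular `𝒜` contains
an `ijk'`-triangle and an `ijl'`-triangle. -/
theorem omission_set_based_on_triangles
    {m : ℕ} {L : MLang m} (hm : 2 ≤ m)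
    (G : LGraph L) (hG : G.Homogeneous) (hgen : G.Generic)
    (i j : Fin m) (hij : i ≠ j)
    (𝒜 : Set (LGraph L)) (h𝒜 : ∀ A ∈ 𝒜, G.MinOmitted A)
    (hcov : IsCoverSet 𝒜 i j)
    (hbased : ∃ k l : Fin m, k ≠ l ∧ k ≠ i ∧ k ≠ j ∧ l ≠ i ∧ l ≠ j ∧
      ∃ S : Set (LGraph L), (∀ A ∈ S, G.MinOmitted A) ∧
        ∃ cik cil cjk cjl : ℕ, IsOmissionSet S i j k l cik cil cjk cjl ∧
          BasedOn 𝒜 i j k l cik cil cjk cjl) :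
    ∃ k' l' : Fin m, k' ≠ l' ∧ k' ≠ i ∧ k' ≠ j ∧ l' ≠ i ∧ l' ≠ j ∧
      (∃ S : Set (LGraph L), (∀ A ∈ S, G.MinOmitted A) ∧
        ∃ cik cil cjk cjl : ℕ, IsOmissionSet S i j k' l' cik cil cjk cjl ∧
          BasedOnTriangles 𝒜 i j k' l' cik cil cjk cjl) ∧
      (∃ A ∈ 𝒜, A.IsTriangleOn i j k') ∧ (∃ A ∈ 𝒜, A.IsTriangleOn i j l') := by
  exact OmS.final hG hgen i j hij 𝒜 h𝒜 hcov
end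

section
/- Let G be a homogeneous m-generic L-graph and suppose O(G) contains a C_{ij}^{kl}-omission set with code Ω = (i,j,k,l; c_{ik}, c_{il}, c_{jk}, c_{jl}). Then no member of O(G) has vertices in all four parts V_i, V_j, V_k, V_l while simultaneously having E_{ik}-colour c_{ik}, E_{il}-colour c_{il}, E_{jk}-colour c_{jk} and E_{jl}-colour c_{jl}. -/
open LGraph

variable {m : ℕ} {L : MLang m}

namespace OmissionProof

/-- `ψ` is an automorphism of `G`. -/
def Aut {m : ℕ} {L : MLang m} (G : LGraph L) (ψ : G.V ≃ G.V) : Prop :=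
  (∀ x, G.part (ψ x) = G.part x) ∧
    ∀ x y : G.V, G.part x ≠ G.part y → G.colour (ψ x) (ψ y) = G.colour x y

/-- Realizations of the type of `v` over `B` (ignoring vertices of `B` in the part of `v`). -/
def Rl {m : ℕ} {L : MLang m} (G : LGraph L) (B : Finset G.V) (v : G.V) : Set G.V :=
  {w | G.part w = G.part v ∧ ∀ b ∈ B, G.part b ≠ G.part v → G.colour w b = G.colour v b}

lemma ext_aut {m : ℕ} {L : MLang m} {G : LGraph L} (hG : G.Homogeneous) (B : Finset G.V)
    (P : Set (G.V × G.V)) (hP : P.Finite)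
    (h1 : ∀ p ∈ P, p.1 ∉ B ∧ p.2 ∉ B ∧ p.2 ∈ Rl G B p.1)
    (h2 : ∀ p ∈ P, ∀ q ∈ P, (p.1 = q.1 ↔ p.2 = q.2) ∧
      (G.part p.1 ≠ G.part q.1 → G.colour p.2 q.2 = G.colour p.1 q.1)) :
    ∃ ψ : G.V ≃ G.V, Aut G ψ ∧ (∀ b ∈ B, ψ b = b) ∧ ∀ p ∈ P, ψ p.1 = p.2 := by
  classical
  let φ : G.V → G.V := fun x => if h : ∃ y, (x, y) ∈ P then h.choose else x
  have hφP : ∀ p ∈ P, φ p.1 = p.2 := by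
    intro p hp
    have h : ∃ y, (p.1, y) ∈ P := ⟨p.2, hp⟩
    have e : φ p.1 = h.choose := dif_pos h
    rw [e]
    exact ((h2 _ h.choose_spec _ hp).1).1 rfl
  have hφB : ∀ b ∈ B, φ b = b := by
    intro b hb
    refine dif_neg ?_
    rintro ⟨y, hy⟩
    exact (h1 _ hy).1 hb
  obtain ⟨ψ, a, b, c⟩ := hG ((B : Set G.V) ∪ Prod.fst '' P)
    (B.finite_toSet.union (hP.image _)) φ (by
      refine ⟨?_, ?_, ?_⟩
      · rintro x (hx | ⟨p, hp, rfl⟩) y (hy | ⟨q, hq, rfl⟩) hxy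
        · rwa [hφB x hx, hφB y hy] at hxy
        · rw [hφB x hx, hφP q hq] at hxy
          exact absurd (hxy ▸ hx) (h1 q hq).2.1
        · rw [hφB y hy, hφP p hp] at hxy
          exact absurd (hxy.symm ▸ hy) (h1 p hp).2.1
        · rw [hφP p hp, hφP q hq] at hxy
          exact ((h2 p hp q hq).1).2 hxy
      · rintro x (hx | ⟨p, hp, rfl⟩)
        · rw [hφB x hx]
        · rw [hφP p hp]; exact (h1 p hp).2.2.1
      · rintro x (hx | ⟨p, hp, rfl⟩) y (hy | ⟨q, hq, rfl⟩) hxy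
        · rw [hφB x hx, hφB y hy]
        · rw [hφB x hx, hφP q hq, G.colour_symm, G.colour_symm x]
          exact (h1 q hq).2.2.2 x hx hxy
        · rw [hφB y hy, hφP p hp]
          exact (h1 p hp).2.2.2 y hy hxy.symm
        · rw [hφP p hp, hφP q hq]
          exact (h2 p hp q hq).2 hxy)
  refine ⟨ψ, ⟨a, b⟩, fun x hx => ?_, fun p hp => ?_⟩
  · rw [c x (Or.inl hx), hφB x hx]
  · rw [c p.1 (Or.inr ⟨p, hp, rfl⟩), hφP p hp]

lemma Rl_self {m : ℕ} {L : MLang m} {G : LGraph L} (B : Finset G.V) (v : G.V) : v ∈ Rl G B v :=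
  ⟨rfl, fun _ _ _ => rfl⟩

lemma aut_Rl {m : ℕ} {L : MLang m} {G : LGraph L} {B : Finset G.V} {ψ : G.V ≃ G.V}
    (hψ : Aut G ψ) (hB : ∀ b ∈ B, ψ b = b) {v w : G.V} (hw : w ∈ Rl G B v) :
    ψ w ∈ Rl G B v := by
  refine ⟨(hψ.1 w).trans hw.1, fun b hb hbv => ?_⟩
  rw [← hw.2 b hb hbv]
  conv_lhs => rw [← hB b hb]
  exact hψ.2 _ _ (by rw [hw.1]; exact hbv.symm)

lemma aut_notMem {m : ℕ} {L : MLang m} {G : LGraph L} {B : Finset G.V} {ψ : G.V ≃ G.V}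
    (hB : ∀ b ∈ B, ψ b = b) {w : G.V} (hw : w ∉ B) : ψ w ∉ B := by
  intro h
  have := hB _ h
  have := ψ.injective this
  exact hw (this ▸ h)

/-- An injection of a countable type into a given infinite set. -/
lemma exists_inj {α : Type} (hc : Countable α) {S : Set α} (hS : S.Infinite) :
    ∃ f : α → α, Function.Injective f ∧ ∀ x, f x ∈ S := by
  obtain ⟨e, he⟩ := hc.exists_injective_nat
  refine ⟨fun x => (hS.natEmbedding S (e x) : α), ?_, fun x => (hS.natEmbedding S (e x)).2⟩
  intro x y hxy
  exact he ((hS.natEmbedding S).injective (Subtype.ext hxy))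

/-- Types over sets in one other part are infinite. -/
lemma infinite_base {m : ℕ} {L : MLang m} {G : LGraph L} (hgen : G.Generic) (B : Finset G.V)
    (v : G.V) (j : Fin m) (hj : j ≠ G.part v) (hB : ∀ b ∈ B, G.part b = j) :
    (Rl G B v).Infinite := by
  classical
  obtain ⟨hc, hinf, hg⟩ := hgen
  by_cases hcard : ∀ a ∈ L.C j (G.part v), ∀ b ∈ L.C j (G.part v), a = b
  · refine (hinf (G.part v)).mono ?_
    intro w hw
    have hw : G.part w = G.part v := hw
    refine ⟨hw, fun b hb hbv => hcard _ ?_ _ ?_⟩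
    · have := G.colour_mem b w (by rw [hw]; exact hbv)
      rw [G.colour_symm, ← hw, ← hB b hb]; exact this
    · have := G.colour_mem b v hbv
      rw [G.colour_symm, ← hB b hb]; exact this
  · push Not at hcard
    obtain ⟨a, ha, b, hb, hab⟩ := hcard
    intro hfin
    have hd : ∀ n : ℕ, ∃ d ∈ L.C j (G.part v), d ≠ n := by
      intro n
      by_cases h : a = n
      · exact ⟨b, hb, fun h' => hab (h.trans h'.symm)⟩
      · exact ⟨a, ha, h⟩
    choose d hd1 hd2 using hd
    obtain ⟨f, hf, hfS⟩ := exists_inj hc ((hinf j).sdiff B.finite_toSet)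
    have hne : Nonempty G.V := ⟨v⟩
    obtain ⟨x, hx, hxU⟩ := hg j (G.part v) hj (B ∪ hfin.toFinset.image f) (by
        intro u hu
        rcases Finset.mem_union.1 hu with hu | hu
        · exact hB u hu
        · obtain ⟨r, -, rfl⟩ := Finset.mem_image.1 hu
          exact (hfS r).1)
      (fun u => if u ∈ B then G.colour v u else d (G.colour (Function.invFun f u) u)) (by
        intro u hu
        by_cases h : u ∈ B
        · simp only [h, if_true]
          have := G.colour_mem u v (by rw [hB u h]; exact hj)
          rw [G.colour_symm, ← hB u h]; exact this
        · simp only [h, if_false]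
          exact hd1 _)
    have hxR : x ∈ Rl G B v := by
      refine ⟨hx, fun b hb _ => ?_⟩
      have := hxU b (Finset.mem_union_left _ hb)
      simpa [hb] using this
    have h1 := hxU (f x) (Finset.mem_union_right _ (Finset.mem_image_of_mem _ (by simpa using hxR)))
    have h2 : f x ∉ B := (hfS x).2
    rw [if_neg h2, Function.leftInverse_invFun hf x] at h1
    exact hd2 _ h1.symm

/-- If the type of `v` over `B ∪ {p}` is finite and over `B` is infinite, it has one realization. -/
lemma unique_of_finite {m : ℕ} {L : MLang m} {G : LGraph L} (hG : G.Homogeneous)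
    (hc : Countable G.V) (B : Finset G.V) (v p : G.V)
    (hBv : ∀ b ∈ B, G.part b ≠ G.part v) (hp : p ∉ B) (hpv : G.part p ≠ G.part v)
    (hU : (Rl G B v).Infinite)
    (hfin : {u | u ∈ Rl G B v ∧ G.colour u p = G.colour v p}.Finite) :
    ∀ u ∈ Rl G B v, G.colour u p = G.colour v p → u = v := by
  classical
  have hUB : ∀ u ∈ Rl G B v, u ∉ B := fun u hu hb => hBv u hb hu.1
  have hvU : v ∈ Rl G B v := Rl_self B v
  intro u2 hu2 hc2
  by_contra hne
  set Sp := {u | u ∈ Rl G B v ∧ G.colour u p = G.colour v p} with hSp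
  have hinf := hU.sdiff hfin
  obtain ⟨u3, hu3, hu3S⟩ := hinf.nonempty
  have hc3 : G.colour u3 p ≠ G.colour v p := fun h => hu3S ⟨hu3, h⟩
  have h3v : u3 ≠ v := by rintro rfl; exact hc3 rfl
  have hRR : ∀ u ∈ Rl G B v, ∀ w ∈ Rl G B v, w ∈ Rl G B u := by
    intro u hu w hw
    refine ⟨hw.1.trans hu.1.symm, fun b hb hbu => ?_⟩
    rw [hw.2 b hb (by rwa [← hu.1]), hu.2 b hb (by rwa [← hu.1])]
  obtain ⟨g1, hg1, hg1B, hg1P⟩ := ext_aut hG B {(v, v), (u2, u3)} (by simp) (by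
      rintro q (rfl | rfl)
      · exact ⟨hUB _ hvU, hUB _ hvU, Rl_self _ _⟩
      · exact ⟨hUB _ hu2, hUB _ hu3, hRR _ hu2 _ hu3⟩) (by
      rintro q (rfl | rfl) r (rfl | rfl)
      · simp
      · exact ⟨by simp [Ne.symm hne, h3v.symm], fun h => absurd hu2.1.symm h⟩
      · exact ⟨by simp [hne, h3v], fun h => absurd hu2.1 h⟩
      · simp)
  have g1v : g1 v = v := hg1P (v, v) (by simp)
  have g1u : g1 u2 = u3 := hg1P (u2, u3) (by simp)
  obtain ⟨f, hf, hfS⟩ := exists_inj hc hinf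
  obtain ⟨g2, hg2, hg2B, hg2P⟩ := ext_aut hG B ((fun u => (u, f u)) '' Sp) (hfin.image _) (by
      rintro _ ⟨u, hu, rfl⟩
      exact ⟨hUB _ hu.1, hUB _ (hfS u).1, hRR _ hu.1 _ (hfS u).1⟩) (by
      rintro _ ⟨u, hu, rfl⟩ _ ⟨w, hw, rfl⟩
      exact ⟨hf.eq_iff.symm, fun h => absurd (hu.1.1.trans hw.1.1.symm) h⟩)
  have g2u : ∀ u ∈ Sp, g2 u = f u := fun u hu => hg2P (u, f u) ⟨u, hu, rfl⟩
  have hpR := Rl_self (G := G) B p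
  have hw' : G.colour v (g1 p) = G.colour v p := by
    conv_lhs => rw [← g1v]
    exact hg1.2 _ _ hpv.symm
  have hw'3 : G.colour u3 (g1 p) = G.colour v p := by
    rw [← g1u, hg1.2 _ _ (by rw [hu2.1]; exact hpv.symm), hc2]
  have hw'p : g1 p ≠ p := by
    intro h; rw [h] at hw'3; exact hc3 hw'3
  have hw'' : ∀ u ∈ Rl G B v, G.colour u (g2 p) = G.colour v p → u ∉ Sp := by
    intro u hu hcu huS
    have hg2s : ∀ b ∈ B, g2.symm b = b := fun b hb => by
      rw [Equiv.symm_apply_eq, hg2B b hb]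
    have hAs : Aut G g2.symm := by
      refine ⟨fun x => ?_, fun x y hxy => ?_⟩
      · have := hg2.1 (g2.symm x); simpa using this.symm
      · have h1 := hg2.1 (g2.symm x)
        have h2 := hg2.1 (g2.symm y)
        have := hg2.2 (g2.symm x) (g2.symm y) (by rw [← h1, ← h2]; simpa using hxy)
        simpa using this.symm
    have hmem : g2.symm u ∈ Sp := by
      refine ⟨aut_Rl hAs hg2s hu, ?_⟩
      have := hAs.2 u (g2 p) (by rw [hu.1, hg2.1]; exact hpv.symm)
      rw [Equiv.symm_apply_apply] at this
      rw [this, hcu]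
    have := g2u _ hmem
    rw [Equiv.apply_symm_apply] at this
    exact (hfS (g2.symm u)).2 (this ▸ huS)
  have hw''p : g2 p ≠ p := by
    intro h
    exact hw'' v hvU (by rw [h]) ⟨hvU, rfl⟩
  have hrr : ∀ w1 ∈ Rl G B p, ∀ w2 ∈ Rl G B p, w2 ∈ Rl G B w1 := by
    intro u hu w hw
    refine ⟨hw.1.trans hu.1.symm, fun b hb hbu => ?_⟩
    rw [hw.2 b hb (by rwa [← hu.1]), hu.2 b hb (by rwa [← hu.1])]
  obtain ⟨g3, hg3, hg3B, hg3P⟩ := ext_aut hG B {(p, p), (g1 p, g2 p)} (by simp) (by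
      rintro q (rfl | rfl)
      · exact ⟨hp, hp, Rl_self _ _⟩
      · exact ⟨aut_notMem hg1B hp, aut_notMem hg2B hp,
          hrr _ (aut_Rl hg1 hg1B hpR) _ (aut_Rl hg2 hg2B hpR)⟩) (by
      rintro q (rfl | rfl) r (rfl | rfl)
      · simp
      · exact ⟨by simp [hw'p.symm, hw''p.symm], fun h => absurd (hg1.1 p).symm h⟩
      · exact ⟨by simp [hw'p, hw''p], fun h => absurd (hg1.1 p) h⟩
      · simp)
  have g3p : g3 p = p := hg3P (p, p) (by simp)
  have g3w : g3 (g1 p) = g2 p := hg3P (g1 p, g2 p) (by simp)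
  have h3U : g3 v ∈ Rl G B v := aut_Rl hg3 hg3B hvU
  refine hw'' (g3 v) h3U ?_ ⟨h3U, ?_⟩
  · rw [← g3w, hg3.2 _ _ (by rw [hg1.1]; exact hpv.symm), hw']
  · conv_lhs => rw [← g3p]
    exact hg3.2 _ _ hpv.symm

lemma Rl_trans {m : ℕ} {L : MLang m} {G : LGraph L} {B : Finset G.V} {v u w : G.V}
    (hu : u ∈ Rl G B v) (hw : w ∈ Rl G B v) : w ∈ Rl G B u := by
  refine ⟨hw.1.trans hu.1.symm, fun b hb hbu => ?_⟩
  rw [hw.2 b hb (by rwa [← hu.1]), hu.2 b hb (by rwa [← hu.1])]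

lemma step {m : ℕ} {L : MLang m} {G : LGraph L} (hG : G.Homogeneous)
    (hc : Countable G.V) (B : Finset G.V) (v p q : G.V)
    (hBv : ∀ b ∈ B, G.part b ≠ G.part v) (hp : p ∉ B) (hq : q ∉ B)
    (hpv : G.part p ≠ G.part v) (hqv : G.part q ≠ G.part v) (hpq : G.part p ≠ G.part q)
    (hq_inf : {u | u ∈ Rl G B v ∧ G.colour u q = G.colour v q}.Infinite)
    (hp_inf : {u | u ∈ Rl G B v ∧ G.colour u p = G.colour v p}.Infinite)
    (huniq : ∀ u ∈ Rl G B v, G.colour u p = G.colour v p → G.colour u q = G.colour v q → u = v) :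
    False := by
  classical
  have hUB : ∀ u ∈ Rl G B v, u ∉ B := fun u hu hb => hBv u hb hu.1
  have hvU : v ∈ Rl G B v := Rl_self B v
  have hpR := Rl_self (G := G) B p
  have hqR := Rl_self (G := G) B q
  have key : ∀ x ∈ Rl G B v, G.colour x q = G.colour v q → ∀ y ∈ Rl G B p, y ∉ B → y ≠ p →
      G.colour v y = G.colour v p → G.colour x y = G.colour v p := by
    intro x hx hxq y hy hyB hyp hvy
    obtain ⟨h, hh, hhB, hhP⟩ := ext_aut hG B {(v, x), (q, q)} (by simp) (by
        rintro r (rfl | rfl)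
        · exact ⟨hUB _ hvU, hUB _ hx, hx⟩
        · exact ⟨hq, hq, hqR⟩) (by
        rintro r (rfl | rfl) s (rfl | rfl)
        · simp
        · refine ⟨⟨fun e => absurd (congrArg G.part e) hqv.symm,
            fun e => absurd ((hx.1.symm.trans (congrArg G.part e))) hqv.symm⟩, fun _ => hxq⟩
        · refine ⟨⟨fun e => absurd (congrArg G.part e) hqv,
            fun e => absurd ((congrArg G.part e).trans hx.1) hqv⟩, fun _ => ?_⟩
          rw [G.colour_symm, G.colour_symm q v]; exact hxq
        · simp)
    have hv : h v = x := hhP (v, x) (by simp)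
    have hhq : h q = q := hhP (q, q) (by simp)
    have hyxR : h p ∈ Rl G B p := aut_Rl hh hhB hpR
    have hyxB : h p ∉ B := aut_notMem hhB hp
    have hyxq : G.colour (h p) q = G.colour p q := by
      conv_lhs => rw [← hhq]
      exact hh.2 _ _ hpq
    have hxyx : G.colour x (h p) = G.colour v p := by
      rw [← hv]; exact hh.2 _ _ hpv.symm
    by_cases hyy : y = h p
    · rw [hyy, hxyx]
    obtain ⟨g, hg, hgB, hgP⟩ := ext_aut hG B {(q, q), (p, h p), (y, y)} (by simp) (by
        rintro r (rfl | rfl | rfl)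
        · exact ⟨hq, hq, hqR⟩
        · exact ⟨hp, hyxB, hyxR⟩
        · exact ⟨hyB, hyB, Rl_self _ _⟩) (by
        have e1 : G.part (h p) ≠ G.part q := by rw [hyxR.1]; exact hpq
        have e2 : G.part y ≠ G.part q := by rw [hy.1]; exact hpq
        rintro r (rfl | rfl | rfl) s (rfl | rfl | rfl)
        · simp
        · refine ⟨⟨fun e => absurd (congrArg G.part e) hpq.symm,
            fun e => absurd (congrArg G.part e) e1.symm⟩, fun _ => ?_⟩
          rw [G.colour_symm, G.colour_symm q p]; exact hyxq
        · simp
        · refine ⟨⟨fun e => absurd (congrArg G.part e) hpq,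
            fun e => absurd (congrArg G.part e) e1⟩, fun _ => hyxq⟩
        · simp
        · exact ⟨by simp [Ne.symm hyp, Ne.symm hyy], fun e => absurd hy.1.symm e⟩
        · simp
        · exact ⟨by simp [hyp, hyy], fun e => absurd hy.1 e⟩
        · simp)
    have gq : g q = q := hgP (q, q) (by simp)
    have gp : g p = h p := hgP (p, h p) (by simp)
    have gy : g y = y := hgP (y, y) (by simp)
    have hgv : g v = x := by
      obtain ⟨w, hw⟩ := h.surjective (g v)
      have hwpart : G.part w = G.part v := by
        rw [← hh.1 w, hw, hg.1]
      have hwv : w = v := by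
        refine huniq w ⟨hwpart, fun b hb hbv => ?_⟩ ?_ ?_
        · rw [← hh.2 w b (by rw [hwpart]; exact hbv.symm), hw, hhB b hb]
          conv_lhs => rw [← hgB b hb]
          exact hg.2 _ _ hbv.symm
        · rw [← hh.2 w p (by rw [hwpart]; exact hpv.symm), hw, ← gp]
          exact hg.2 _ _ hpv.symm
        · rw [← hh.2 w q (by rw [hwpart]; exact hqv.symm), hw, hhq]
          conv_lhs => rw [← gq]
          exact hg.2 _ _ hqv.symm
      rw [← hw, hwv, hv]
    rw [← hvy, ← hgv]
    conv_lhs => rw [← gy]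
    exact hg.2 _ _ (by rw [hy.1]; exact hpv.symm)
  obtain ⟨x2, ⟨hx2, hx2q⟩, hx2v⟩ := (hq_inf.sdiff (Set.finite_singleton v)).nonempty
  obtain ⟨x3, ⟨hx3, hx3q⟩, hx3v⟩ := (hq_inf.sdiff (Set.toFinite {v, x2})).nonempty
  obtain ⟨x4, ⟨hx4, hx4p⟩, hx4v⟩ := (hp_inf.sdiff (Set.finite_singleton v)).nonempty
  simp only [Set.mem_singleton_iff, Set.mem_insert_iff, not_or] at hx2v hx3v hx4v
  have hx2p : G.colour x2 p ≠ G.colour v p := fun h => hx2v (huniq _ hx2 h hx2q)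
  have hx3p : G.colour x3 p ≠ G.colour v p := fun h => hx3v.1 (huniq _ hx3 h hx3q)
  have hx42 : x4 ≠ x2 := by rintro rfl; exact hx2p hx4p
  obtain ⟨g, hg, hgB, hgP⟩ := ext_aut hG B {(v, v), (x2, x2), (x3, x4)} (by simp) (by
      rintro r (rfl | rfl | rfl)
      · exact ⟨hUB _ hvU, hUB _ hvU, hvU⟩
      · exact ⟨hUB _ hx2, hUB _ hx2, Rl_self _ _⟩
      · exact ⟨hUB _ hx3, hUB _ hx4, Rl_trans hx3 hx4⟩) (by
      rintro r hr s hs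
      constructor
      · obtain ⟨h31, h32⟩ := hx3v
        rcases hr with rfl | rfl | rfl <;> rcases hs with rfl | rfl | rfl <;>
          simp [Ne.symm hx42, hx42, hx4v, Ne.symm hx4v, h31, h32, Ne.symm h31, Ne.symm h32]
      · intro h
        refine absurd ?_ h
        have aux : ∀ r ∈ ({(v, v), (x2, x2), (x3, x4)} : Set (G.V × G.V)),
            G.part r.1 = G.part v := by
          rintro r (rfl | rfl | rfl)
          · rfl
          · exact hx2.1
          · exact hx3.1
        exact (aux r hr).trans (aux s hs).symm)
  have gv : g v = v := hgP (v, v) (by simp)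
  have g2 : g x2 = x2 := hgP (x2, x2) (by simp)
  have g3 : g x3 = x4 := hgP (x3, x4) (by simp)
  have hgpv : G.colour v (g p) = G.colour v p := by
    conv_lhs => rw [← gv]
    exact hg.2 _ _ hpv.symm
  have hgp2 : G.colour x2 (g p) = G.colour x2 p := by
    conv_lhs => rw [← g2]
    exact hg.2 _ _ (by rw [hx2.1]; exact hpv.symm)
  have hgp : g p = p := by
    by_contra hne
    refine hx2p ?_
    rw [← hgp2]
    exact key x2 hx2 hx2q (g p) (aut_Rl hg hgB hpR) (aut_notMem hgB hp) hne hgpv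
  have := hg.2 x3 p (by rw [hx3.1]; exact hpv.symm)
  rw [g3, hgp, hx4p] at this
  exact hx3p this.symm

lemma infinite_Rl {m : ℕ} {L : MLang m} {G : LGraph L} (hG : G.Homogeneous) (hgen : G.Generic) :
    ∀ (n : ℕ) (B : Finset G.V), B.card = n → ∀ v, (Rl G B v).Infinite := by
  classical
  intro n
  induction n using Nat.strong_induction_on with
  | _ n ih =>
  intro B hn v
  by_cases hBv : ∀ b ∈ B, G.part b ≠ G.part v
  swap
  · push Not at hBv
    obtain ⟨b, hb, hbv⟩ := hBv
    refine (ih _ (by rw [← hn]; exact Finset.card_erase_lt_of_mem hb) (B.erase b) rfl v).mono ?_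
    rintro w ⟨hw, hw2⟩
    refine ⟨hw, fun a ha hav => hw2 a (Finset.mem_erase.2 ⟨?_, ha⟩) hav⟩
    rintro rfl; exact hav hbv
  by_cases hemp : B = ∅
  · subst hemp
    refine (hgen.2.1 (G.part v)).mono ?_
    intro w hw
    exact ⟨hw, by simp⟩
  obtain ⟨p, hp⟩ := Finset.nonempty_iff_ne_empty.2 hemp
  by_cases hone : ∀ b ∈ B, G.part b = G.part p
  · exact infinite_base hgen B v _ (hBv p hp) hone
  push Not at hone
  obtain ⟨q, hq, hqp⟩ := hone
  intro hfin
  have hne : q ≠ p := fun h => hqp (congrArg _ h)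
  have e1 : (Rl G (B.erase p) v).Infinite :=
    ih _ (by rw [← hn]; exact Finset.card_erase_lt_of_mem hp) _ rfl v
  have e2 : (Rl G (B.erase q) v).Infinite :=
    ih _ (by rw [← hn]; exact Finset.card_erase_lt_of_mem hq) _ rfl v
  have hpv := hBv p hp
  have hqv := hBv q hq
  have huniq := unique_of_finite hG hgen.1 (B.erase p) v p
    (fun b hb => hBv b (Finset.mem_of_mem_erase hb)) (by simp) hpv e1 (by
      refine hfin.subset ?_
      rintro u ⟨hu, hup⟩
      refine ⟨hu.1, fun b hb hbv => ?_⟩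
      by_cases h : b = p
      · rw [h, hup]
      · exact hu.2 b (Finset.mem_erase.2 ⟨h, hb⟩) hbv)
  refine step hG hgen.1 ((B.erase p).erase q) v p q
    (fun b hb => hBv b (Finset.mem_of_mem_erase (Finset.mem_of_mem_erase hb)))
    (by simp) (by simp) hpv hqv (Ne.symm hqp) (e1.mono ?_) (e2.mono ?_) ?_
  · rintro u ⟨hu, hu2⟩
    exact ⟨⟨hu, fun b hb => hu2 b (Finset.mem_of_mem_erase hb)⟩,
      hu2 q (Finset.mem_erase.2 ⟨hne, hq⟩) hqv⟩
  · rintro u ⟨hu, hu2⟩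
    refine ⟨⟨hu, fun b hb => hu2 b ?_⟩, hu2 p (Finset.mem_erase.2 ⟨hne.symm, hp⟩) hpv⟩
    simp only [Finset.mem_erase] at hb ⊢
    exact ⟨hb.1, hb.2.2⟩
  · intro u hu hup huq
    refine huniq u ⟨hu.1, fun b hb hbv => ?_⟩ hup
    by_cases h : b = q
    · rw [h, huq]
    · exact hu.2 b (Finset.mem_erase.2 ⟨h, hb⟩) hbv

/-- Members of `O(G)` are monic. -/
lemma monic_of_minOmitted {m : ℕ} {L : MLang m} {G : LGraph L} (hG : G.Homogeneous)
    (hgen : G.Generic) (A : LGraph L) (hA : G.MinOmitted A) : A.Monic := by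
  classical
  obtain ⟨hfin, hom, hmin⟩ := hA
  intro x y hxy
  by_contra hne
  obtain ⟨f, hf1, hf2, hf3⟩ := hmin {x}ᶜ (by simp)
  obtain ⟨g, hg1, hg2, hg3⟩ := hmin {y}ᶜ (by simp)
  have hv : Nonempty G.V := ⟨g ⟨x, hne⟩⟩
  obtain ⟨F, hF⟩ : ∃ F : A.V → G.V, ∀ a (h : a ≠ x), F a = f ⟨a, h⟩ :=
    ⟨fun a => if h : a ≠ x then f ⟨a, h⟩ else hv.some, fun a h => dif_pos h⟩
  obtain ⟨K, hK⟩ : ∃ F : A.V → G.V, ∀ a (h : a ≠ y), F a = g ⟨a, h⟩ :=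
    ⟨fun a => if h : a ≠ y then g ⟨a, h⟩ else hv.some, fun a h => dif_pos h⟩
  have F1 : ∀ a b, a ≠ x → b ≠ x → (F a = F b ↔ a = b) := by
    intro a b ha hb
    rw [hF a ha, hF b hb]
    exact ⟨fun h => congrArg Subtype.val (hf1 h), fun h => by subst h; rfl⟩
  have K1 : ∀ a b, a ≠ y → b ≠ y → (K a = K b ↔ a = b) := by
    intro a b ha hb
    rw [hK a ha, hK b hb]
    exact ⟨fun h => congrArg Subtype.val (hg1 h), fun h => by subst h; rfl⟩
  have F2 : ∀ a, a ≠ x → G.part (F a) = A.part a := fun a ha => by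
    rw [hF a ha]; exact hf2 _
  have K2 : ∀ a, a ≠ y → G.part (K a) = A.part a := fun a ha => by
    rw [hK a ha]; exact hg2 _
  have F3 : ∀ a b, a ≠ x → b ≠ x → A.part a ≠ A.part b →
      G.colour (F a) (F b) = A.colour a b := by
    intro a b ha hb hab
    rw [hF a ha, hF b hb]; exact hf3 _ _ hab
  have K3 : ∀ a b, a ≠ y → b ≠ y → A.part a ≠ A.part b →
      G.colour (K a) (K b) = A.colour a b := by
    intro a b ha hb hab
    rw [hK a ha, hK b hb]; exact hg3 _ _ hab
  obtain ⟨ψ, hψ, -, hψP⟩ := ext_aut hG ∅ ((fun a => (K a, F a)) '' {a | a ≠ x ∧ a ≠ y})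
    (Set.toFinite _) (by
      rintro _ ⟨a, ⟨hax, hay⟩, rfl⟩
      exact ⟨by simp, by simp, (F2 a hax).trans (K2 a hay).symm, by simp⟩) (by
      rintro _ ⟨a, ⟨hax, hay⟩, rfl⟩ _ ⟨b, ⟨hbx, hby⟩, rfl⟩
      refine ⟨(K1 a b hay hby).trans (F1 a b hax hbx).symm, fun h => ?_⟩
      have h : G.part (K a) ≠ G.part (K b) := h
      rw [K2 a hay, K2 b hby] at h
      exact (F3 a b hax hbx h).trans (K3 a b hay hby h).symm)
  have hψ' : ∀ a, a ≠ x → a ≠ y → ψ (K a) = F a := fun a hax hay =>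
    hψP (K a, F a) ⟨a, ⟨hax, hay⟩, rfl⟩
  haveI := Fintype.ofFinite A.V
  obtain ⟨w, ⟨hw1, hw2⟩, hwB⟩ := ((infinite_Rl hG hgen _ ((Finset.univ.erase x).image F) rfl
    (ψ (K x))).sdiff ((Finset.univ.erase x).image F).finite_toSet).nonempty
  have hwF : ∀ a, a ≠ x → w ≠ F a := by
    rintro a ha rfl
    exact hwB (by
      simp only [Finset.coe_image, Set.mem_image]
      exact ⟨a, by simp [ha], rfl⟩)
  have hpx : G.part (ψ (K x)) = A.part x := by rw [hψ.1, K2 x hne]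
  have hwc : ∀ a, A.part a ≠ A.part x → G.colour w (F a) = A.colour x a := by
    intro a ha
    have hax : a ≠ x := fun h => ha (congrArg _ h)
    have hay : a ≠ y := fun h => ha ((congrArg _ h).trans hxy.symm)
    rw [hw2 (F a) (Finset.mem_image.2 ⟨a, by simp [hax], rfl⟩) (by rw [F2 a hax, hpx]; exact ha),
      ← hψ' a hax hay, hψ.2 _ _ (by rw [K2 x hne, K2 a hay]; exact ha.symm),
      K3 x a hne hay ha.symm]
  apply hom
  refine ⟨Function.update F x w, ?_, ?_, ?_⟩
  · intro a b hab
    by_cases ha : a = x <;> by_cases hb : b = x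
    · rw [ha, hb]
    · subst ha
      rw [Function.update_self, Function.update_of_ne hb] at hab
      exact absurd hab (hwF b hb)
    · subst hb
      rw [Function.update_self, Function.update_of_ne ha] at hab
      exact absurd hab.symm (hwF a ha)
    · rw [Function.update_of_ne ha, Function.update_of_ne hb] at hab
      exact (F1 a b ha hb).1 hab
  · intro a
    by_cases ha : a = x
    · subst ha
      rw [Function.update_self, hw1, hpx]
    · rw [Function.update_of_ne ha, F2 a ha]
  · intro a b hab
    by_cases ha : a = x <;> by_cases hb : b = x
    · exact absurd (by rw [ha, hb]) hab
    · subst ha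
      rw [Function.update_self, Function.update_of_ne hb]
      exact hwc b hab.symm
    · subst hb
      rw [Function.update_self, Function.update_of_ne ha, G.colour_symm, A.colour_symm]
      exact hwc a hab
    · rw [Function.update_of_ne ha, Function.update_of_ne hb]
      exact F3 a b ha hb hab

/-- A triangle agreeing with three vertices of `A`, not all of `A`, is realized. -/
lemma triangle_realized {m : ℕ} {L : MLang m} {G A T : LGraph L} (hA : G.MinOmitted A)
    {i j k : Fin m} (hij : i ≠ j) (hik : i ≠ k) (hjk : j ≠ k) (hT : T.IsTriangleOn i j k)
    {a b c d : A.V} (ha : A.part a = i) (hb : A.part b = j) (hc : A.part c = k)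
    (hd : A.part d ≠ i ∧ A.part d ≠ j ∧ A.part d ≠ k)
    (hab : ∀ x y, T.part x = i → T.part y = j → T.colour x y = A.colour a b)
    (hac : ∀ x y, T.part x = i → T.part y = k → T.colour x y = A.colour a c)
    (hbc : ∀ x y, T.part x = j → T.part y = k → T.colour x y = A.colour b c) :
    G.Realized T := by
  classical
  obtain ⟨f, hf1, hf2, hf3⟩ := hA.2.2 {d}ᶜ (by simp)
  have had : a ≠ d := by rintro rfl; exact hd.1 ha
  have hbd : b ≠ d := by rintro rfl; exact hd.2.1 hb
  have hcd : c ≠ d := by rintro rfl; exact hd.2.2 hc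
  obtain ⟨hmon, hparts, -⟩ := hT
  let t : T.V → (({d}ᶜ : Set A.V)) := fun x =>
    if T.part x = i then ⟨a, had⟩ else if T.part x = j then ⟨b, hbd⟩ else ⟨c, hcd⟩
  have ti : ∀ x, T.part x = i → t x = ⟨a, had⟩ := fun x hx => if_pos hx
  have tj : ∀ x, T.part x = j → t x = ⟨b, hbd⟩ := fun x hx => by
    simp only [t]; rw [if_neg (by rw [hx]; exact hij.symm), if_pos hx]
  have tk : ∀ x, T.part x = k → t x = ⟨c, hcd⟩ := fun x hx => by
    simp only [t]; rw [if_neg (by rw [hx]; exact hik.symm), if_neg (by rw [hx]; exact hjk.symm)]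
  have tp : ∀ x, A.part (t x).1 = T.part x := by
    intro x
    rcases hparts x with h | h | h
    · rw [ti x h, h, ha]
    · rw [tj x h, h, hb]
    · rw [tk x h, h, hc]
  have tc : ∀ x y, T.part x ≠ T.part y → A.colour (t x).1 (t y).1 = T.colour x y := by
    intro x y hxy
    rcases hparts x with h | h | h <;> rcases hparts y with h' | h' | h'
    · exact absurd (h.trans h'.symm) hxy
    · rw [ti x h, tj y h', hab x y h h']
    · rw [ti x h, tk y h', hac x y h h']
    · rw [tj x h, ti y h', T.colour_symm, hab y x h' h, A.colour_symm]
    · exact absurd (h.trans h'.symm) hxy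
    · rw [tj x h, tk y h', hbc x y h h']
    · rw [tk x h, ti y h', T.colour_symm, hac y x h' h, A.colour_symm]
    · rw [tk x h, tj y h', T.colour_symm, hbc y x h' h, A.colour_symm]
    · exact absurd (h.trans h'.symm) hxy
  refine ⟨fun x => f (t x), ?_, ?_, ?_⟩
  · intro x y hxy
    have := hf1 hxy
    refine hmon x y ?_
    rw [← tp x, ← tp y, this]
  · intro x
    rw [← tp x]; exact hf2 (t x)
  · intro x y hxy
    rw [← tc x y hxy]
    refine hf3 (t x) (t y) ?_
    change A.part (t x).1 ≠ A.part (t y).1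
    rwa [tp, tp]

end OmissionProof

/-- If `O(G)` contains a `C_{ij}^{kl}`-omission set with code
`(i,j,k,l; cik, cil, cjk, cjl)`, then no member of `O(G)` has vertices in all four
parts `V_i, V_j, V_k, V_l` while simultaneously having `E_{ik}`-colour `cik`,
`E_{il}`-colour `cil`, `E_{jk}`-colour `cjk` and `E_{jl}`-colour `cjl`. -/
theorem no_minOmitted_agreeing_with_code
    {m : ℕ} {L : MLang m} (hm : 2 ≤ m)
    (G : LGraph L) (hG : G.Homogeneous) (hgen : G.Generic)
    (i j k l : Fin m) (hij : i ≠ j) (hik : i ≠ k) (hil : i ≠ l)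
    (hjk : j ≠ k) (hjl : j ≠ l) (hkl : k ≠ l)
    (S : Set (LGraph L)) (hS : ∀ A ∈ S, G.MinOmitted A)
    (cik cil cjk cjl : ℕ) (hOm : IsOmissionSet S i j k l cik cil cjk cjl) :
    ∀ A : LGraph L, G.MinOmitted A →
      ¬ ((∃ x : A.V, A.part x = i) ∧ (∃ x : A.V, A.part x = j) ∧
         (∃ x : A.V, A.part x = k) ∧ (∃ x : A.V, A.part x = l) ∧
         A.Covers i k cik ∧ A.Covers i l cil ∧ A.Covers j k cjk ∧ A.Covers j l cjl) := by
  intro A hA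
  rintro ⟨⟨a, ha⟩, ⟨b, hb⟩, ⟨c, hc⟩, ⟨d, hd⟩, ⟨x1, y1, h1, h1', e1⟩, ⟨x2, y2, h2, h2', e2⟩,
    ⟨x3, y3, h3, h3', e3⟩, ⟨x4, y4, h4, h4', e4⟩⟩
  have hmon := OmissionProof.monic_of_minOmitted hG hgen A hA
  rw [hmon x1 a (h1.trans ha.symm), hmon y1 c (h1'.trans hc.symm)] at e1
  rw [hmon x2 a (h2.trans ha.symm), hmon y2 d (h2'.trans hd.symm)] at e2
  rw [hmon x3 b (h3.trans hb.symm), hmon y3 c (h3'.trans hc.symm)] at e3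
  rw [hmon x4 b (h4.trans hb.symm), hmon y4 d (h4'.trans hd.symm)] at e4
  obtain ⟨⟨hSm, hcov⟩, htri, o1, o2, o3, o4⟩ := hOm
  have hmem : A.colour a b ∈ L.C i j := by
    have := A.colour_mem a b (by rw [ha, hb]; exact hij)
    rwa [ha, hb] at this
  obtain ⟨T, hT, x, y, hx, hy, hxy⟩ := hcov _ hmem
  have hab : ∀ x y, T.part x = i → T.part y = j → T.colour x y = A.colour a b := by
    intro x' y' hx' hy'
    rw [hSm T hT x' x (hx'.trans hx.symm), hSm T hT y' y (hy'.trans hy.symm), hxy]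
  refine (hS T hT).2.1 ?_
  rcases htri T hT with h | h
  · exact OmissionProof.triangle_realized (d := d) hA hij hik hjk h ha hb hc
      (by rw [hd]; exact ⟨hil.symm, hjl.symm, hkl.symm⟩) hab
      (fun x y hx hy => (o1 T hT x y hx hy).trans e1.symm)
      (fun x y hx hy => (o3 T hT x y hx hy).trans e3.symm)
  · exact OmissionProof.triangle_realized (d := c) hA hij hil hjl h ha hb hd
      (by rw [hc]; exact ⟨hik.symm, hjk.symm, hkl⟩) hab
      (fun x y hx hy => (o2 T hT x y hx hy).trans e2.symm)
      (fun x y hx hy => (o4 T hT x y hx hy).trans e4.symm)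
end
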